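/- Assume GRH for L(s,χ), χ primitive mod q > 1. Let t ≥ 2, 4 ≤ x ≤ t², σ₁ = 1/2 + 1/log x, and set M₂ = (σ₁ - 1/2)·(L'/L)(σ₁+it,χ). Then |M₂| ≤ [(1/e + 1/e²)/(1 - (1/e)(1+1/e))]·(1/2)·(log(q(t+1))/log x) + O((1/log x)·|∑_{n<x²} Λ_x(n)χ(n) n^{-(σ₁+it)}|), the implied constant being absolute. -/

import Mathlib

open Complex Real ArithmeticFunction

/-- The generalized Riemann hypothesis for the Dirichlet L-function of `χ`. -/
def GRH {q : ℕ} [NeZero q] (χ : DirichletCharacter ℂ q) : Prop :=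
  ∀ ρ : ℂ, DirichletCharacter.LFunction χ ρ = 0 → 0 < ρ.re → ρ.re < 1 → ρ.re = 1 / 2

/-- Selberg's truncated von Mangoldt function `Λ_x`. -/
noncomputable def Lambdax (x : ℝ) (n : ℕ) : ℝ :=
  if (n : ℝ) ≤ x then vonMangoldt n
  else if (n : ℝ) ≤ x ^ 2 then vonMangoldt n * (Real.log (x ^ 2 / n) / Real.log x)
  else 0

/-- The Dirichlet polynomial `∑_{n<x²} Λ_x(n) χ(n) n^{-s}`. -/
noncomputable def Dpoly {q : ℕ} (χ : DirichletCharacter ℂ q) (x : ℝ) (s : ℂ) : ℂ :=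
  ∑ n ∈ Finset.filter (fun n : ℕ => (n : ℝ) < x ^ 2) (Finset.range (⌈x ^ 2⌉₊ + 1)),
    (Lambdax x n : ℂ) * χ n / (n : ℂ) ^ s

section
open Filter MeasureTheory Set Topology

/-- The integral of `g` along the vertical line `re z = c`, parametrised by the imaginary part. -/
noncomputable def vInt (g : ℂ → ℂ) (c : ℝ) : ℂ := ∫ y : ℝ, g (c + y * Complex.I)

lemma vInt_congr {f g : ℂ → ℂ} {c : ℝ} (h : ∀ z : ℂ, z.re = c → f z = g z) :
    vInt f c = vInt g c := by
  unfold vInt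
  congr 1
  ext y
  exact h _ (by simp)

lemma integrable_decay : Integrable (fun y : ℝ ↦ (1 + |y|) ^ (-(3 / 2) : ℝ)) := by
  have := integrable_one_add_norm (E := ℝ) (μ := volume) (r := 3 / 2) (by norm_num)
  simpa using this

lemma decay_norm_le_decay_im (z : ℂ) :
    (1 + ‖z‖) ^ (-(3 / 2) : ℝ) ≤ (1 + |z.im|) ^ (-(3 / 2) : ℝ) :=
  Real.rpow_le_rpow_of_nonpos (by positivity) (by linarith [Complex.abs_im_le_norm z]) (by norm_num)

lemma le_decay_im {g : ℂ → ℂ} {C : ℝ} {z : ℂ} (h : ‖g z‖ ≤ C * (1 + ‖z‖) ^ (-(3 / 2) : ℝ)) :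
    ‖g z‖ ≤ C * (1 + |z.im|) ^ (-(3 / 2) : ℝ) := by
  have hC : 0 ≤ C := by
    by_contra hC
    have : C * (1 + ‖z‖) ^ (-(3 / 2) : ℝ) < 0 := mul_neg_of_neg_of_pos (not_le.mp hC) (by positivity)
    linarith [norm_nonneg (g z)]
  exact h.trans (mul_le_mul_of_nonneg_left (decay_norm_le_decay_im z) hC)

lemma continuous_vertical {g : ℂ → ℂ} {c : ℝ} {S : Set ℂ} (hg : ContinuousOn g S)
    (hS : ∀ z : ℂ, z.re = c → z ∈ S) : Continuous fun y : ℝ ↦ g (c + y * Complex.I) :=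
  hg.comp_continuous (by fun_prop) fun y ↦ hS _ (by simp)

lemma integrable_vertical {g : ℂ → ℂ} {c C : ℝ} {S : Set ℂ} (hg : ContinuousOn g S)
    (hS : ∀ z : ℂ, z.re = c → z ∈ S)
    (hb : ∀ z : ℂ, z.re = c → ‖g z‖ ≤ C * (1 + ‖z‖) ^ (-(3 / 2) : ℝ)) :
    Integrable fun y : ℝ ↦ g (c + y * Complex.I) := by
  refine (integrable_decay.const_mul C).mono' (continuous_vertical hg hS).aestronglyMeasurable ?_
  refine Eventually.of_forall fun y ↦ ?_
  simpa using le_decay_im (hb (c + y * Complex.I) (by simp))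

lemma tendsto_decay_atTop : Tendsto (fun T : ℝ ↦ (1 + |T|) ^ (-(3 / 2) : ℝ)) atTop (𝓝 0) :=
  (tendsto_rpow_neg_atTop (by norm_num)).comp
    (tendsto_atTop_add_const_left _ _ tendsto_abs_atTop_atTop)

/-- Shifting the line of integration inside a strip of holomorphy. -/
lemma vInt_eq_of_strip {g : ℂ → ℂ} {a b C : ℝ} (hab : a ≤ b)
    (hg : DifferentiableOn ℂ g {z | a ≤ z.re ∧ z.re ≤ b})
    (hb : ∀ z : ℂ, a ≤ z.re → z.re ≤ b → ‖g z‖ ≤ C * (1 + ‖z‖) ^ (-(3 / 2) : ℝ)) :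
    vInt g a = vInt g b := by
  have hrect : ∀ T : ℝ, 0 ≤ T →
      Complex.I • (∫ y in (-T)..T, g (b + y * Complex.I))
        - Complex.I • (∫ y in (-T)..T, g (a + y * Complex.I))
      = (∫ u in a..b, g (u + (T : ℝ) * Complex.I)) - ∫ u in a..b, g (u + (-T : ℝ) * Complex.I) := by
    intro T hT
    have := Complex.integral_boundary_rect_eq_zero_of_continuousOn_of_differentiableOn g
      (a + (-T : ℝ) * Complex.I) (b + T * Complex.I) ?_ ?_
    · simp only [add_re, ofReal_re, mul_re, I_re, mul_zero, ofReal_im, I_im, mul_one, sub_self,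
        add_zero, add_im, mul_im, zero_add] at this
      linear_combination this
    · refine hg.continuousOn.mono fun z hz ↦ ?_
      have := hz.1
      simp [uIcc_of_le hab] at this
      exact this
    · refine hg.mono fun z hz ↦ ?_
      have := hz.1
      simp [min_eq_left hab, max_eq_right hab] at this
      exact ⟨this.1.le, this.2.le⟩
  have hhor : ∀ ε : ℝ, |ε| = 1 →
      Tendsto (fun T : ℝ ↦ ∫ u in a..b, g (u + (ε * T : ℝ) * Complex.I)) atTop (𝓝 0) := by
    intro ε hε
    have h1 : Tendsto (fun T : ℝ ↦ C * (1 + |T|) ^ (-(3 / 2) : ℝ) * |b - a|) atTop (𝓝 0) := by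
      simpa using (tendsto_decay_atTop.const_mul C).mul_const |b - a|
    refine squeeze_zero_norm (fun T ↦ ?_) h1
    refine intervalIntegral.norm_integral_le_of_norm_le_const fun u hu ↦ ?_
    rw [uIoc_of_le hab] at hu
    have := le_decay_im (hb (u + (ε * T : ℝ) * Complex.I) (by simpa using hu.1.le) (by simpa using hu.2))
    simpa [abs_mul, hε] using this
  have hv : ∀ c : ℝ, a ≤ c → c ≤ b →
      Tendsto (fun T : ℝ ↦ ∫ y in (-T)..T, g (c + y * Complex.I)) atTop (𝓝 (vInt g c)) := by
    intro c h1 h2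
    refine intervalIntegral_tendsto_integral ?_ tendsto_neg_atTop_atBot tendsto_id
    exact integrable_vertical hg.continuousOn (fun z hz ↦ by simp [hz, h1, h2])
      (fun z hz ↦ hb z (by rw [hz]; exact h1) (by rw [hz]; exact h2))
  have hlim := ((hv b hab le_rfl).const_smul Complex.I).sub ((hv a le_rfl hab).const_smul Complex.I)
  have hlim2 := (hhor 1 (by simp)).sub (hhor (-1) (by simp))
  have := tendsto_nhds_unique (hlim.congr' ((eventually_ge_atTop 0).mono fun T hT ↦ hrect T hT))
    (by simpa using hlim2)
  have h3 : Complex.I * (vInt g b - vInt g a) = 0 := by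
    simp only [smul_eq_mul] at this
    linear_combination this
  have := (mul_eq_zero.mp h3).resolve_left Complex.I_ne_zero
  exact (sub_eq_zero.mp this).symm

lemma vInt_eq_zero_of_right {g : ℂ → ℂ} {a C : ℝ} (hg : DifferentiableOn ℂ g {z | a ≤ z.re})
    (hb : ∀ z : ℂ, a ≤ z.re → ‖g z‖ ≤ C * (1 + ‖z‖) ^ (-(3 / 2) : ℝ)) : vInt g a = 0 := by
  have hC : 0 ≤ C := by
    have := (norm_nonneg _).trans (hb a (by simp))
    exact nonneg_of_mul_nonneg_left this (by positivity)
  have hconst : ∀ n : ℕ, vInt g (a + n) = vInt g a := fun n ↦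
    (vInt_eq_of_strip (by simp) (hg.mono fun z hz ↦ hz.1) (fun z h _ ↦ hb z h)).symm
  have hlim : Tendsto (fun n : ℕ ↦ vInt g (a + n)) atTop (𝓝 (∫ _ : ℝ, (0 : ℂ))) := by
    refine tendsto_integral_of_dominated_convergence (fun y ↦ C * (1 + |y|) ^ (-(3 / 2) : ℝ)) ?_
      (integrable_decay.const_mul C) ?_ ?_
    · intro n
      exact (continuous_vertical hg.continuousOn
        (fun z hz ↦ by simp [hz])).aestronglyMeasurable
    · intro n
      refine Eventually.of_forall fun y ↦ ?_
      simpa using le_decay_im (hb ((a + n : ℝ) + y * Complex.I) (by simp))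
    · refine Eventually.of_forall fun y ↦ ?_
      have h1 : Tendsto (fun n : ℕ ↦ C * (1 + |a + n|) ^ (-(3 / 2) : ℝ)) atTop (𝓝 0) := by
        have := (tendsto_decay_atTop.comp
          (tendsto_atTop_add_const_left _ a tendsto_natCast_atTop_atTop)).const_mul C
        simpa [Function.comp_def] using this
      refine squeeze_zero_norm (fun n ↦ ?_) h1
      refine (hb ((a + n : ℝ) + y * Complex.I) (by simp)).trans (mul_le_mul_of_nonneg_left ?_ hC)
      refine Real.rpow_le_rpow_of_nonpos (by positivity) ?_ (by norm_num)
      have := Complex.abs_re_le_norm ((a + n : ℝ) + y * Complex.I)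
      simp only [add_re, ofReal_re, mul_re, I_re, mul_zero, ofReal_im, I_im, mul_one, sub_self,
        add_zero] at this
      linarith
  simp only [hconst, integral_zero] at hlim
  exact tendsto_nhds_unique tendsto_const_nhds hlim

lemma vInt_comp_neg (g : ℂ → ℂ) (c : ℝ) : vInt (fun z ↦ g (-z)) (-c) = vInt g c := by
  unfold vInt
  rw [← integral_neg_eq_self]
  congr 1
  ext y
  push_cast
  ring_nf

lemma vInt_eq_zero_of_left {g : ℂ → ℂ} {a C : ℝ} (hg : DifferentiableOn ℂ g {z | z.re ≤ a})
    (hb : ∀ z : ℂ, z.re ≤ a → ‖g z‖ ≤ C * (1 + ‖z‖) ^ (-(3 / 2) : ℝ)) : vInt g a = 0 := by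
  rw [← vInt_comp_neg]
  refine vInt_eq_zero_of_right (C := C) ?_ ?_
  · refine hg.comp (by fun_prop) fun z hz ↦ ?_
    simp only [mem_ofPred_eq, neg_re] at hz ⊢
    linarith
  · intro z hz
    simpa using hb (-z) (by simp only [neg_re]; linarith)

lemma one_add_norm_le_mul_norm_sub {z s : ℂ} {η : ℝ} (hη : 0 < η) (h : η ≤ ‖z - s‖) :
    1 + ‖z‖ ≤ (1 + (1 + ‖s‖) / η) * ‖z - s‖ := by
  have h1 : ‖z‖ ≤ ‖z - s‖ + ‖s‖ := by
    simpa using norm_add_le (z - s) s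
  have h2 : 1 + ‖s‖ ≤ (1 + ‖s‖) / η * ‖z - s‖ := by
    rw [div_mul_eq_mul_div, le_div_iff₀ hη]
    gcongr
  linarith

lemma rpow_half_mul_rpow_neg_two {r : ℝ} (hr : 0 < r) :
    r ^ (1 / 2 : ℝ) * (r ^ 2)⁻¹ = r ^ (-(3 / 2) : ℝ) := by
  rw [← Real.rpow_natCast, ← Real.rpow_neg hr.le, ← Real.rpow_add hr]
  norm_num

/-- Decay of `h(z) E(z) / (z - s)²` away from `s`. -/
lemma norm_mul_div_sq_le {h E z s : ℂ} {A M η : ℝ} (hη : 0 < η) (hs : η ≤ ‖z - s‖)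
    (hh : ‖h‖ ≤ A * (1 + ‖z‖) ^ (1 / 2 : ℝ)) (hE : ‖E‖ ≤ M) :
    ‖h * (E / (z - s) ^ 2)‖ ≤
      A * M * (1 + (1 + ‖s‖) / η) ^ 2 * (1 + ‖z‖) ^ (-(3 / 2) : ℝ) := by
  have hM : 0 ≤ M := (norm_nonneg _).trans hE
  have hz : 0 < 1 + ‖z‖ := by positivity
  have hA : 0 ≤ A * (1 + ‖z‖) ^ (1 / 2 : ℝ) := (norm_nonneg _).trans hh
  have hpos : 0 < ‖z - s‖ := hη.trans_le hs
  have h1 := one_add_norm_le_mul_norm_sub hη hs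
  set D := 1 + (1 + ‖s‖) / η with hD
  have h2 : (‖z - s‖ ^ 2)⁻¹ ≤ D ^ 2 * ((1 + ‖z‖) ^ 2)⁻¹ := by
    rw [← div_eq_mul_inv, inv_le_iff_one_le_mul₀ (by positivity), div_mul_eq_mul_div,
      le_div_iff₀ (by positivity), one_mul, ← mul_pow]
    gcongr
  rw [norm_mul, norm_div, norm_pow, div_eq_mul_inv]
  calc ‖h‖ * (‖E‖ * (‖z - s‖ ^ 2)⁻¹)
      ≤ (A * (1 + ‖z‖) ^ (1 / 2 : ℝ)) * (M * (D ^ 2 * ((1 + ‖z‖) ^ 2)⁻¹)) := by gcongr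
    _ = A * M * D ^ 2 * ((1 + ‖z‖) ^ (1 / 2 : ℝ) * ((1 + ‖z‖) ^ 2)⁻¹) := by ring
    _ = _ := by rw [rpow_half_mul_rpow_neg_two hz]

end

section
open Filter MeasureTheory Set Topology

lemma norm_vertical_sub_ge {z s : ℂ} : |z.re - s.re| ≤ ‖z - s‖ := by
  simpa using Complex.abs_re_le_norm (z - s)

/-- The rational function `1 / (z - s) - 1 / (z - s + 2 α)`, with `α = re s - a`. -/
noncomputable def poissonRat (a : ℝ) (s z : ℂ) : ℂ :=
  2 * ((s.re - a : ℝ) : ℂ) * (z - s) / (z - s + 2 * ((s.re - a : ℝ) : ℂ)) * (1 / (z - s) ^ 2)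

lemma poissonRat_denom {a : ℝ} {s z : ℂ} (hz : a ≤ z.re) :
    s.re - a ≤ ‖z - s + 2 * ((s.re - a : ℝ) : ℂ)‖ := by
  refine le_trans ?_ (Complex.re_le_norm _)
  simp
  linarith

lemma poissonRat_bound {a : ℝ} {s z : ℂ} (ha : a < s.re) (hz : a ≤ z.re) {η : ℝ} (hη : 0 < η)
    (hs : η ≤ ‖z - s‖) {f : ℂ} {A : ℝ} (hf : ‖f‖ ≤ A * (1 + ‖z‖) ^ (1 / 2 : ℝ)) :
    ‖f * poissonRat a s z‖ ≤
      6 * (s.re - a) * A * 1 * (1 + (1 + ‖s‖) / η) ^ 2 * (1 + ‖z‖) ^ (-(3 / 2) : ℝ) := by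
  have hd := poissonRat_denom (s := s) hz
  have hα : 0 < s.re - a := sub_pos.mpr ha
  unfold poissonRat
  rw [← mul_assoc]
  refine norm_mul_div_sq_le (M := 1) hη hs ?_ (by simp)
  set w := 2 * ((s.re - a : ℝ) : ℂ) with hw
  have hwn : ‖w‖ = 2 * (s.re - a) := by
    rw [hw, norm_mul, Complex.norm_real, Real.norm_of_nonneg hα.le]
    simp
  have hzs : ‖z - s‖ ≤ 3 * ‖z - s + w‖ := by
    have : ‖z - s‖ ≤ ‖z - s + w‖ + ‖w‖ := by
      simpa using norm_sub_le (z - s + w) w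
    linarith
  have : ‖w * (z - s) / (z - s + w)‖ ≤ 6 * (s.re - a) := by
    rw [norm_div, norm_mul, hwn, div_le_iff₀ (hα.trans_le hd)]
    nlinarith
  rw [norm_mul]
  calc ‖f‖ * _ ≤ (A * (1 + ‖z‖) ^ (1 / 2 : ℝ)) * (6 * (s.re - a)) := by
        gcongr
        exact (norm_nonneg _).trans hf
    _ = _ := by ring

lemma poissonRat_eq {a : ℝ} {s z : ℂ} (ha : a < s.re) (hz : a ≤ z.re) (hzs : z ≠ s) :
    poissonRat a s z = 1 / (z - s) - 1 / (z - s + 2 * ((s.re - a : ℝ) : ℂ)) := by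
  have h1 : z - s + 2 * ((s.re - a : ℝ) : ℂ) ≠ 0 :=
    norm_pos_iff.mp ((sub_pos.mpr ha).trans_le (poissonRat_denom hz))
  have h2 : z - s ≠ 0 := sub_ne_zero.mpr hzs
  unfold poissonRat
  field_simp
  ring

lemma poissonRat_line {a : ℝ} {s : ℂ} (ha : a < s.re) (y : ℝ) :
    poissonRat a s (a + y * Complex.I)
      = ((-(2 * (s.re - a) / ((s.re - a) ^ 2 + (y - s.im) ^ 2)) : ℝ) : ℂ) := by
  have hα : 0 < s.re - a := sub_pos.mpr ha
  have hs : (a + y * Complex.I : ℂ) ≠ s := by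
    intro h
    have := congrArg Complex.re h
    simp at this
    linarith
  rw [poissonRat_eq ha (by simp) hs]
  have e1 : (a + y * Complex.I : ℂ) - s = -((s.re - a : ℝ) : ℂ) + ((y - s.im : ℝ) : ℂ) * Complex.I := by
    apply Complex.ext <;> simp
  have e2 : (a + y * Complex.I : ℂ) - s + 2 * ((s.re - a : ℝ) : ℂ)
      = ((s.re - a : ℝ) : ℂ) + ((y - s.im : ℝ) : ℂ) * Complex.I := by
    rw [e1]; ring
  have n1 : (a + y * Complex.I : ℂ) - s ≠ 0 := sub_ne_zero.mpr hs
  have n2 : (a + y * Complex.I : ℂ) - s + 2 * ((s.re - a : ℝ) : ℂ) ≠ 0 :=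
    norm_pos_iff.mp (hα.trans_le (poissonRat_denom (by simp)))
  rw [e1] at n1
  rw [e2] at n2
  rw [e2, e1]
  have n3 : ((s.re - a) ^ 2 + (y - s.im) ^ 2 : ℝ) ≠ 0 := by positivity
  have n3' : (((s.re - a : ℝ) : ℂ) ^ 2 + ((y - s.im : ℝ) : ℂ) ^ 2 : ℂ) ≠ 0 := by
    exact_mod_cast n3
  rw [div_sub_div _ _ n1 n2]
  push_cast at n3' n1 n2 ⊢
  rw [← neg_div, div_eq_div_iff (mul_ne_zero n1 n2) n3']
  ring_nf
  simp only [Complex.I_sq]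
  ring

lemma differentiableOn_poissonRat {a : ℝ} {s : ℂ} (ha : a < s.re) {S : Set ℂ}
    (hS : ∀ z ∈ S, a ≤ z.re ∧ z ≠ s) : DifferentiableOn ℂ (poissonRat a s) S := by
  intro z hz
  have h1 : z - s + 2 * ((s.re - a : ℝ) : ℂ) ≠ 0 :=
    norm_pos_iff.mp ((sub_pos.mpr ha).trans_le (poissonRat_denom (hS z hz).1))
  have h2 : (z - s) ^ 2 ≠ 0 := pow_ne_zero _ (sub_ne_zero.mpr (hS z hz).2)
  unfold poissonRat
  refine DifferentiableAt.differentiableWithinAt ?_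
  refine DifferentiableAt.mul (DifferentiableAt.div (by fun_prop) (by fun_prop) h1)
    (DifferentiableAt.div (by fun_prop) (by fun_prop) h2)

lemma one_le_rpow_half (z : ℂ) : 1 ≤ (1 + ‖z‖) ^ (1 / 2 : ℝ) :=
  Real.one_le_rpow (by simp) (by norm_num)

lemma vInt_poissonRat_right {a b : ℝ} {s : ℂ} (ha : a < s.re) (hb : s.re < b) {f : ℂ → ℂ} {A : ℝ}
    (hfd : DifferentiableOn ℂ f {z | b ≤ z.re})
    (hf : ∀ z : ℂ, b ≤ z.re → ‖f z‖ ≤ A * (1 + ‖z‖) ^ (1 / 2 : ℝ)) :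
    vInt (fun z ↦ f z * poissonRat a s z) b = 0 := by
  refine vInt_eq_zero_of_right (hfd.mul (differentiableOn_poissonRat ha ?_)) ?_
    (C := 6 * (s.re - a) * A * 1 * (1 + (1 + ‖s‖) / (b - s.re)) ^ 2)
  · intro z hz
    have : b ≤ z.re := hz
    exact ⟨by linarith, by rintro rfl; linarith⟩
  · intro z hz
    refine poissonRat_bound ha (by linarith) (sub_pos.mpr hb) ?_ (hf z hz)
    refine le_trans ?_ norm_vertical_sub_ge
    exact le_trans (by linarith) (le_abs_self _)

lemma vInt_poissonRat_self {a : ℝ} {s : ℂ} (ha : a < s.re) :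
    vInt (poissonRat a s) a = -(2 * Real.pi) := by
  have hα : 0 < s.re - a := sub_pos.mpr ha
  unfold vInt
  simp_rw [poissonRat_line ha]
  rw [integral_complex_ofReal]
  have h1 : ∀ y : ℝ, -(2 * (s.re - a) / ((s.re - a) ^ 2 + (y - s.im) ^ 2))
      = -(2 / (s.re - a)) * (1 + ((y - s.im) / (s.re - a)) ^ 2)⁻¹ := by
    intro y
    field_simp
  simp_rw [h1]
  rw [integral_const_mul, integral_sub_right_eq_self (fun y : ℝ ↦ (1 + (y / (s.re - a)) ^ 2)⁻¹),
    Measure.integral_comp_div (fun y : ℝ ↦ (1 + y ^ 2)⁻¹), integral_univ_inv_one_add_sq,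
    abs_of_pos hα]
  push_cast
  have : (s.re : ℂ) - a ≠ 0 := by exact_mod_cast hα.ne'
  simp only [smul_eq_mul]
  push_cast
  field_simp

/-- Residue theorem for a simple pole at `s` inside a vertical strip. -/
lemma vInt_sub_vInt_eq_residue {Φ : ℂ → ℂ} {a b C : ℝ} {s : ℂ} (ha : a < s.re) (hb : s.re < b)
    (hΦ : DifferentiableOn ℂ Φ {z | a ≤ z.re ∧ z.re ≤ b})
    (hbd : ∀ z : ℂ, a ≤ z.re → z.re ≤ b → 1 ≤ ‖z - s‖ →
      ‖Φ z * (z - s)‖ ≤ C * (1 + ‖z‖) ^ (1 / 2 : ℝ)) :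
    vInt (fun z ↦ Φ z / (z - s)) b - vInt (fun z ↦ Φ z / (z - s)) a = 2 * Real.pi * Φ s := by
  set S : Set ℂ := {z | a ≤ z.re ∧ z.re ≤ b} with hS
  have hα : 0 < s.re - a := sub_pos.mpr ha
  have hSs : S ∈ 𝓝 s := by
    have h1 : IsOpen {z : ℂ | a < z.re ∧ z.re < b} :=
      (isOpen_lt continuous_const Complex.continuous_re).inter
        (isOpen_lt Complex.continuous_re continuous_const)
    exact mem_of_superset (h1.mem_nhds ⟨ha, hb⟩) fun z hz ↦ ⟨hz.1.le, hz.2.le⟩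
  have hSc : IsClosed S := (isClosed_le continuous_const Complex.continuous_re).inter
    (isClosed_le Complex.continuous_re continuous_const)
  set w := 2 * ((s.re - a : ℝ) : ℂ) with hw
  set g : ℂ → ℂ := fun z ↦ dslope Φ s z + Φ s / (z - s + w) with hg
  have hgd : DifferentiableOn ℂ g S := by
    refine ((Complex.differentiableOn_dslope hSs).mpr hΦ).add ?_
    intro z hz
    have h1 : z - s + w ≠ 0 := norm_pos_iff.mp (hα.trans_le (poissonRat_denom hz.1))
    exact ((differentiableAt_const (Φ s)).fun_div (d := fun z ↦ z - s + w) (by fun_prop)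
      h1).differentiableWithinAt
  have hgeq : ∀ z : ℂ, a ≤ z.re → z ≠ s → g z = Φ z / (z - s) - Φ s * poissonRat a s z := by
    intro z hz hzs
    rw [poissonRat_eq ha hz hzs, hg]
    simp only [dslope_of_ne _ hzs, slope_def_field]
    ring
  have hCΦ : ∀ z : ℂ, a ≤ z.re → z.re ≤ b → ∀ η : ℝ, 0 < η → η ≤ 1 → η ≤ ‖z - s‖ → 1 ≤ ‖z - s‖ →
      ‖Φ z / (z - s)‖ ≤ C * 1 * (1 + (1 + ‖s‖) / η) ^ 2 * (1 + ‖z‖) ^ (-(3 / 2) : ℝ) := by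
    intro z h1 h2 η hη _ hzs hz1
    have := norm_mul_div_sq_le (E := 1) (M := 1) hη hzs (hbd z h1 h2 hz1) (by simp)
    have hne : z - s ≠ 0 := norm_pos_iff.mp (hη.trans_le hzs)
    convert this using 2
    field_simp
  obtain ⟨C', hC'⟩ : ∃ C', ∀ z : ℂ, a ≤ z.re → z.re ≤ b →
      ‖g z‖ ≤ C' * (1 + ‖z‖) ^ (-(3 / 2) : ℝ) := by
    obtain ⟨M, hM⟩ := ((isCompact_closedBall s 1).inter_right hSc).exists_bound_of_continuousOn
      (hgd.continuousOn.mono inter_subset_right)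
    have hM0 : 0 ≤ M := (norm_nonneg _).trans (hM s ⟨by simp, ha.le, hb.le⟩)
    set C1 := C * 1 * (1 + (1 + ‖s‖) / 1) ^ 2
    set C2 := ‖Φ s‖ * (6 * (s.re - a) * 1 * 1 * (1 + (1 + ‖s‖) / 1) ^ 2)
    set C3 := M * (2 + ‖s‖) ^ (3 / 2 : ℝ)
    refine ⟨max C3 (C1 + C2), fun z h1 h2 ↦ ?_⟩
    have hpos : 0 < (1 + ‖z‖) ^ (-(3 / 2) : ℝ) := by positivity
    rcases le_or_gt 1 ‖z - s‖ with h | h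
    · have hne : z ≠ s := by
        rintro rfl
        norm_num at h
      rw [hgeq z h1 hne]
      refine (norm_sub_le _ _).trans ?_
      have e1 := hCΦ z h1 h2 1 one_pos le_rfl h h
      have e2 := poissonRat_bound (f := 1) (A := 1) ha h1 one_pos h (by simpa using one_le_rpow_half z)
      rw [norm_mul]
      rw [one_mul] at e2
      have e3 := mul_le_mul_of_nonneg_left e2 (norm_nonneg (Φ s))
      calc _ ≤ (C1 + C2) * (1 + ‖z‖) ^ (-(3 / 2) : ℝ) := by
            rw [add_mul]
            exact add_le_add e1 (e3.trans_eq (by ring))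
        _ ≤ _ := by gcongr; exact le_max_right _ _
    · have e1 := hM z ⟨by simpa [dist_eq_norm] using h.le, h1, h2⟩
      have e2 : 1 ≤ (2 + ‖s‖) ^ (3 / 2 : ℝ) * (1 + ‖z‖) ^ (-(3 / 2) : ℝ) := by
        rw [Real.rpow_neg (by positivity), ← div_eq_mul_inv, one_le_div (by positivity)]
        have : ‖z‖ ≤ ‖z - s‖ + ‖s‖ := by simpa using norm_add_le (z - s) s
        exact Real.rpow_le_rpow (by positivity) (by linarith) (by norm_num)
      calc ‖g z‖ ≤ M * ((2 + ‖s‖) ^ (3 / 2 : ℝ) * (1 + ‖z‖) ^ (-(3 / 2) : ℝ)) := by nlinarith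
        _ = C3 * (1 + ‖z‖) ^ (-(3 / 2) : ℝ) := by ring
        _ ≤ _ := by gcongr; exact le_max_left _ _
  have hshift := vInt_eq_of_strip (ha.trans hb).le hgd hC'
  have hline : ∀ c : ℝ, a ≤ c → c ≤ b → c ≠ s.re →
      vInt (fun z ↦ Φ z / (z - s)) c = vInt g c + Φ s * vInt (poissonRat a s) c := by
    intro c h1 h2 hc
    have hη : 0 < |c - s.re| := abs_pos.mpr (sub_ne_zero.mpr hc)
    have hR : Integrable fun y : ℝ ↦ poissonRat a s (c + y * Complex.I) := by
      refine integrable_vertical (S := {z | z.re = c})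
        (differentiableOn_poissonRat ha ?_).continuousOn (fun z hz ↦ hz)
        (C := 6 * (s.re - a) * 1 * 1 * (1 + (1 + ‖s‖) / |c - s.re|) ^ 2) ?_
      · intro z hz
        have : z.re = c := hz
        exact ⟨by linarith, by rintro rfl; exact hc this.symm⟩
      · intro z hz
        have := poissonRat_bound (f := 1) (A := 1) ha (z := z) (by linarith) hη
          (by rw [← hz]; exact norm_vertical_sub_ge) (by simpa using one_le_rpow_half z)
        simpa using this
    have hgi : Integrable fun y : ℝ ↦ g (c + y * Complex.I) :=
      integrable_vertical hgd.continuousOn (fun z hz ↦ ⟨hz ▸ h1, hz ▸ h2⟩)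
        (fun z hz ↦ hC' z (hz ▸ h1) (hz ▸ h2))
    have : vInt (fun z ↦ Φ z / (z - s)) c = vInt (fun z ↦ g z + Φ s * poissonRat a s z) c := by
      refine vInt_congr fun z hz ↦ ?_
      rw [hgeq z (hz ▸ h1) (by rintro rfl; exact hc hz.symm)]
      ring
    rw [this]
    unfold vInt
    rw [integral_add hgi (hR.const_mul _), integral_const_mul]
  rw [hline a le_rfl (ha.trans hb).le ha.ne, hline b (ha.trans hb).le le_rfl hb.ne', hshift,
    vInt_poissonRat_self ha]
  have := vInt_poissonRat_right (f := fun _ ↦ 1) (A := 1) ha hb (by fun_prop)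
    (fun z _ ↦ by simpa using one_le_rpow_half z)
  simp only [one_mul] at this
  rw [show vInt (poissonRat a s) b = 0 from this]
  ring

/-- Poisson's formula for a half-plane. -/
lemma poisson_half_plane {f : ℂ → ℂ} {a A : ℝ} {s : ℂ} (ha : a < s.re)
    (hfd : DifferentiableOn ℂ f {z | a ≤ z.re})
    (hf : ∀ z : ℂ, a ≤ z.re → ‖f z‖ ≤ A * (1 + ‖z‖) ^ (1 / 2 : ℝ)) :
    vInt (fun z ↦ f z * poissonRat a s z) a = -(2 * Real.pi * f s) := by
  have hα : 0 < s.re - a := sub_pos.mpr ha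
  set w := 2 * ((s.re - a : ℝ) : ℂ) with hw
  have hwn : w ≠ 0 := by
    rw [hw]
    exact mul_ne_zero two_ne_zero (by exact_mod_cast hα.ne')
  have hden : ∀ z : ℂ, a ≤ z.re → z - s + w ≠ 0 := fun z hz ↦
    norm_pos_iff.mp (hα.trans_le (poissonRat_denom hz))
  have hres := vInt_sub_vInt_eq_residue (Φ := fun z ↦ f z * (w / (z - s + w))) (a := a)
    (b := s.re + 1) (s := s) (C := A * (6 * (s.re - a))) ha (by linarith) ?_ ?_
  · have hcongr : ∀ c : ℝ, a ≤ c → c ≠ s.re → vInt (fun z ↦ f z * (w / (z - s + w)) / (z - s)) c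
        = vInt (fun z ↦ f z * poissonRat a s z) c := by
      intro c hc hcs
      refine vInt_congr fun z hz ↦ ?_
      have hzs : z - s ≠ 0 := sub_ne_zero.mpr (by rintro rfl; exact hcs hz.symm)
      have := hden z (hz ▸ hc)
      unfold poissonRat
      rw [← hw]
      field_simp
    rw [hcongr a le_rfl ha.ne, hcongr _ (by linarith) (by linarith),
      vInt_poissonRat_right ha (by linarith) (hfd.mono fun z (hz : _ ≤ z.re) ↦
        show a ≤ z.re by linarith) (fun z hz ↦ hf z (by linarith))] at hres
    simp only [sub_self, zero_add, div_self hwn, mul_one] at hres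
    linear_combination -hres
  · refine (hfd.mono fun z hz ↦ hz.1).mul fun z hz ↦ ?_
    exact ((differentiableAt_const w).fun_div (d := fun z ↦ z - s + w) (by fun_prop)
      (hden z hz.1)).differentiableWithinAt
  · intro z h1 h2 h3
    have hzs : ‖z - s‖ ≤ 3 * ‖z - s + w‖ := by
      have e1 : ‖z - s‖ ≤ ‖z - s + w‖ + ‖w‖ := by
        simpa using norm_sub_le (z - s + w) w
      have e2 : ‖w‖ = 2 * (s.re - a) := by
        rw [hw, norm_mul, Complex.norm_real, Real.norm_of_nonneg hα.le]
        simp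
      have := poissonRat_denom (s := s) h1
      linarith
    have e2 : ‖w‖ = 2 * (s.re - a) := by
      rw [hw, norm_mul, Complex.norm_real, Real.norm_of_nonneg hα.le]
      simp
    have e3 : ‖w / (z - s + w) * (z - s)‖ ≤ 6 * (s.re - a) := by
      rw [norm_mul, norm_div, e2, div_mul_eq_mul_div,
        div_le_iff₀ (norm_pos_iff.mpr (hden z h1))]
      nlinarith
    rw [mul_assoc, norm_mul]
    calc _ ≤ (A * (1 + ‖z‖) ^ (1 / 2 : ℝ)) * (6 * (s.re - a)) := by
          have := hf z h1
          gcongr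
          exact (norm_nonneg _).trans this
      _ = _ := by ring

end

section
open Filter MeasureTheory Set Topology

/-- The residue at a simple zero of `E` for integrands `h(z) E(z) / (z - s)²`. -/
lemma vInt_sub_vInt_of_zero {h E : ℂ → ℂ} {a b A M : ℝ} {s : ℂ} (ha : a < s.re) (hb : s.re < b)
    (hh : DifferentiableOn ℂ h {z | a ≤ z.re ∧ z.re ≤ b}) (hE : Differentiable ℂ E) (hEs : E s = 0)
    (hhb : ∀ z : ℂ, a ≤ z.re → z.re ≤ b → ‖h z‖ ≤ A * (1 + ‖z‖) ^ (1 / 2 : ℝ))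
    (hEb : ∀ z : ℂ, a ≤ z.re → z.re ≤ b → ‖E z‖ ≤ M) :
    vInt (fun z ↦ h z * (E z / (z - s) ^ 2)) b - vInt (fun z ↦ h z * (E z / (z - s) ^ 2)) a
      = 2 * Real.pi * (h s * deriv E s) := by
  have hslope : ∀ z, z ≠ s → dslope E s z = E z / (z - s) := fun z hz ↦ by
    rw [dslope_of_ne _ hz, slope_def_field, hEs, sub_zero]
  have hres := vInt_sub_vInt_eq_residue (Φ := fun z ↦ h z * dslope E s z) (C := A * M) ha hb
    (hh.mul ?_) ?_
  · have hc : ∀ c : ℝ, c ≠ s.re → vInt (fun z ↦ h z * dslope E s z / (z - s)) c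
        = vInt (fun z ↦ h z * (E z / (z - s) ^ 2)) c := fun c hc ↦ vInt_congr fun z hz ↦ by
      have hzs : z ≠ s := by
        rintro rfl
        exact hc hz.symm
      have := sub_ne_zero.mpr hzs
      rw [hslope z hzs]
      field_simp
    rw [hc b hb.ne', hc a ha.ne, dslope_same] at hres
    exact hres
  · exact ((Complex.differentiableOn_dslope univ_mem).mpr hE.differentiableOn).mono (subset_univ _)
  · intro z h1 h2 h3
    have hzs : z ≠ s := by
      rintro rfl
      norm_num at h3
    have := sub_ne_zero.mpr hzs
    have e : h z * dslope E s z * (z - s) = h z * E z := by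
      rw [hslope z hzs]
      field_simp
    rw [e, norm_mul]
    calc _ ≤ A * (1 + ‖z‖) ^ (1 / 2 : ℝ) * M :=
          mul_le_mul (hhb z h1 h2) (hEb z h1 h2) (norm_nonneg _)
            ((norm_nonneg _).trans (hhb z h1 h2))
      _ = _ := by ring

lemma norm_exp_ofReal_mul_sub (l : ℝ) (z s : ℂ) :
    ‖Complex.exp (l * (z - s))‖ = Real.exp (l * (z.re - s.re)) := by
  rw [Complex.norm_exp]
  simp

lemma le_norm_sub_of_re {z s : ℂ} {c : ℝ} (h : z.re ≤ c) : s.re - c ≤ ‖z - s‖ := by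
  have := norm_vertical_sub_ge (z := z) (s := s)
  have := neg_abs_le (z.re - s.re)
  linarith

lemma le_norm_sub_of_re' {z s : ℂ} {c : ℝ} (h : c ≤ z.re) : c - s.re ≤ ‖z - s‖ := by
  have := norm_vertical_sub_ge (z := z) (s := s)
  have := le_abs_self (z.re - s.re)
  linarith

/-- Left shift: `h(z) E(z) / (z - s)²` integrates to zero to the left of `s`. -/
lemma vInt_eq_zero_of_left_of_bound {h E : ℂ → ℂ} {c A M : ℝ} {s : ℂ} (hc : c < s.re)
    (hh : DifferentiableOn ℂ h {z | z.re ≤ c}) (hE : Differentiable ℂ E)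
    (hhb : ∀ z : ℂ, z.re ≤ c → ‖h z‖ ≤ A * (1 + ‖z‖) ^ (1 / 2 : ℝ))
    (hEb : ∀ z : ℂ, z.re ≤ c → ‖E z‖ ≤ M) :
    vInt (fun z ↦ h z * (E z / (z - s) ^ 2)) c = 0 := by
  refine vInt_eq_zero_of_left (hh.mul (hE.differentiableOn.div (by fun_prop) ?_))
    (fun z hz ↦ norm_mul_div_sq_le (sub_pos.mpr hc) (le_norm_sub_of_re hz) (hhb z hz) (hEb z hz))
  intro z (hz : z.re ≤ c)
  exact pow_ne_zero _ (norm_pos_iff.mp ((sub_pos.mpr hc).trans_le (le_norm_sub_of_re hz)))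

lemma vInt_eq_zero_of_right_of_bound {h E : ℂ → ℂ} {c A M : ℝ} {s : ℂ} (hc : s.re < c)
    (hh : DifferentiableOn ℂ h {z | c ≤ z.re}) (hE : Differentiable ℂ E)
    (hhb : ∀ z : ℂ, c ≤ z.re → ‖h z‖ ≤ A * (1 + ‖z‖) ^ (1 / 2 : ℝ))
    (hEb : ∀ z : ℂ, c ≤ z.re → ‖E z‖ ≤ M) :
    vInt (fun z ↦ h z * (E z / (z - s) ^ 2)) c = 0 := by
  refine vInt_eq_zero_of_right (hh.mul (hE.differentiableOn.div (by fun_prop) ?_))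
    (fun z hz ↦ norm_mul_div_sq_le (sub_pos.mpr hc) (le_norm_sub_of_re' hz) (hhb z hz) (hEb z hz))
  intro z (hz : c ≤ z.re)
  exact pow_ne_zero _ (norm_pos_iff.mp ((sub_pos.mpr hc).trans_le (le_norm_sub_of_re' hz)))

/-- Integrability of `h(z) E(z) / (z - s)²` on a vertical line avoiding `s`. -/
lemma integrable_vertical_kernel {h E : ℂ → ℂ} {c A M : ℝ} {s : ℂ} (hc : c ≠ s.re)
    (hh : ContinuousOn h {z | z.re = c}) (hE : Continuous E)
    (hhb : ∀ z : ℂ, z.re = c → ‖h z‖ ≤ A * (1 + ‖z‖) ^ (1 / 2 : ℝ))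
    (hEb : ∀ z : ℂ, z.re = c → ‖E z‖ ≤ M) :
    Integrable fun y : ℝ ↦ (fun z ↦ h z * (E z / (z - s) ^ 2)) (c + y * Complex.I) := by
  have hle : ∀ z : ℂ, z.re = c → |c - s.re| ≤ ‖z - s‖ := fun z hz ↦ by
    rw [← hz]
    exact norm_vertical_sub_ge
  have hpos : 0 < |c - s.re| := abs_pos.mpr (sub_ne_zero.mpr hc)
  have hcont : ContinuousOn (fun z ↦ h z * (E z / (z - s) ^ 2)) {z | z.re = c} :=
    hh.mul (hE.continuousOn.div (by fun_prop) fun z hz ↦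
      pow_ne_zero _ (norm_pos_iff.mp (hpos.trans_le (hle z hz))))
  have hbd : ∀ z : ℂ, z.re = c → ‖h z * (E z / (z - s) ^ 2)‖ ≤
      A * M * (1 + (1 + ‖s‖) / |c - s.re|) ^ 2 * (1 + ‖z‖) ^ (-(3 / 2) : ℝ) := fun z hz ↦
    norm_mul_div_sq_le hpos (hle z hz) (hhb z hz) (hEb z hz)
  exact integrable_vertical hcont (fun z hz ↦ hz) hbd

/-- Perron's formula with the kernel `1 / (z - s)²`. -/
lemma perron_sq {b : ℝ} {s : ℂ} (hb : s.re < b) (l : ℝ) :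
    vInt (fun z ↦ Complex.exp (l * (z - s)) / (z - s) ^ 2) b = 2 * Real.pi * (max l 0 : ℝ) := by
  have hE : Differentiable ℂ fun z : ℂ ↦ Complex.exp (l * (z - s)) := by fun_prop
  have h1 : ∀ z : ℂ, ‖(1 : ℂ)‖ ≤ 1 * (1 + ‖z‖) ^ (1 / 2 : ℝ) := fun z ↦ by
    simpa using one_le_rpow_half z
  rcases le_total l 0 with hl | hl
  · rw [max_eq_right hl]
    have := vInt_eq_zero_of_right_of_bound (h := fun _ ↦ 1) (E := fun z ↦ Complex.exp (l * (z - s)))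
      (A := 1) (M := 1) hb (by fun_prop) hE (fun z _ ↦ h1 z) (fun z hz ↦ by
        rw [norm_exp_ofReal_mul_sub, Real.exp_le_one_iff]
        exact mul_nonpos_of_nonpos_of_nonneg hl (by linarith))
    simpa using this
  · rw [max_eq_left hl]
    set E : ℂ → ℂ := fun z ↦ Complex.exp (l * (z - s)) - 1 with hEdef
    have hE' : Differentiable ℂ E := hE.sub_const 1
    have hbd : ∀ z : ℂ, z.re ≤ b → ‖E z‖ ≤ Real.exp (l * (b - s.re)) + 1 := fun z hz ↦ by
      refine (norm_sub_le _ _).trans ?_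
      rw [norm_exp_ofReal_mul_sub, norm_one]
      gcongr
    have hderiv : deriv E s = l := by
      have : HasDerivAt E (Complex.exp (l * (s - s)) * (l * 1)) s :=
        ((((hasDerivAt_id s).sub_const s).const_mul (l : ℂ)).cexp).sub_const 1
      simpa using this.deriv
    have e1 := vInt_sub_vInt_of_zero (h := fun _ ↦ 1) (E := E) (A := 1) (a := s.re - 1)
      (M := Real.exp (l * (b - s.re)) + 1) (by linarith) hb (by fun_prop) hE' (by simp [hEdef])
      (fun z _ _ ↦ h1 z) (fun z _ hz ↦ hbd z hz)
    have e2 := vInt_eq_zero_of_left_of_bound (h := fun _ ↦ 1) (E := E) (A := 1) (c := s.re - 1)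
      (s := s) (M := Real.exp (l * (b - s.re)) + 1) (by linarith) (by fun_prop) hE'
      (fun z _ ↦ h1 z) (fun z hz ↦ hbd z (by linarith))
    have e3 := vInt_eq_zero_of_right_of_bound (h := fun _ ↦ 1) (E := fun _ ↦ 1) (A := 1) (c := b)
      (s := s) (M := 1) hb (by fun_prop) (by fun_prop) (fun z _ ↦ h1 z) (fun z _ ↦ by simp)
    rw [e2, hderiv, sub_zero] at e1
    have i1 := integrable_vertical_kernel (h := fun _ ↦ 1) (E := E) (A := 1) (c := b)
      (s := s) (M := Real.exp (l * (b - s.re)) + 1) hb.ne' (by fun_prop) hE'.continuous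
      (fun z _ ↦ h1 z) (fun z hz ↦ hbd z hz.le)
    have i2 := integrable_vertical_kernel (h := fun _ ↦ 1) (E := fun _ ↦ 1) (A := 1) (c := b)
      (s := s) (M := 1) hb.ne' (by fun_prop) (by fun_prop) (fun z _ ↦ h1 z) (fun z _ ↦ by simp)
    have e4 : vInt (fun z ↦ Complex.exp (l * (z - s)) / (z - s) ^ 2) b
        = vInt (fun z ↦ 1 * (E z / (z - s) ^ 2)) b + vInt (fun z ↦ 1 * (1 / (z - s) ^ 2)) b := by
      unfold vInt
      rw [← integral_add i1 i2]
      congr 1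
      ext y
      simp only [hEdef]
      ring
    rw [e4, e1, e3]
    ring

/-- The numerator of Selberg's kernel. -/
noncomputable def selE (L : ℝ) (s z : ℂ) : ℂ :=
  Complex.exp (L * (z - s)) - Complex.exp ((2 * L : ℝ) * (z - s))

lemma differentiable_selE (L : ℝ) (s : ℂ) : Differentiable ℂ (selE L s) := by
  unfold selE
  fun_prop

lemma selE_self (L : ℝ) (s : ℂ) : selE L s s = 0 := by simp [selE]

lemma deriv_selE_self (L : ℝ) (s : ℂ) : deriv (selE L s) s = -L := by
  have h : ∀ l : ℝ, HasDerivAt (fun z : ℂ ↦ Complex.exp (l * (z - s)))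
      (Complex.exp (l * (s - s)) * (l * 1)) s := fun l ↦
    (((hasDerivAt_id s).sub_const s).const_mul (l : ℂ)).cexp
  have := ((h L).sub (h (2 * L))).deriv
  have e : selE L s = (fun z : ℂ ↦ Complex.exp (L * (z - s))) -
    fun z : ℂ ↦ Complex.exp ((2 * L : ℝ) * (z - s)) := rfl
  rw [e, this]
  simp
  ring

lemma norm_selE_le (L : ℝ) (s z : ℂ) : ‖selE L s z‖ ≤
    Real.exp (L * (z.re - s.re)) + Real.exp (2 * L * (z.re - s.re)) := by
  refine (norm_sub_le _ _).trans ?_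
  rw [norm_exp_ofReal_mul_sub, norm_exp_ofReal_mul_sub]

lemma norm_selE_le_of_re_le {L : ℝ} (hL : 0 ≤ L) {b : ℝ} {s z : ℂ} (hz : z.re ≤ b) :
    ‖selE L s z‖ ≤ Real.exp (L * (b - s.re)) + Real.exp (2 * L * (b - s.re)) := by
  refine (norm_selE_le L s z).trans ?_
  gcongr

/-- On the line `re z = c`, the conjugate of `f` is the reflected function `conj (f (2 c - conj z))`,
which is holomorphic to the left, so that its kernel integral vanishes. -/
lemma vInt_conj_eq_zero {f : ℂ → ℂ} {L c A : ℝ} {s : ℂ} (hL : 0 ≤ L) (hc : c < s.re)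
    (hf : ∀ z : ℂ, c ≤ z.re → DifferentiableAt ℂ f z)
    (hfb : ∀ z : ℂ, c ≤ z.re → ‖f z‖ ≤ A * (1 + ‖z‖) ^ (1 / 2 : ℝ)) :
    vInt (fun z ↦ (starRingEnd ℂ) (f z) * (selE L s z / (z - s) ^ 2)) c = 0 := by
  set F : ℂ → ℂ := fun z ↦ (starRingEnd ℂ) (f (2 * c - (starRingEnd ℂ) z)) with hF
  have hA : 0 ≤ A := nonneg_of_mul_nonneg_left ((norm_nonneg _).trans (hfb c (by simp)))
    (by positivity)
  have := vInt_eq_zero_of_left_of_bound (h := F) (E := selE L s)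
    (A := A * (1 + 2 * |c|) ^ (1 / 2 : ℝ)) (c := c) hc ?_ (differentiable_selE L s) ?_
    (fun z hz ↦ norm_selE_le_of_re_le hL hz)
  · rw [← this]
    refine vInt_congr fun z hz ↦ ?_
    have : 2 * (c : ℂ) - (starRingEnd ℂ) z = z := by
      apply Complex.ext
      · simp [hz]; ring
      · simp
    simp only [hF, this]
  · intro z (hz : z.re ≤ c)
    have h1 : DifferentiableAt ℂ (fun w ↦ f (2 * c - w)) ((starRingEnd ℂ) z) := by
      refine DifferentiableAt.comp (g := f) _ (hf _ ?_) (by fun_prop)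
      simp
      linarith
    have h2 := h1.conj_conj
    simp only [Complex.conj_conj] at h2
    exact DifferentiableAt.differentiableWithinAt h2
  · intro z hz
    simp only [hF, RCLike.norm_conj]
    have h1 : ‖2 * (c : ℂ) - (starRingEnd ℂ) z‖ ≤ 2 * |c| + ‖z‖ := by
      refine (norm_sub_le _ _).trans ?_
      simp
    refine (hfb _ (by simp; linarith)).trans ?_
    rw [mul_assoc, ← Real.mul_rpow (by positivity) (by positivity)]
    gcongr
    nlinarith [norm_nonneg z, abs_nonneg c]

/-- Selberg's bound for the kernel integral of a function with nonnegative real part. -/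
lemma norm_vInt_selE_le {f : ℂ → ℂ} {L c A : ℝ} {s : ℂ} (hL : 0 ≤ L) (hc : c < s.re)
    (hf : ∀ z : ℂ, c ≤ z.re → DifferentiableAt ℂ f z)
    (hfb : ∀ z : ℂ, c ≤ z.re → ‖f z‖ ≤ A * (1 + ‖z‖) ^ (1 / 2 : ℝ))
    (hre : ∀ z : ℂ, z.re = c → 0 ≤ (f z).re) :
    ‖vInt (fun z ↦ f z * (selE L s z / (z - s) ^ 2)) c‖ ≤
      2 * Real.pi * ((Real.exp (-(L * (s.re - c))) + Real.exp (-(2 * L * (s.re - c))))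
        / (s.re - c) * (f s).re) := by
  have hα : 0 < s.re - c := sub_pos.mpr hc
  set M := Real.exp (-(L * (s.re - c))) + Real.exp (-(2 * L * (s.re - c))) with hM
  have hMpos : 0 < M := by positivity
  have hfd : DifferentiableOn ℂ f {z | c ≤ z.re} := fun z hz ↦ (hf z hz).differentiableWithinAt
  have hfc : ContinuousOn f {z | z.re = c} := hfd.continuousOn.mono fun z hz ↦ le_of_eq hz.symm
  have hEb : ∀ z : ℂ, z.re = c → ‖selE L s z‖ ≤ M := fun z hz ↦ by
    refine (norm_selE_le L s z).trans_eq ?_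
    rw [hz, hM]
    congr 2 <;> ring
  have i1 := integrable_vertical_kernel (h := f) (E := selE L s) hc.ne hfc
    (differentiable_selE L s).continuous (fun z hz ↦ hfb z hz.ge) hEb
  have i2 := integrable_vertical_kernel (h := fun z ↦ (starRingEnd ℂ) (f z)) (E := selE L s) (A := A)
    hc.ne (Complex.continuous_conj.comp_continuousOn hfc) (differentiable_selE L s).continuous
    (fun z hz ↦ by simpa using hfb z hz.ge) hEb
  have e0 := vInt_conj_eq_zero (L := L) hL hc hf hfb
  have e1 : vInt (fun z ↦ f z * (selE L s z / (z - s) ^ 2)) c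
      = ∫ y : ℝ, (fun z : ℂ ↦ ((2 * (f z).re : ℝ) : ℂ) * (selE L s z / (z - s) ^ 2))
          (c + y * Complex.I) := by
    rw [← add_zero (vInt _ c), ← e0]
    unfold vInt
    rw [← integral_add i1 i2]
    congr 1
    ext y
    simp only
    rw [← add_mul, Complex.add_conj]
  have hp := poisson_half_plane hc hfd hfb
  have hpre : ∫ y : ℝ, (f (c + y * Complex.I)).re *
      (2 * (s.re - c) / ((s.re - c) ^ 2 + (y - s.im) ^ 2)) = 2 * Real.pi * (f s).re := by
    have ip : Integrable fun y : ℝ ↦ f (c + y * Complex.I) * poissonRat c s (c + y * Complex.I) :=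
      integrable_vertical (g := fun z ↦ f z * poissonRat c s z) (S := {z | z.re = c})
        (hfc.mul (differentiableOn_poissonRat hc (fun z hz ↦ ⟨le_of_eq hz.symm, by
          rintro rfl
          exact hc.ne' hz⟩)).continuousOn) (fun z hz ↦ hz)
        (fun z hz ↦ poissonRat_bound hc hz.ge hα (le_norm_sub_of_re hz.le) (hfb z hz.ge))
    have h1 := congrArg Complex.re hp
    unfold vInt at h1
    have h2 := Complex.reCLM.integral_comp_comm ip
    simp only [Complex.reCLM_apply] at h2
    rw [← h2] at h1
    have h3 : ∀ y : ℝ, (f (c + y * Complex.I) * poissonRat c s (c + y * Complex.I)).re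
        = -((f (c + y * Complex.I)).re * (2 * (s.re - c) / ((s.re - c) ^ 2 + (y - s.im) ^ 2))) := by
      intro y
      rw [poissonRat_line hc, Complex.re_mul_ofReal]
      ring
    simp_rw [h3] at h1
    rw [integral_neg] at h1
    have h4 : (-(2 * Real.pi * f s) : ℂ).re = -(2 * Real.pi * (f s).re) := by
      rw [show (2 * Real.pi * f s : ℂ) = ((2 * Real.pi : ℝ) : ℂ) * f s by push_cast; ring,
        Complex.neg_re, Complex.re_ofReal_mul]
    linarith
  have hfint : Integrable fun y : ℝ ↦ (f (c + y * Complex.I)).re *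
      (2 * (s.re - c) / ((s.re - c) ^ 2 + (y - s.im) ^ 2)) := by
    have ip : Integrable fun y : ℝ ↦ f (c + y * Complex.I) * poissonRat c s (c + y * Complex.I) :=
      integrable_vertical (g := fun z ↦ f z * poissonRat c s z) (S := {z | z.re = c})
        (hfc.mul (differentiableOn_poissonRat hc (fun z hz ↦ ⟨le_of_eq hz.symm, by
          rintro rfl
          exact hc.ne' hz⟩)).continuousOn) (fun z hz ↦ hz)
        (fun z hz ↦ poissonRat_bound hc hz.ge hα (le_norm_sub_of_re hz.le) (hfb z hz.ge))
    refine (ip.re.neg).congr (Eventually.of_forall fun y ↦ ?_)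
    simp only [Pi.neg_apply]
    rw [poissonRat_line hc]
    simp only [RCLike.re_eq_complex_re, Complex.re_mul_ofReal]
    ring
  rw [e1]
  calc _ ≤ ∫ y : ℝ, M / (s.re - c) * ((f (c + y * Complex.I)).re *
      (2 * (s.re - c) / ((s.re - c) ^ 2 + (y - s.im) ^ 2))) := by
        refine norm_integral_le_of_norm_le (hfint.const_mul _) (Eventually.of_forall fun y ↦ ?_)
        have h0 := hre (c + y * Complex.I) (by simp)
        have h1 := hEb (c + y * Complex.I) (by simp)
        have h2 : ‖(c + y * Complex.I - s : ℂ)‖ ^ 2 = (s.re - c) ^ 2 + (y - s.im) ^ 2 := by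
          rw [← Complex.normSq_eq_norm_sq, Complex.normSq_apply]
          simp
          ring
        simp only
        rw [norm_mul, norm_div, norm_pow, h2, Complex.norm_real, Real.norm_of_nonneg (by linarith)]
        have h3 : 0 < (s.re - c) ^ 2 + (y - s.im) ^ 2 := by positivity
        calc _ ≤ 2 * (f (c + y * Complex.I)).re * (M / ((s.re - c) ^ 2 + (y - s.im) ^ 2)) := by
              gcongr
          _ = _ := by field_simp
    _ = _ := by
        rw [integral_const_mul, hpre]
        ring

end

section
open Filter MeasureTheory Set Topology

/-- The terms of the series of the digamma function. -/
noncomputable def psiTerm (k : ℕ) (w : ℂ) : ℂ := 1 / ((k : ℂ) + 1) - 1 / (w + k)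

lemma add_natCast_ne_zero {w : ℂ} (hw : 0 < w.re) (k : ℕ) : w + k ≠ 0 := fun h ↦ by
  have := congrArg Complex.re h
  simp at this
  have : (0 : ℝ) ≤ k := k.cast_nonneg
  linarith

lemma psiTerm_eq {w : ℂ} (hw : 0 < w.re) (k : ℕ) :
    psiTerm k w = (w - 1) / (((k : ℂ) + 1) * (w + k)) := by
  have h1 := add_natCast_ne_zero hw k
  have h2 : (k : ℂ) + 1 ≠ 0 := k.cast_add_one_ne_zero
  unfold psiTerm
  field_simp
  ring

lemma norm_le_norm_add_natCast {w : ℂ} (hw : 0 ≤ w.re) (k : ℕ) : ‖w‖ ≤ ‖w + k‖ := by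
  rw [← sq_le_sq₀ (norm_nonneg _) (norm_nonneg _), ← Complex.normSq_eq_norm_sq,
    ← Complex.normSq_eq_norm_sq, Complex.normSq_apply, Complex.normSq_apply]
  simp
  have : (0 : ℝ) ≤ k := k.cast_nonneg
  nlinarith

lemma re_add_le_norm_add_natCast (w : ℂ) (k : ℕ) : w.re + k ≤ ‖w + k‖ := by
  simpa using Complex.re_le_norm (w + k)

lemma norm_psiTerm_le {δ : ℝ} (hδ : 0 < δ) (hδ1 : δ ≤ 1) {w : ℂ} (hw : δ ≤ w.re) (k : ℕ) :
    ‖psiTerm k w‖ ≤ 2 / δ * (1 + ‖w‖) ^ (1 / 2 : ℝ) * ((k : ℝ) + 1) ^ (-(3 / 2) : ℝ) := by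
  have hk : (0 : ℝ) ≤ k := k.cast_nonneg
  have hw0 : 0 < w.re := hδ.trans_le hw
  have h1 := norm_le_norm_add_natCast hw0.le k
  have h2 := re_add_le_norm_add_natCast w k
  set N := ‖w + k‖ with hN
  have hNpos : 0 < N := by linarith
  have e1 : δ * ((k : ℝ) + 1) ≤ N := by nlinarith
  have e2 : δ * (1 + ‖w‖) ≤ 2 * N := by nlinarith
  set P := (1 + ‖w‖) ^ (1 / 2 : ℝ) with hP
  set Q := ((k : ℝ) + 1) ^ (1 / 2 : ℝ) with hQ
  have hPpos : 0 < P := by positivity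
  have hQpos : 0 < Q := by positivity
  have hP2 : P ^ 2 = 1 + ‖w‖ := by
    rw [hP, ← Real.rpow_natCast, ← Real.rpow_mul (by positivity)]
    norm_num
  have hQ2 : Q ^ 2 = (k : ℝ) + 1 := by
    rw [hQ, ← Real.rpow_natCast, ← Real.rpow_mul (by positivity)]
    norm_num
  have hQ3 : ((k : ℝ) + 1) ^ (-(3 / 2) : ℝ) = 1 / (Q ^ 2 * Q) := by
    rw [hQ2, hQ, Real.rpow_neg (by positivity), one_div]
    congr 1
    rw [show (3 / 2 : ℝ) = 1 + 1 / 2 by norm_num, Real.rpow_add (by positivity), Real.rpow_one]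
  have e3 : δ * (P * Q) ≤ 2 * N := by
    rw [← hP2] at e2
    rw [← hQ2] at e1
    have : (δ * (P * Q)) ^ 2 ≤ (2 * N) ^ 2 := by
      have := mul_le_mul e2 e1 (by positivity) (by positivity)
      nlinarith
    exact (sq_le_sq₀ (by positivity) (by positivity)).mp this
  have e4 : ‖(k : ℂ) + 1‖ = Q ^ 2 := by
    rw [hQ2]
    have : ((k : ℂ) + 1) = (((k : ℝ) + 1 : ℝ) : ℂ) := by push_cast; rfl
    rw [this, Complex.norm_real, Real.norm_of_nonneg (by positivity)]
  have e5 : ‖w - 1‖ ≤ P ^ 2 := by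
    rw [hP2]
    refine (norm_sub_le _ _).trans ?_
    simp [add_comm]
  rw [psiTerm_eq hw0, norm_div, norm_mul, e4, hQ3, ← hN]
  have : 2 / δ * P * (1 / (Q ^ 2 * Q)) = 2 * P / (δ * Q ^ 2 * Q) := by field_simp
  rw [this, div_le_div_iff₀ (by positivity) (by positivity)]
  calc ‖w - 1‖ * (δ * Q ^ 2 * Q) ≤ P ^ 2 * (δ * Q ^ 2 * Q) := by gcongr
    _ = δ * (P * Q) * (P * Q ^ 2) := by ring
    _ ≤ 2 * N * (P * Q ^ 2) := by gcongr
    _ = _ := by ring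

lemma summable_natCast_add_one_rpow :
    Summable fun k : ℕ ↦ ((k : ℝ) + 1) ^ (-(3 / 2) : ℝ) := by
  have h := (summable_nat_add_iff 1).mpr
    (Real.summable_nat_rpow (p := -(3 / 2)) |>.mpr (by norm_num))
  simpa using h

lemma summable_psiTerm {w : ℂ} (hw : 0 < w.re) : Summable fun k ↦ psiTerm k w := by
  refine Summable.of_norm_bounded (summable_natCast_add_one_rpow.mul_left
    (2 / min w.re 1 * (1 + ‖w‖) ^ (1 / 2 : ℝ))) fun k ↦ ?_
  exact norm_psiTerm_le (lt_min hw one_pos) (min_le_right _ _) (min_le_left _ _) k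

/-- Primitives of the terms of the digamma series. -/
noncomputable def logGammaTerm (k : ℕ) (w : ℂ) : ℂ :=
  (w - 1) / ((k : ℂ) + 1) - (Complex.log (w + k) - Complex.log ((k : ℂ) + 1))

lemma hasDerivAt_logGammaTerm {w : ℂ} (hw : 0 < w.re) (k : ℕ) :
    HasDerivAt (logGammaTerm k) (psiTerm k w) w := by
  have h1 : HasDerivAt (fun w : ℂ ↦ Complex.log (w + k)) (1 / (w + k)) w := by
    refine ((hasDerivAt_id w).add_const (k : ℂ)).clog ?_
    refine Or.inl ?_
    simp
    positivity
  exact (((hasDerivAt_id w).sub_const 1).div_const _).sub (h1.sub_const _)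

lemma hasDerivAt_tsum_logGammaTerm {w : ℂ} (hw : 0 < w.re) :
    (Summable fun k ↦ logGammaTerm k w) ∧
    HasDerivAt (fun w ↦ ∑' k, logGammaTerm k w) (∑' k, psiTerm k w) w := by
  set δ := min w.re 1 / 2 with hδ
  have hδ0 : 0 < δ := half_pos (lt_min hw one_pos)
  have hδ1 : δ < 1 := by
    have := min_le_right w.re 1
    linarith
  have hδw : δ < w.re := by
    have := min_le_left w.re 1
    linarith
  set R := ‖w‖ + 2 with hR
  set S : Set ℂ := {z | δ < z.re} ∩ Metric.ball 0 R with hS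
  have hSo : IsOpen S :=
    (isOpen_lt continuous_const Complex.continuous_re).inter Metric.isOpen_ball
  have hSc : IsPreconnected S :=
    ((convex_halfSpace_re_gt δ).inter (convex_ball 0 R)).isPreconnected
  have hwS : w ∈ S := ⟨hδw, by simp [hR]⟩
  have h1S : (1 : ℂ) ∈ S := ⟨by simpa using hδ1, by simp [hR]; linarith [norm_nonneg w]⟩
  have hu : Summable fun k : ℕ ↦ 2 / δ * (1 + R) ^ (1 / 2 : ℝ) * ((k : ℝ) + 1) ^ (-(3 / 2) : ℝ) :=
    summable_natCast_add_one_rpow.mul_left _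
  have hd : ∀ (k : ℕ) (z : ℂ), z ∈ S → HasDerivAt (logGammaTerm k) (psiTerm k z) z := fun k z hz ↦
    hasDerivAt_logGammaTerm (hδ0.trans hz.1) k
  have hb : ∀ (k : ℕ) (z : ℂ), z ∈ S → ‖psiTerm k z‖ ≤
      2 / δ * (1 + R) ^ (1 / 2 : ℝ) * ((k : ℝ) + 1) ^ (-(3 / 2) : ℝ) := fun k z hz ↦ by
    refine (norm_psiTerm_le hδ0 hδ1.le (le_of_lt hz.1) k).trans ?_
    have : ‖z‖ ≤ R := by simpa using (Metric.mem_ball.mp hz.2).le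
    gcongr
  have h1 : Summable fun k ↦ logGammaTerm k 1 := by
    have : (fun k ↦ logGammaTerm k 1) = fun _ ↦ 0 := by
      ext k
      simp [logGammaTerm, add_comm]
    rw [this]
    exact summable_zero
  exact ⟨summable_of_summable_hasDerivAt_of_isPreconnected hu hSo hSc hd hb h1S h1 hwS,
    hasDerivAt_tsum_of_isPreconnected hu hSo hSc hd hb h1S h1 hwS⟩

lemma GammaSeq_eq_exp_sum {w : ℂ} (hw : 0 < w.re) {n : ℕ} (hn : n ≠ 0) :
    Complex.GammaSeq w n = Complex.exp (∑ k ∈ Finset.range (n + 1), logGammaTerm k w)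
      * Complex.exp (-(w - 1) * ((((harmonic (n + 1) : ℚ) : ℝ) - Real.log n : ℝ) : ℂ))
      * ((n : ℂ) / ((n : ℂ) + 1)) := by
  have hn0 : (n : ℂ) ≠ 0 := Nat.cast_ne_zero.mpr hn
  have hn1 : (n : ℂ) + 1 ≠ 0 := n.cast_add_one_ne_zero
  have h1 : ∀ m : ℕ, Complex.exp (∑ k ∈ Finset.range m, logGammaTerm k w)
      = Complex.exp ((w - 1) * (((harmonic m : ℚ) : ℝ) : ℂ)) * (m.factorial : ℂ)
        / ∏ j ∈ Finset.range m, (w + j) := by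
    intro m
    induction m with
    | zero => simp
    | succ m ih =>
      rw [Finset.sum_range_succ, Complex.exp_add, ih, Finset.prod_range_succ, harmonic_succ,
        Nat.factorial_succ]
      have h2 : Complex.exp (logGammaTerm m w) =
          Complex.exp ((w - 1) * (1 / ((m : ℂ) + 1))) * ((m : ℂ) + 1) / (w + m) := by
        unfold logGammaTerm
        rw [Complex.exp_sub, Complex.exp_sub, Complex.exp_log (add_natCast_ne_zero hw m),
          Complex.exp_log m.cast_add_one_ne_zero]
        field_simp
      rw [h2]
      push_cast
      rw [mul_add (w - 1), Complex.exp_add, one_div, ← mul_div_mul_comm]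
      congr 1
      ring
  rw [h1, Complex.GammaSeq, Complex.cpow_def_of_ne_zero hn0, ← Complex.natCast_log]
  have h3 : Complex.exp ((Real.log n : ℂ) * w) =
      Complex.exp ((w - 1) * (((harmonic (n + 1) : ℚ) : ℝ) : ℂ)) *
      Complex.exp (-(w - 1) * ((((harmonic (n + 1) : ℚ) : ℝ) - Real.log n : ℝ) : ℂ)) * n := by
    conv_rhs => rw [← Complex.exp_log hn0]
    rw [← Complex.exp_add, ← Complex.exp_add, ← Complex.natCast_log]
    congr 1
    push_cast
    ring
  rw [h3, Nat.factorial_succ]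
  push_cast
  field_simp

lemma Gamma_eq_exp_tsum {w : ℂ} (hw : 0 < w.re) :
    Complex.Gamma w = Complex.exp ((∑' k, logGammaTerm k w)
      - (w - 1) * (Real.eulerMascheroniConstant : ℂ)) := by
  have h1 := Complex.GammaSeq_tendsto_Gamma w
  have h2 : Tendsto (fun n : ℕ ↦ Complex.exp (∑ k ∈ Finset.range (n + 1), logGammaTerm k w)
      * Complex.exp (-(w - 1) * ((((harmonic (n + 1) : ℚ) : ℝ) - Real.log n : ℝ) : ℂ))
      * ((n : ℂ) / ((n : ℂ) + 1))) atTop (𝓝 (Complex.exp (∑' k, logGammaTerm k w)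
        * Complex.exp (-(w - 1) * (Real.eulerMascheroniConstant : ℂ)) * 1)) := by
    refine Tendsto.mul (Tendsto.mul ?_ ?_) ?_
    · exact (Complex.continuous_exp.tendsto _).comp
        (((hasDerivAt_tsum_logGammaTerm hw).1.hasSum.tendsto_sum_nat).comp (tendsto_add_atTop_nat 1))
    · refine (Complex.continuous_exp.tendsto _).comp (Tendsto.const_mul _ ?_)
      refine (Complex.continuous_ofReal.tendsto _).comp ?_
      have a1 : Tendsto (fun n : ℕ ↦ ((harmonic n : ℚ) : ℝ) - Real.log n + 1 / ((n : ℝ) + 1)) atTop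
          (𝓝 (Real.eulerMascheroniConstant + 0)) :=
        Real.tendsto_harmonic_sub_log.add tendsto_one_div_add_atTop_nhds_zero_nat
      rw [add_zero] at a1
      refine a1.congr fun n ↦ ?_
      rw [harmonic_succ]
      push_cast
      ring
    · exact tendsto_natCast_div_add_atTop 1
  have h3 := tendsto_nhds_unique (h1.congr' ?_) h2
  · rw [h3, mul_one, ← Complex.exp_add]
    congr 1
    ring
  · filter_upwards [eventually_ne_atTop 0] with n hn
    exact GammaSeq_eq_exp_sum hw hn

lemma digamma_eq_tsum {w : ℂ} (hw : 0 < w.re) :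
    Complex.digamma w = -(Real.eulerMascheroniConstant : ℂ) + ∑' k, psiTerm k w := by
  have h1 : HasDerivAt (fun w ↦ Complex.exp ((∑' k, logGammaTerm k w)
      - (w - 1) * (Real.eulerMascheroniConstant : ℂ))) (Complex.Gamma w *
        ((∑' k, psiTerm k w) - 1 * (Real.eulerMascheroniConstant : ℂ))) w := by
    rw [Gamma_eq_exp_tsum hw]
    exact ((hasDerivAt_tsum_logGammaTerm hw).2.sub
      (((hasDerivAt_id w).sub_const 1).mul_const _)).cexp
  have h2 : Complex.Gamma =ᶠ[𝓝 w] (fun w ↦ Complex.exp ((∑' k, logGammaTerm k w)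
      - (w - 1) * (Real.eulerMascheroniConstant : ℂ))) := by
    filter_upwards [(isOpen_lt continuous_const Complex.continuous_re).mem_nhds hw] with z hz
    exact Gamma_eq_exp_tsum hz
  rw [Complex.digamma_def, logDeriv_apply, h2.deriv_eq, h1.deriv,
    mul_div_cancel_left₀ _ (Complex.Gamma_ne_zero_of_re_pos hw)]
  ring

lemma norm_digamma_le {δ : ℝ} (hδ : 0 < δ) (hδ1 : δ ≤ 1) :
    ∃ C : ℝ, 0 ≤ C ∧ ∀ w : ℂ, δ ≤ w.re → ‖Complex.digamma w‖ ≤ C * (1 + ‖w‖) ^ (1 / 2 : ℝ) := by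
  set Z := ∑' k : ℕ, ((k : ℝ) + 1) ^ (-(3 / 2) : ℝ) with hZ
  have hZ0 : 0 ≤ Z := tsum_nonneg fun k ↦ by positivity
  refine ⟨|Real.eulerMascheroniConstant| + 2 / δ * Z, by positivity, fun w hw ↦ ?_⟩
  rw [digamma_eq_tsum (hδ.trans_le hw)]
  have h1 : ‖∑' k, psiTerm k w‖ ≤ 2 / δ * (1 + ‖w‖) ^ (1 / 2 : ℝ) * Z :=
    tsum_of_norm_bounded (summable_natCast_add_one_rpow.hasSum.mul_left _)
      (norm_psiTerm_le hδ hδ1 hw)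
  have h2 : (1 : ℝ) ≤ (1 + ‖w‖) ^ (1 / 2 : ℝ) := Real.one_le_rpow (by simp) (by norm_num)
  refine (norm_add_le _ _).trans ?_
  rw [norm_neg, Complex.norm_real, Real.norm_eq_abs]
  nlinarith [abs_nonneg Real.eulerMascheroniConstant]

lemma summable_one_div_norm_add_sq {w : ℂ} (hw : 0 < w.re) :
    Summable fun k : ℕ ↦ 1 / ‖w + k‖ ^ 2 := by
  rw [← summable_nat_add_iff 1]
  refine Summable.of_nonneg_of_le (fun k ↦ by positivity) (fun k ↦ ?_)
    ((summable_nat_add_iff 1).mpr (Real.summable_one_div_nat_pow.mpr one_lt_two))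
  have := re_add_le_norm_add_natCast w (k + 1)
  have h2 : ((k + 1 : ℕ) : ℝ) ≤ ‖w + (k + 1 : ℕ)‖ := by linarith
  have h3 : (0 : ℝ) < ((k + 1 : ℕ) : ℝ) := by positivity
  gcongr

lemma log_norm_add_one_sub_le {u : ℂ} (hu : 0 < u.re) :
    Real.log ‖u + 1‖ - Real.log ‖u‖ ≤ (1 / u).re + 1 / 2 * (1 / ‖u‖ ^ 2) := by
  have hu0 : u ≠ 0 := fun h ↦ by simp [h] at hu
  have hu1 : u + 1 ≠ 0 := fun h ↦ by
    have := congrArg Complex.re h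
    simp at this
    linarith
  have hn : 0 < ‖u‖ := norm_pos_iff.mpr hu0
  have hn1 : 0 < ‖u + 1‖ := norm_pos_iff.mpr hu1
  have e1 : ‖u + 1‖ ^ 2 = ‖u‖ ^ 2 + 2 * u.re + 1 := by
    rw [← Complex.normSq_eq_norm_sq, ← Complex.normSq_eq_norm_sq, Complex.normSq_apply,
      Complex.normSq_apply]
    simp
    ring
  have e2 : (1 / u).re = u.re / ‖u‖ ^ 2 := by
    rw [one_div, Complex.inv_re, Complex.normSq_eq_norm_sq]
  have e3 := Real.log_le_sub_one_of_pos (x := ‖u + 1‖ ^ 2 / ‖u‖ ^ 2) (by positivity)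
  rw [Real.log_div (by positivity) (by positivity), Real.log_pow, Real.log_pow, e1] at e3
  have e4 : (‖u‖ ^ 2 + 2 * u.re + 1) / ‖u‖ ^ 2 - 1 = 2 * (u.re / ‖u‖ ^ 2) + 1 / ‖u‖ ^ 2 := by
    field_simp
    ring
  rw [e4] at e3
  rw [e2]
  push_cast at e3
  linarith

lemma re_psiTerm (k : ℕ) (w : ℂ) : (psiTerm k w).re = 1 / ((k : ℝ) + 1) - (1 / (w + k)).re := by
  unfold psiTerm
  rw [Complex.sub_re]
  congr 1
  have : (1 / ((k : ℂ) + 1)) = ((1 / ((k : ℝ) + 1) : ℝ) : ℂ) := by push_cast; rfl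
  rw [this, Complex.ofReal_re]

lemma sum_one_div_eq_harmonic (n : ℕ) :
    ∑ k ∈ Finset.range n, 1 / ((k : ℝ) + 1) = ((harmonic n : ℚ) : ℝ) := by
  simp [harmonic]

/-- An upper bound for the real part of the digamma function. -/
lemma re_digamma_le {w : ℂ} (hw : 0 < w.re) :
    (Complex.digamma w).re ≤ Real.log ‖w‖ + 1 / 2 * ∑' k : ℕ, 1 / ‖w + k‖ ^ 2 := by
  rw [digamma_eq_tsum hw]
  have h1 : Tendsto (fun n : ℕ ↦ -Real.eulerMascheroniConstant +
      (∑ k ∈ Finset.range n, psiTerm k w).re) atTop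
      (𝓝 (-(Real.eulerMascheroniConstant : ℂ) + ∑' k, psiTerm k w).re) := by
    simp only [Complex.add_re, Complex.neg_re, Complex.ofReal_re]
    exact ((Complex.continuous_re.tendsto _).comp
      (summable_psiTerm hw).hasSum.tendsto_sum_nat).const_add _
  have h2 : Tendsto (fun n : ℕ ↦ -Real.eulerMascheroniConstant +
      (((harmonic n : ℚ) : ℝ) - Real.log n) +
      (Real.log ‖w‖ + 1 / 2 * ∑ k ∈ Finset.range n, 1 / ‖w + k‖ ^ 2)) atTop
      (𝓝 (-Real.eulerMascheroniConstant + Real.eulerMascheroniConstant +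
        (Real.log ‖w‖ + 1 / 2 * ∑' k : ℕ, 1 / ‖w + k‖ ^ 2))) :=
    (Real.tendsto_harmonic_sub_log.const_add _).add
      (((summable_one_div_norm_add_sq hw).hasSum.tendsto_sum_nat.const_mul _).const_add _)
  rw [neg_add_cancel, zero_add] at h2
  refine le_of_tendsto_of_tendsto h1 h2 ?_
  filter_upwards [eventually_gt_atTop 0] with n hn
  have h3 : ∀ m : ℕ, -∑ k ∈ Finset.range m, (1 / (w + k)).re ≤
      Real.log ‖w‖ - Real.log ‖w + m‖ + 1 / 2 * ∑ k ∈ Finset.range m, 1 / ‖w + k‖ ^ 2 := by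
    intro m
    induction m with
    | zero => simp
    | succ m ih =>
      rw [Finset.sum_range_succ, Finset.sum_range_succ]
      have hm : (0 : ℝ) ≤ m := m.cast_nonneg
      have := log_norm_add_one_sub_le (u := w + m) (by simp; linarith)
      have e : w + ((m + 1 : ℕ) : ℂ) = w + m + 1 := by push_cast; ring
      rw [e]
      linarith
  have h4 := h3 n
  have hn' : (0 : ℝ) < n := by exact_mod_cast hn
  have h5 : Real.log n ≤ Real.log ‖w + n‖ :=
    Real.log_le_log hn' (by linarith [re_add_le_norm_add_natCast w n])
  rw [Complex.re_sum]
  simp_rw [re_psiTerm]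
  rw [Finset.sum_sub_distrib, sum_one_div_eq_harmonic]
  linarith

/-- The real part of the digamma function tends to infinity with the real part. -/
lemma exists_le_re_digamma (M : ℝ) :
    ∃ A : ℝ, 1 ≤ A ∧ ∀ w : ℂ, A ≤ w.re → M ≤ (Complex.digamma w).re := by
  obtain ⟨n, hn⟩ : ∃ n : ℕ, M + Real.eulerMascheroniConstant + 1 ≤ ((harmonic n : ℚ) : ℝ) := by
    obtain ⟨n, hn⟩ := exists_nat_ge (Real.exp (M + Real.eulerMascheroniConstant + 1))
    refine ⟨n, le_trans ?_ (log_add_one_le_harmonic n)⟩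
    rw [Real.le_log_iff_exp_le (by positivity)]
    push_cast
    linarith
  refine ⟨n + 1, by simp, fun w hw ↦ ?_⟩
  have hn0 : (0 : ℝ) ≤ n := n.cast_nonneg
  have hw0 : 0 < w.re := by linarith
  rw [digamma_eq_tsum hw0, Complex.add_re, Complex.re_tsum (summable_psiTerm hw0)]
  have h1 : ∀ k : ℕ, (1 / (w + k)).re ≤ 1 / ((n : ℝ) + 1 + k) := fun k ↦ by
    refine (Complex.re_le_norm _).trans ?_
    rw [norm_div, norm_one]
    have := re_add_le_norm_add_natCast w k
    gcongr
    linarith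
  have h2 : ∀ k : ℕ, 0 ≤ (psiTerm k w).re := fun k ↦ by
    rw [re_psiTerm, sub_nonneg]
    refine (h1 k).trans ?_
    gcongr 1 / ?_
    linarith
  have h3 : ∑ k ∈ Finset.range n, (psiTerm k w).re ≤ ∑' k, (psiTerm k w).re :=
    Summable.sum_le_tsum _ (fun k _ ↦ h2 k) ((Complex.hasSum_re (summable_psiTerm hw0).hasSum).summable)
  have h4 : ((harmonic n : ℚ) : ℝ) - 1 ≤ ∑ k ∈ Finset.range n, (psiTerm k w).re := by
    simp_rw [re_psiTerm]
    rw [Finset.sum_sub_distrib, sum_one_div_eq_harmonic]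
    have : ∑ k ∈ Finset.range n, (1 / (w + k)).re ≤ 1 := by
      calc _ ≤ ∑ k ∈ Finset.range n, 1 / ((n : ℝ) + 1) := by
            refine Finset.sum_le_sum fun k _ ↦ (h1 k).trans ?_
            gcongr 1 / ?_
            linarith [(k.cast_nonneg : (0 : ℝ) ≤ k)]
        _ = n / ((n : ℝ) + 1) := by simp [div_eq_mul_inv]
        _ ≤ 1 := by
          rw [div_le_one (by positivity)]
          linarith
    linarith
  simp only [Complex.neg_re, Complex.ofReal_re]
  linarith

end

section
open Filter MeasureTheory Set Topology

/-- Termwise integration along a vertical line. -/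
lemma hasSum_vInt {F : ℕ → ℂ → ℂ} {f : ℂ → ℂ} {c : ℝ} {u : ℕ → ℝ}
    (hfint : ∀ n, Integrable fun y : ℝ ↦ F n (c + y * Complex.I))
    (hb : ∀ n (z : ℂ), z.re = c → ‖F n z‖ ≤ u n * (1 + ‖z‖) ^ (-(3 / 2) : ℝ)) (hu : Summable u)
    (hF : ∀ z : ℂ, z.re = c → f z = ∑' n, F n z) :
    HasSum (fun n ↦ vInt (F n) c) (vInt f c) := by
  have hu0 : ∀ n, 0 ≤ u n := fun n ↦ nonneg_of_mul_nonneg_left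
    ((norm_nonneg _).trans (hb n c (by simp))) (by positivity)
  have h1 : Summable fun n ↦ ∫ y : ℝ, ‖F n (c + y * Complex.I)‖ := by
    refine Summable.of_nonneg_of_le (fun n ↦ integral_nonneg fun y ↦ norm_nonneg _) (fun n ↦ ?_)
      (hu.mul_right (∫ y : ℝ, (1 + |y|) ^ (-(3 / 2) : ℝ)))
    rw [← integral_const_mul]
    refine integral_mono (hfint n).norm (integrable_decay.const_mul _) fun y ↦ ?_
    simpa using le_decay_im (hb n (c + y * Complex.I) (by simp))
  have h2 := hasSum_integral_of_summable_integral_norm hfint h1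
  have e : vInt f c = ∫ y : ℝ, ∑' n, F n (c + y * Complex.I) := by
    unfold vInt
    congr 1
    ext y
    exact hF _ (by simp)
  rw [e]
  exact h2

lemma vInt_const_mul (a : ℂ) (f : ℂ → ℂ) (c : ℝ) :
    vInt (fun z ↦ a * f z) c = a * vInt f c := by
  unfold vInt
  rw [integral_const_mul]

lemma norm_one_le_rpow_half (z : ℂ) : ‖(1 : ℂ)‖ ≤ 1 * (1 + ‖z‖) ^ (1 / 2 : ℝ) := by
  simpa using one_le_rpow_half z

lemma integrable_vertical_exp {b : ℝ} {s : ℂ} (hb : b ≠ s.re) (l : ℝ) :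
    Integrable fun y : ℝ ↦
      (fun z : ℂ ↦ 1 * (Complex.exp (l * (z - s)) / (z - s) ^ 2)) (b + y * Complex.I) := by
  refine integrable_vertical_kernel (h := fun _ ↦ 1) (E := fun z ↦ Complex.exp (l * (z - s)))
    (A := 1) (M := Real.exp (l * (b - s.re))) hb (by fun_prop) (by fun_prop)
    (fun z _ ↦ norm_one_le_rpow_half z) (fun z hz ↦ ?_)
  rw [norm_exp_ofReal_mul_sub, hz]

lemma perron_selE_exp {b L l : ℝ} {s : ℂ} (hb : s.re < b) :
    vInt (fun z ↦ Complex.exp (-(l : ℂ) * (z - s)) * (selE L s z / (z - s) ^ 2)) b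
      = 2 * Real.pi * ((max (L - l) 0 - max (2 * L - l) 0 : ℝ) : ℂ) := by
  have h1 := perron_sq hb (L - l)
  have h2 := perron_sq hb (2 * L - l)
  have e : vInt (fun z ↦ Complex.exp (-(l : ℂ) * (z - s)) * (selE L s z / (z - s) ^ 2)) b
      = vInt (fun z ↦ Complex.exp ((L - l : ℝ) * (z - s)) / (z - s) ^ 2) b
        - vInt (fun z ↦ Complex.exp ((2 * L - l : ℝ) * (z - s)) / (z - s) ^ 2) b := by
    have i1 := integrable_vertical_exp hb.ne' (L - l)
    have i2 := integrable_vertical_exp hb.ne' (2 * L - l)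
    simp only [one_mul] at i1 i2
    unfold vInt
    rw [← integral_sub i1 i2]
    congr 1
    ext y
    unfold selE
    beta_reduce
    rw [← mul_div_assoc, ← sub_div, mul_sub, ← Complex.exp_add, ← Complex.exp_add]
    congr 3 <;> (push_cast; ring_nf)
  rw [e, h1, h2]
  push_cast
  ring

lemma L_mul_Lambdax {x : ℝ} (hx : 1 < x) {n : ℕ} (hn : n ≠ 0) (hnx : (n : ℝ) ≤ x ^ 2) :
    Real.log x * Lambdax x n = vonMangoldt n *
      (max (2 * Real.log x - Real.log n) 0 - max (Real.log x - Real.log n) 0) := by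
  have hL : 0 < Real.log x := Real.log_pos hx
  have hn0 : (0 : ℝ) < n := by positivity
  have h2 : Real.log n ≤ 2 * Real.log x := by
    have := Real.log_le_log hn0 hnx
    rwa [Real.log_pow] at this
  rw [max_eq_left (sub_nonneg.mpr h2)]
  unfold Lambdax
  split_ifs with h
  · rw [max_eq_left (sub_nonneg.mpr (Real.log_le_log hn0 h))]
    ring
  · have h3 : Real.log x ≤ Real.log n := Real.log_le_log (by linarith) (not_le.mp h).le
    rw [max_eq_right (sub_nonpos.mpr h3), Real.log_div (by positivity) hn0.ne', Real.log_pow]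
    push_cast
    field_simp
    ring

lemma L_mul_Dpoly_eq_sum {q : ℕ} (χ : DirichletCharacter ℂ q) {x : ℝ} (hx : 1 < x) (s : ℂ) :
    HasSum (fun n : ℕ ↦ LSeries.term ((fun n : ℕ ↦ χ n) * fun n : ℕ ↦ (vonMangoldt n : ℂ)) s n *
      ((max (2 * Real.log x - Real.log n) 0 - max (Real.log x - Real.log n) 0 : ℝ) : ℂ))
      (Real.log x * Dpoly χ x s) := by
  set F := Finset.filter (fun n : ℕ => (n : ℝ) < x ^ 2) (Finset.range (⌈x ^ 2⌉₊ + 1)) with hF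
  have h1 : Real.log x * Dpoly χ x s = ∑ n ∈ F,
      LSeries.term ((fun n : ℕ ↦ χ n) * fun n : ℕ ↦ (vonMangoldt n : ℂ)) s n *
      ((max (2 * Real.log x - Real.log n) 0 - max (Real.log x - Real.log n) 0 : ℝ) : ℂ) := by
    unfold Dpoly
    rw [Finset.mul_sum]
    refine Finset.sum_congr rfl fun n hn ↦ ?_
    rcases eq_or_ne n 0 with rfl | hn0
    · simp [Lambdax, (zero_lt_one.trans hx).le]
    · have h2 := L_mul_Lambdax hx hn0 (Finset.mem_filter.mp hn).2.le
      rw [LSeries.term_of_ne_zero hn0, ← mul_div_assoc, ← mul_assoc, ← Complex.ofReal_mul, h2]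
      simp only [Pi.mul_apply]
      push_cast
      ring
  rw [h1]
  refine hasSum_sum_of_ne_finset_zero fun n hn ↦ ?_
  rcases eq_or_ne n 0 with rfl | hn0
  · simp
  · have hn1 : (0 : ℝ) < n := by positivity
    have h2 : x ^ 2 ≤ n := by
      by_contra! h
      refine hn (Finset.mem_filter.mpr ⟨Finset.mem_range.mpr ?_, h⟩)
      have : (n : ℝ) < ⌈x ^ 2⌉₊ := h.trans_le (Nat.le_ceil _)
      have : n < ⌈x ^ 2⌉₊ := by exact_mod_cast this
      omega
    have h3 : 2 * Real.log x ≤ Real.log n := by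
      have := Real.log_le_log (by positivity) h2
      rwa [Real.log_pow] at this
    have hL : 0 < Real.log x := Real.log_pos hx
    rw [max_eq_right (by linarith), max_eq_right (by linarith)]
    simp

lemma logDeriv_LFunction_eq {q : ℕ} [NeZero q] (χ : DirichletCharacter ℂ q) {z : ℂ}
    (hz : 1 < z.re) : logDeriv (DirichletCharacter.LFunction χ) z =
      -LSeries ((fun n : ℕ ↦ χ n) * fun n : ℕ ↦ (vonMangoldt n : ℂ)) z := by
  rw [DirichletCharacter.LSeries_twist_vonMangoldt_eq χ hz, logDeriv_apply,
    DirichletCharacter.deriv_LFunction_eq_deriv_LSeries χ hz,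
    DirichletCharacter.LFunction_eq_LSeries χ hz]
  ring

/-- The kernel integral of `L'/L` to the right is Selberg's Dirichlet polynomial. -/
lemma vInt_logDeriv_LFunction {q : ℕ} [NeZero q] (χ : DirichletCharacter ℂ q) {x b : ℝ} {s : ℂ}
    (hx : 1 < x) (hb : 1 < b) (hs : s.re < b) :
    vInt (fun z ↦ logDeriv (DirichletCharacter.LFunction χ) z *
      (selE (Real.log x) s z / (z - s) ^ 2)) b = 2 * Real.pi * (Real.log x * Dpoly χ x s) := by
  set f : ℕ → ℂ := (fun n : ℕ ↦ χ n) * fun n : ℕ ↦ (vonMangoldt n : ℂ) with hf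
  set L := Real.log x with hL
  have hL0 : 0 < L := Real.log_pos hx
  have hsum : LSeriesSummable f b :=
    DirichletCharacter.LSeriesSummable_twist_vonMangoldt χ (by simpa using hb)
  have hnorm : ∀ (z : ℂ), z.re = b → ∀ n, ‖LSeries.term f z n‖ = ‖LSeries.term f b n‖ := by
    intro z hz n
    rw [LSeries.norm_term_eq, LSeries.norm_term_eq, hz, Complex.ofReal_re]
  set M := Real.exp (L * (b - s.re)) + Real.exp (2 * L * (b - s.re)) with hM
  have hbs : 0 < b - s.re := sub_pos.mpr hs
  have hMz : ∀ z : ℂ, z.re = b → ‖selE L s z‖ ≤ M := fun z hz ↦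
    norm_selE_le_of_re_le hL0.le hz.le
  have hh : ∀ n (z : ℂ), z.re = b → ‖LSeries.term f z n‖ ≤
      ‖LSeries.term f b n‖ * (1 + ‖z‖) ^ (1 / 2 : ℝ) := fun n z hz ↦ by
    rw [hnorm z hz]
    exact le_mul_of_one_le_right (norm_nonneg _) (one_le_rpow_half z)
  have hS := hasSum_vInt (F := fun n z ↦ LSeries.term f z n * (selE L s z / (z - s) ^ 2))
    (f := fun z ↦ -(logDeriv (DirichletCharacter.LFunction χ) z * (selE L s z / (z - s) ^ 2)))
    (c := b) (u := fun n ↦ ‖LSeries.term f b n‖ * M * (1 + (1 + ‖s‖) / (b - s.re)) ^ 2)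
    (fun n ↦ integrable_vertical_kernel (h := fun z ↦ LSeries.term f z n) (E := selE L s) hs.ne'
      (fun z _ ↦ (LSeries.hasDerivAt_term f n z).continuousAt.continuousWithinAt)
      (differentiable_selE L s).continuous (hh n) hMz)
    (fun n z hz ↦ norm_mul_div_sq_le hbs (le_norm_sub_of_re' hz.ge) (hh n z hz) (hMz z hz))
    ((hsum.norm.mul_right _).mul_right _) (fun z hz ↦ ?_)
  · have hterm : ∀ n, vInt (fun z ↦ LSeries.term f z n * (selE L s z / (z - s) ^ 2)) b
        = -(2 * Real.pi) * (LSeries.term f s n *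
          ((max (2 * L - Real.log n) 0 - max (L - Real.log n) 0 : ℝ) : ℂ)) := by
      intro n
      rcases eq_or_ne n 0 with rfl | hn
      · simp [vInt]
      · have hn0 : (n : ℂ) ≠ 0 := Nat.cast_ne_zero.mpr hn
        have e : ∀ z : ℂ, LSeries.term f z n * (selE L s z / (z - s) ^ 2) = LSeries.term f s n *
            (Complex.exp (-((Real.log n : ℝ) : ℂ) * (z - s)) * (selE L s z / (z - s) ^ 2)) := by
          intro z
          rw [← mul_assoc]
          congr 1
          rw [LSeries.term_of_ne_zero hn, LSeries.term_of_ne_zero hn,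
            Complex.cpow_def_of_ne_zero hn0, Complex.cpow_def_of_ne_zero hn0,
            ← Complex.natCast_log, div_eq_mul_inv, div_eq_mul_inv, ← Complex.exp_neg,
            ← Complex.exp_neg, mul_assoc, ← Complex.exp_add]
          congr 2
          ring
        simp_rw [e]
        rw [vInt_const_mul, perron_selE_exp hs]
        push_cast
        ring
    simp_rw [hterm] at hS
    have h1 := hS.unique ((L_mul_Dpoly_eq_sum χ hx s).mul_left (-(2 * (Real.pi : ℂ))))
    have h2 : vInt (fun z ↦ -(logDeriv (DirichletCharacter.LFunction χ) z *
        (selE L s z / (z - s) ^ 2))) b = -vInt (fun z ↦ logDeriv (DirichletCharacter.LFunction χ) z *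
        (selE L s z / (z - s) ^ 2)) b := by
      unfold vInt
      rw [integral_neg]
    rw [h2] at h1
    linear_combination -h1
  · rw [logDeriv_LFunction_eq χ (hz ▸ hb), tsum_mul_right, LSeries]
    ring

/-- The kernel integral of `1 / (z + β)` to the right of `-β`. -/
lemma vInt_one_div_add {L c β : ℝ} {s : ℂ} (hL : 0 ≤ L) (hc : c < s.re) (hβ : -β < c) :
    vInt (fun z ↦ 1 / (z + β) * (selE L s z / (z - s) ^ 2)) c
      = 2 * Real.pi * (selE L s (-β) / (-β - s) ^ 2) := by
  have hα : 0 < s.re - c := sub_pos.mpr hc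
  have hne : ∀ z : ℂ, z.re ≤ c → (z - s) ^ 2 ≠ 0 := fun z hz ↦
    pow_ne_zero _ (norm_pos_iff.mp (hα.trans_le (le_norm_sub_of_re hz)))
  have hΦ : DifferentiableOn ℂ (fun z ↦ selE L s z / (z - s) ^ 2) {z | z.re ≤ c} :=
    (differentiable_selE L s).differentiableOn.div (by fun_prop) fun z hz ↦ hne z hz
  set M := Real.exp (L * (c - s.re)) + Real.exp (2 * L * (c - s.re)) with hM
  have hM0 : 0 ≤ M := by positivity
  have hK : ∀ z : ℂ, z.re ≤ c → ‖selE L s z / (z - s) ^ 2‖ ≤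
      1 * M * (1 + (1 + ‖s‖) / (s.re - c)) ^ 2 * (1 + ‖z‖) ^ (-(3 / 2) : ℝ) := fun z hz ↦ by
    simpa using norm_mul_div_sq_le (h := 1) hα (le_norm_sub_of_re hz) (norm_one_le_rpow_half z)
      (norm_selE_le_of_re_le hL hz)
  set B := 1 * M * (1 + (1 + ‖s‖) / (s.re - c)) ^ 2 with hB
  have hB0 : 0 ≤ B := by positivity
  have hres := vInt_sub_vInt_eq_residue (Φ := fun z ↦ selE L s z / (z - s) ^ 2) (a := -β - 1)
    (b := c) (s := (-β : ℝ)) (C := B * (1 + |β|)) (by simp) (by simpa using hβ)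
    (hΦ.mono fun z hz ↦ hz.2) ?_
  · have h0 : vInt (fun z ↦ selE L s z / (z - s) ^ 2 / (z - ((-β : ℝ) : ℂ))) (-β - 1) = 0 := by
      refine vInt_eq_zero_of_left (C := B) ((hΦ.mono ?_).div (by fun_prop) ?_) ?_
      · intro z (hz : z.re ≤ -β - 1)
        show z.re ≤ c
        linarith
      · intro z (hz : z.re ≤ -β - 1) h
        have := congrArg Complex.re h
        simp at this
        linarith
      · intro z hz
        have h1 : 1 ≤ ‖z - ((-β : ℝ) : ℂ)‖ := by
          have := le_norm_sub_of_re (s := ((-β : ℝ) : ℂ)) hz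
          simp only [Complex.ofReal_re] at this
          linarith
        rw [norm_div]
        exact (div_le_self (norm_nonneg _) h1).trans (hK z (by linarith))
    rw [h0, sub_zero] at hres
    have h1 : vInt (fun z ↦ 1 / (z + β) * (selE L s z / (z - s) ^ 2)) c =
        vInt (fun z ↦ selE L s z / (z - s) ^ 2 / (z - ((-β : ℝ) : ℂ))) c := by
      refine vInt_congr fun z hz ↦ ?_
      push_cast
      rw [sub_neg_eq_add]
      ring
    rw [h1, hres]
    push_cast
    rfl
  · intro z h1 h2 h3
    rw [norm_mul]
    have h4 : ‖z - ((-β : ℝ) : ℂ)‖ ≤ (1 + |β|) * (1 + ‖z‖) := by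
      refine (norm_sub_le _ _).trans ?_
      rw [Complex.norm_real, Real.norm_eq_abs, abs_neg]
      nlinarith [norm_nonneg z, abs_nonneg β]
    calc _ ≤ B * (1 + ‖z‖) ^ (-(3 / 2) : ℝ) * ((1 + |β|) * (1 + ‖z‖)) := by
          exact mul_le_mul (hK z h2) h4 (norm_nonneg _) (by positivity)
      _ = B * (1 + |β|) * ((1 + ‖z‖) ^ (-(3 / 2) : ℝ) * (1 + ‖z‖) ^ (1 : ℝ)) := by
          rw [Real.rpow_one]
          ring
      _ ≤ _ := by
          rw [← Real.rpow_add (by positivity)]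
          refine mul_le_mul_of_nonneg_left ?_ (by positivity)
          exact Real.rpow_le_rpow_of_exponent_le (by simp) (by norm_num)

/-- The kernel integral of the Gamma factor. -/
lemma norm_vInt_digamma_le {L c a : ℝ} {s : ℂ} (hL : 0 ≤ L) (hc0 : 0 < c) (hc1 : c ≤ 1)
    (hc : c < s.re) (ha : 0 ≤ a) :
    ‖vInt (fun z ↦ (1 / 2 * Complex.digamma ((z + a) / 2)) * (selE L s z / (z - s) ^ 2)) c‖ ≤
      2 * Real.pi * ((Real.exp (-(L * s.re)) + Real.exp (-(2 * L * s.re))) / 4 *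
        ∑' k : ℕ, 1 / ‖(s + a) / 2 + k‖ ^ 2) := by
  have hα : 0 < s.re - c := sub_pos.mpr hc
  set w := (s + a) / 2 with hw
  have hre : ∀ z : ℂ, ((z + a) / 2).re = (z.re + a) / 2 := fun z ↦ by
    simp
  have hw0 : 0 < w.re := by
    rw [hw, hre]
    linarith
  set M := Real.exp (L * (c - s.re)) + Real.exp (2 * L * (c - s.re)) with hM
  have hMz : ∀ z : ℂ, z.re ≤ c → ‖selE L s z‖ ≤ M := fun z hz ↦ norm_selE_le_of_re_le hL hz
  set A : ℝ := 2 / (c / 2) * (1 + a) ^ (1 / 2 : ℝ) with hA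
  have hpt : ∀ (k : ℕ) (z : ℂ), z.re = c → ‖psiTerm k ((z + a) / 2)‖ ≤
      A * ((k : ℝ) + 1) ^ (-(3 / 2) : ℝ) * (1 + ‖z‖) ^ (1 / 2 : ℝ) := fun k z hz ↦ by
    refine (norm_psiTerm_le (δ := c / 2) (by linarith) (by linarith)
      (by rw [hre, hz]; linarith) k).trans ?_
    have h1 : ‖(z + a) / 2‖ ≤ ‖z‖ + a := by
      rw [norm_div]
      have h2 := norm_add_le z a
      rw [Complex.norm_real, Real.norm_of_nonneg ha] at h2
      simp
      linarith [norm_nonneg z]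
    have h2 : (1 + ‖(z + a) / 2‖) ^ (1 / 2 : ℝ) ≤ (1 + a) ^ (1 / 2 : ℝ) * (1 + ‖z‖) ^ (1 / 2 : ℝ) := by
      rw [← Real.mul_rpow (by positivity) (by positivity)]
      gcongr
      nlinarith [norm_nonneg z]
    calc _ ≤ 2 / (c / 2) * ((1 + a) ^ (1 / 2 : ℝ) * (1 + ‖z‖) ^ (1 / 2 : ℝ)) *
          ((k : ℝ) + 1) ^ (-(3 / 2) : ℝ) := by gcongr
      _ = _ := by ring
  have hcont : ∀ k : ℕ, ContinuousOn (fun z ↦ psiTerm k ((z + a) / 2)) {z | z.re = c} := by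
    intro k z (hz : z.re = c)
    unfold psiTerm
    have := add_natCast_ne_zero (w := (z + a) / 2) (by rw [hre, hz]; linarith) k
    exact ContinuousAt.continuousWithinAt (by fun_prop (disch := assumption))
  have hS := hasSum_vInt (F := fun k z ↦ psiTerm k ((z + a) / 2) * (selE L s z / (z - s) ^ 2))
    (f := fun z ↦ (∑' k, psiTerm k ((z + a) / 2)) * (selE L s z / (z - s) ^ 2))
    (c := c) (u := fun k ↦ A * ((k : ℝ) + 1) ^ (-(3 / 2) : ℝ) * M *
      (1 + (1 + ‖s‖) / (s.re - c)) ^ 2)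
    (fun k ↦ integrable_vertical_kernel (h := fun z ↦ psiTerm k ((z + a) / 2)) (E := selE L s) hc.ne
      (hcont k) (differentiable_selE L s).continuous (hpt k) fun z hz ↦ hMz z hz.le)
    (fun k z hz ↦ norm_mul_div_sq_le hα (le_norm_sub_of_re hz.le) (hpt k z hz) (hMz z hz.le))
    (((summable_natCast_add_one_rpow.mul_left _).mul_right _).mul_right _)
    (fun z hz ↦ tsum_mul_right.symm)
  have hconst : ∀ v : ℂ, vInt (fun z ↦ v * (selE L s z / (z - s) ^ 2)) c = 0 := fun v ↦
    vInt_eq_zero_of_left_of_bound (h := fun _ ↦ v) (A := ‖v‖) hc (by fun_prop)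
      (differentiable_selE L s)
      (fun z _ ↦ le_mul_of_one_le_right (norm_nonneg _) (one_le_rpow_half z)) hMz
  have hterm : ∀ k : ℕ, vInt (fun z ↦ psiTerm k ((z + a) / 2) * (selE L s z / (z - s) ^ 2)) c
      = -(4 * Real.pi) * (selE L s (-((a + 2 * k : ℝ) : ℂ)) / (-((a + 2 * k : ℝ) : ℂ) - s) ^ 2) := by
    intro k
    have hk : (0 : ℝ) ≤ k := k.cast_nonneg
    have h1 := vInt_one_div_add (β := a + 2 * k) hL hc (by linarith)
    have h2 := hconst (1 / ((k : ℂ) + 1))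
    have hne : ∀ z : ℂ, z.re = c → z + ((a + 2 * k : ℝ) : ℂ) ≠ 0 := fun z hz h ↦ by
      have := congrArg Complex.re h
      rw [Complex.add_re, Complex.ofReal_re, hz, Complex.zero_re] at this
      linarith
    have i1 : Integrable fun y : ℝ ↦ (fun z ↦ 1 / ((k : ℂ) + 1) * (selE L s z / (z - s) ^ 2))
        (c + y * Complex.I) :=
      integrable_vertical_kernel (h := fun _ ↦ 1 / ((k : ℂ) + 1)) (A := ‖1 / ((k : ℂ) + 1)‖) hc.ne
        (by fun_prop) (differentiable_selE L s).continuous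
        (fun z _ ↦ le_mul_of_one_le_right (norm_nonneg _) (one_le_rpow_half z))
        fun z hz ↦ hMz z hz.le
    have i2 : Integrable fun y : ℝ ↦ (fun z ↦ 1 / (z + ((a + 2 * k : ℝ) : ℂ)) *
        (selE L s z / (z - s) ^ 2)) (c + y * Complex.I) := by
      refine integrable_vertical_kernel (h := fun z ↦ 1 / (z + ((a + 2 * k : ℝ) : ℂ))) (A := 1 / c)
        hc.ne (continuousOn_const.div (by fun_prop) hne) (differentiable_selE L s).continuous
        (fun z hz ↦ ?_) fun z hz ↦ hMz z hz.le
      have h3 : c ≤ ‖z + ((a + 2 * k : ℝ) : ℂ)‖ := by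
        refine le_trans ?_ (Complex.re_le_norm _)
        rw [Complex.add_re, Complex.ofReal_re, hz]
        linarith
      rw [norm_div, norm_one]
      calc 1 / ‖z + ((a + 2 * k : ℝ) : ℂ)‖ ≤ 1 / c := by gcongr
        _ ≤ _ := le_mul_of_one_le_right (by positivity) (one_le_rpow_half z)
    have h3 : vInt (fun z ↦ psiTerm k ((z + a) / 2) * (selE L s z / (z - s) ^ 2)) c =
        vInt (fun z ↦ 1 / ((k : ℂ) + 1) * (selE L s z / (z - s) ^ 2)) c -
        2 * vInt (fun z ↦ 1 / (z + ((a + 2 * k : ℝ) : ℂ)) * (selE L s z / (z - s) ^ 2)) c := by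
      rw [← vInt_const_mul]
      unfold vInt
      rw [← integral_sub i1 (i2.const_mul 2)]
      congr 1
      ext y
      have h4 := hne (c + y * Complex.I) (by simp)
      set z : ℂ := c + y * Complex.I
      have h5 : (z + a) / 2 + k = (z + ((a + 2 * k : ℝ) : ℂ)) / 2 := by
        push_cast
        ring
      unfold psiTerm
      beta_reduce
      rw [h5]
      field_simp
    rw [h3, h2, h1]
    ring
  have hE : ∀ k : ℕ, ‖vInt (fun z ↦ psiTerm k ((z + a) / 2) * (selE L s z / (z - s) ^ 2)) c‖ ≤
      Real.pi * (Real.exp (-(L * s.re)) + Real.exp (-(2 * L * s.re))) * (1 / ‖w + k‖ ^ 2) := by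
    intro k
    have hk : (0 : ℝ) ≤ k := k.cast_nonneg
    have h1 : ‖-((a + 2 * k : ℝ) : ℂ) - s‖ = 2 * ‖w + k‖ := by
      have : -((a + 2 * k : ℝ) : ℂ) - s = -(2 * (w + k)) := by
        rw [hw]
        push_cast
        ring
      rw [this, norm_neg, norm_mul]
      simp
    have h2 : ‖selE L s (-((a + 2 * k : ℝ) : ℂ))‖ ≤
        Real.exp (-(L * s.re)) + Real.exp (-(2 * L * s.re)) := by
      refine (norm_selE_le_of_re_le (b := 0) hL ?_).trans_eq ?_
      · rw [Complex.neg_re, Complex.ofReal_re]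
        linarith
      · congr 2 <;> ring
    have h0 : 0 < ‖w + k‖ := norm_pos_iff.mpr (add_natCast_ne_zero hw0 k)
    rw [hterm, norm_mul, norm_div, norm_pow, h1]
    have h3 : ‖(-(4 * Real.pi) : ℂ)‖ = 4 * Real.pi := by
      rw [norm_neg, norm_mul, Complex.norm_real, Real.norm_of_nonneg Real.pi_pos.le]
      simp
    rw [h3]
    calc _ ≤ 4 * Real.pi * ((Real.exp (-(L * s.re)) + Real.exp (-(2 * L * s.re))) /
          (2 * ‖w + k‖) ^ 2) := by gcongr
      _ = _ := by
        field_simp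
        ring
  have hfin : vInt (fun z ↦ (1 / 2 * Complex.digamma ((z + a) / 2)) *
      (selE L s z / (z - s) ^ 2)) c = 1 / 2 *
      vInt (fun z ↦ (∑' k, psiTerm k ((z + a) / 2)) * (selE L s z / (z - s) ^ 2)) c := by
    have i1 : Integrable fun y : ℝ ↦ (fun z ↦ -(Real.eulerMascheroniConstant : ℂ) *
        (selE L s z / (z - s) ^ 2)) (c + y * Complex.I) :=
      integrable_vertical_kernel (h := fun _ ↦ -(Real.eulerMascheroniConstant : ℂ))
        (A := ‖-(Real.eulerMascheroniConstant : ℂ)‖) hc.ne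
        (by fun_prop) (differentiable_selE L s).continuous
        (fun z _ ↦ le_mul_of_one_le_right (norm_nonneg _) (one_le_rpow_half z))
        fun z hz ↦ hMz z hz.le
    have hub : ∀ z : ℂ, z.re = c → ‖∑' k, psiTerm k ((z + a) / 2)‖ ≤
        A * (∑' k : ℕ, ((k : ℝ) + 1) ^ (-(3 / 2) : ℝ)) * (1 + ‖z‖) ^ (1 / 2 : ℝ) := fun z hz ↦
      tsum_of_norm_bounded ((summable_natCast_add_one_rpow.hasSum.mul_left A).mul_right _)
        fun k ↦ hpt k z hz
    have hcs : ContinuousOn (fun z ↦ ∑' k, psiTerm k ((z + a) / 2)) {z | z.re = c} := by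
      have hd : ∀ z : ℂ, z.re = c → ContinuousAt Complex.digamma ((z + a) / 2) := by
        intro z hz
        have hp : 0 < ((z + a) / 2).re := by
          rw [hre, hz]
          linarith
        have hnb : {v : ℂ | 0 < v.re} ∈ 𝓝 ((z + a) / 2) :=
          (isOpen_lt continuous_const Complex.continuous_re).mem_nhds hp
        have hG : DifferentiableOn ℂ Complex.Gamma {v : ℂ | 0 < v.re} := fun v hv ↦
          (Complex.differentiableAt_Gamma v fun m hm ↦ by
            have h6 : 0 < v.re := hv
            rw [hm] at h6
            simp at h6
            have : (0 : ℝ) ≤ m := m.cast_nonneg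
            linarith).differentiableWithinAt
        have hG' := (hG.analyticAt hnb)
        rw [Complex.digamma_def]
        exact (hG'.deriv.div hG' (Complex.Gamma_ne_zero_of_re_pos hp)).continuousAt
      intro z hz
      have h7 : ContinuousAt (fun z : ℂ ↦ Complex.digamma ((z + a) / 2) +
          (Real.eulerMascheroniConstant : ℂ)) z :=
        (ContinuousAt.comp (g := Complex.digamma) (f := fun z : ℂ ↦ (z + a) / 2) (hd z hz)
          (by fun_prop) : ContinuousAt (fun z : ℂ ↦ Complex.digamma ((z + a) / 2)) z).add
          continuousAt_const
      refine h7.continuousWithinAt.congr (fun v hv ↦ ?_) ?_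
      · rw [digamma_eq_tsum (by rw [hre, show v.re = c from hv]; linarith)]
        ring
      · rw [digamma_eq_tsum (by rw [hre, show z.re = c from hz]; linarith)]
        ring
    have i2 : Integrable fun y : ℝ ↦ (fun z ↦ (∑' k, psiTerm k ((z + a) / 2)) *
        (selE L s z / (z - s) ^ 2)) (c + y * Complex.I) :=
      integrable_vertical_kernel (h := fun z ↦ ∑' k, psiTerm k ((z + a) / 2)) hc.ne hcs
        (differentiable_selE L s).continuous hub fun z hz ↦ hMz z hz.le
    have e : vInt (fun z ↦ (1 / 2 * Complex.digamma ((z + a) / 2)) *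
        (selE L s z / (z - s) ^ 2)) c = 1 / 2 * (vInt (fun z ↦
        -(Real.eulerMascheroniConstant : ℂ) * (selE L s z / (z - s) ^ 2)) c +
        vInt (fun z ↦ (∑' k, psiTerm k ((z + a) / 2)) * (selE L s z / (z - s) ^ 2)) c) := by
      unfold vInt
      rw [← integral_add i1 i2, ← integral_const_mul]
      congr 1
      ext y
      beta_reduce
      rw [digamma_eq_tsum (by rw [hre]; simp; linarith)]
      ring
    rw [e, hconst, zero_add]
  have hsumw := (summable_one_div_norm_add_sq hw0).hasSum
  have hfinal := tsum_of_norm_bounded (hsumw.mul_left (Real.pi *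
    (Real.exp (-(L * s.re)) + Real.exp (-(2 * L * s.re))))) hE
  rw [hS.tsum_eq] at hfinal
  rw [hfin, norm_mul]
  have : ‖(1 / 2 : ℂ)‖ = 1 / 2 := by simp
  rw [this]
  linarith

end

section
open Filter MeasureTheory Set Topology

/-- An everywhere convergent Mellin transform is bounded on vertical strips. -/
lemma exists_norm_mellin_le {f : ℝ → ℂ} (hf : ∀ s, MellinConvergent f s) (a b : ℝ) :
    ∃ C, ∀ s : ℂ, a ≤ s.re → s.re ≤ b → ‖mellin f s‖ ≤ C := by
  have hnorm : ∀ (s : ℂ) {t : ℝ}, t ∈ Ioi (0 : ℝ) →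
      ‖(t : ℂ) ^ (s - 1) • f t‖ = t ^ (s.re - 1) * ‖f t‖ := fun s t ht ↦ by
    rw [norm_smul, Complex.norm_cpow_eq_rpow_re_of_pos ht, Complex.sub_re, Complex.one_re]
  have hfint : ∀ c : ℝ, IntegrableOn (fun t : ℝ ↦ t ^ (c - 1) * ‖f t‖) (Ioi 0) := fun c ↦
    IntegrableOn.congr_fun (hf (c : ℂ)).norm (fun t ht ↦ by
      simpa using hnorm (c : ℂ) ht) measurableSet_Ioi
  refine ⟨∫ t in Ioi (0 : ℝ), (t ^ (a - 1) * ‖f t‖ + t ^ (b - 1) * ‖f t‖), fun s ha hb ↦ ?_⟩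
  refine (norm_integral_le_integral_norm _).trans ?_
  refine setIntegral_mono_on (hf s).norm ((hfint a).add (hfint b)) measurableSet_Ioi fun t ht ↦ ?_
  have ht0 : (0 : ℝ) < t := ht
  rw [hnorm s ht, ← add_mul]
  refine mul_le_mul_of_nonneg_right ?_ (norm_nonneg _)
  rcases le_total t 1 with h | h
  · have := Real.rpow_le_rpow_of_exponent_ge ht0 h (sub_le_sub_right ha 1)
    have := Real.rpow_nonneg ht0.le (b - 1)
    linarith
  · have := Real.rpow_le_rpow_of_exponent_le h (sub_le_sub_right hb 1)
    have := Real.rpow_nonneg ht0.le (a - 1)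
    linarith

lemma exists_norm_completedHurwitzZetaEven₀_le (x : UnitAddCircle) (a b : ℝ) :
    ∃ C, ∀ s : ℂ, a ≤ s.re → s.re ≤ b → ‖HurwitzZeta.completedHurwitzZetaEven₀ x s‖ ≤ C := by
  set P := HurwitzZeta.hurwitzEvenFEPair x
  obtain ⟨C, hC⟩ := exists_norm_mellin_le (f := P.f_modif)
    (fun s ↦ (P.isStrongFEPair_toStrongFEPair.hasMellin s).1) (a / 2) (b / 2)
  refine ⟨C / 2, fun s ha hb ↦ ?_⟩
  have h1 : HurwitzZeta.completedHurwitzZetaEven₀ x s = mellin P.f_modif (s / 2) / 2 := rfl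
  rw [h1, norm_div]
  have h2 : (s / 2).re = s.re / 2 := by simp
  have := hC (s / 2) (by rw [h2]; linarith) (by rw [h2]; linarith)
  have h3 : ‖(2 : ℂ)‖ = 2 := by simp
  rw [h3]
  linarith

lemma exists_norm_completedHurwitzZetaOdd_le (x : UnitAddCircle) (a b : ℝ) :
    ∃ C, ∀ s : ℂ, a ≤ s.re → s.re ≤ b → ‖HurwitzZeta.completedHurwitzZetaOdd x s‖ ≤ C := by
  have hP := HurwitzZeta.isStrong_hurwitzOddFEPair x
  obtain ⟨C, hC⟩ := exists_norm_mellin_le (f := (HurwitzZeta.hurwitzOddFEPair x).f)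
    (fun s ↦ (hP.hasMellin s).1) ((a + 1) / 2) ((b + 1) / 2)
  refine ⟨C / 2, fun s ha hb ↦ ?_⟩
  have h1 : HurwitzZeta.completedHurwitzZetaOdd x s =
      (HurwitzZeta.hurwitzOddFEPair x).Λ ((s + 1) / 2) / 2 := rfl
  rw [h1, hP.Λ_eq, norm_div]
  have h2 : ((s + 1) / 2).re = (s.re + 1) / 2 := by simp
  have := hC ((s + 1) / 2) (by rw [h2]; linarith) (by rw [h2]; linarith)
  have h3 : ‖(2 : ℂ)‖ = 2 := by simp
  rw [h3]
  linarith

/-- The parity of a Dirichlet character: `0` if even, `1` if odd. -/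
noncomputable def parity {q : ℕ} (χ : DirichletCharacter ℂ q) : ℝ :=
  open scoped Classical in if χ.Even then 0 else 1

lemma parity_nonneg {q : ℕ} (χ : DirichletCharacter ℂ q) : 0 ≤ parity χ := by
  unfold parity
  split_ifs <;> norm_num

lemma parity_le_one {q : ℕ} (χ : DirichletCharacter ℂ q) : parity χ ≤ 1 := by
  unfold parity
  split_ifs <;> norm_num

lemma parity_inv {q : ℕ} (χ : DirichletCharacter ℂ q) : parity χ⁻¹ = parity χ := by
  have h : χ⁻¹.Even ↔ χ.Even := by
    unfold DirichletCharacter.Even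
    rw [MulChar.inv_apply_eq_inv', inv_eq_one]
  by_cases h1 : χ.Even
  · simp [parity, h1, h.mpr h1]
  · simp [parity, h1, mt h.mp h1]

lemma gammaFactor_eq {q : ℕ} (χ : DirichletCharacter ℂ q) (z : ℂ) :
    DirichletCharacter.gammaFactor χ z = Complex.Gammaℝ (z + parity χ) := by
  unfold DirichletCharacter.gammaFactor parity
  split_ifs <;> simp

lemma gammaFactor_ne_zero {q : ℕ} (χ : DirichletCharacter ℂ q) {z : ℂ} (hz : 0 < z.re) :
    DirichletCharacter.gammaFactor χ z ≠ 0 := by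
  rw [gammaFactor_eq]
  refine Complex.Gammaℝ_ne_zero_of_re_pos ?_
  have := parity_nonneg χ
  simp
  linarith

variable {q : ℕ} [NeZero q]

lemma exists_norm_completedLFunction_le {χ : DirichletCharacter ℂ q} (hq : 1 < q) (hχ : χ ≠ 1)
    (a b : ℝ) :
    ∃ C, ∀ s : ℂ, a ≤ s.re → s.re ≤ b → ‖DirichletCharacter.completedLFunction χ s‖ ≤ C := by
  choose C₁ h₁ using fun x ↦ exists_norm_completedHurwitzZetaEven₀_le x a b
  choose C₂ h₂ using fun x ↦ exists_norm_completedHurwitzZetaOdd_le x a b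
  have hq0 : (0 : ℝ) < q := by positivity
  refine ⟨(q : ℝ) ^ (-a) * ∑ j : ZMod q, ‖χ j‖ * C₁ (ZMod.toAddCircle j) +
    (q : ℝ) ^ (-a) * ∑ j : ZMod q, ‖χ j‖ * C₂ (ZMod.toAddCircle j), fun s ha hb ↦ ?_⟩
  have hsum : ∑ j, χ j = 0 := by
    simpa using χ.sum_eq_zero_of_ne_one hχ
  rw [DirichletCharacter.completedLFunction, ZMod.completedLFunction_eq, χ.map_zero' hq.ne', hsum]
  simp only [mul_zero, zero_div, sub_zero]
  rw [ZMod.completedLFunction₀]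
  have hqs : ‖(q : ℂ) ^ (-s)‖ ≤ (q : ℝ) ^ (-a) := by
    rw [Complex.norm_natCast_cpow_of_pos (by omega)]
    refine Real.rpow_le_rpow_of_exponent_le (by exact_mod_cast hq.le) ?_
    simpa using ha
  have hpiece : ∀ (F : ZMod q → ℂ) (D : ZMod q → ℝ), (∀ j, ‖F j‖ ≤ D j) →
      ‖(q : ℂ) ^ (-s) * ∑ j, χ j * F j‖ ≤ (q : ℝ) ^ (-a) * ∑ j, ‖χ j‖ * D j := by
    intro F D h
    rw [norm_mul]
    refine mul_le_mul hqs ((norm_sum_le _ _).trans (Finset.sum_le_sum fun j _ ↦ ?_))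
      (norm_nonneg _) (by positivity)
    rw [norm_mul]
    exact mul_le_mul_of_nonneg_left (h j) (norm_nonneg _)
  exact (norm_add_le _ _).trans (add_le_add (hpiece _ _ fun j ↦ h₁ _ s ha hb)
    (hpiece _ _ fun j ↦ h₂ _ s ha hb))

/-- The completed `L`-function, normalised so that the functional equation has a constant root
number. -/
noncomputable def xiFun (χ : DirichletCharacter ℂ q) (z : ℂ) : ℂ :=
  (q : ℂ) ^ (z / 2) * DirichletCharacter.completedLFunction χ z

lemma differentiable_xiFun {χ : DirichletCharacter ℂ q} (hχ : χ ≠ 1) :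
    Differentiable ℂ (xiFun χ) := by
  have hq : (q : ℂ) ≠ 0 := NeZero.ne _
  have h : Differentiable ℂ fun z : ℂ ↦ (q : ℂ) ^ (z / 2) := fun z ↦
    (differentiableAt_id.div_const 2).const_cpow (Or.inl hq)
  exact h.mul (DirichletCharacter.differentiable_completedLFunction hχ)

lemma exists_norm_xiFun_le {χ : DirichletCharacter ℂ q} (hq : 1 < q) (hχ : χ ≠ 1) (a b : ℝ) :
    ∃ C, ∀ s : ℂ, a ≤ s.re → s.re ≤ b → ‖xiFun χ s‖ ≤ C := by
  obtain ⟨C, hC⟩ := exists_norm_completedLFunction_le hq hχ a b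
  refine ⟨(q : ℝ) ^ (b / 2) * C, fun s ha hb ↦ ?_⟩
  rw [xiFun, norm_mul]
  refine mul_le_mul ?_ (hC s ha hb) (norm_nonneg _) (by positivity)
  rw [Complex.norm_natCast_cpow_of_pos (by omega)]
  refine Real.rpow_le_rpow_of_exponent_le (by exact_mod_cast hq.le) ?_
  have : (s / 2).re = s.re / 2 := by simp
  linarith

lemma completedLFunction_eq_mul (χ : DirichletCharacter ℂ q) {z : ℂ} (hz : 0 < z.re) :
    DirichletCharacter.completedLFunction χ z =
      DirichletCharacter.LFunction χ z * DirichletCharacter.gammaFactor χ z := by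
  rw [DirichletCharacter.LFunction_eq_completed_div_gammaFactor χ z
    (Or.inl fun h ↦ by simp [h] at hz), div_mul_cancel₀ _ (gammaFactor_ne_zero χ hz)]

lemma LFunction_conj (χ : DirichletCharacter ℂ q) {z : ℂ} (hz : 1 < z.re) :
    DirichletCharacter.LFunction χ⁻¹ (starRingEnd ℂ z) =
      starRingEnd ℂ (DirichletCharacter.LFunction χ z) := by
  rw [DirichletCharacter.LFunction_eq_LSeries _ (by simpa using hz),
    DirichletCharacter.LFunction_eq_LSeries _ hz, LSeries, LSeries, Complex.conj_tsum]
  refine tsum_congr fun n ↦ ?_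
  rcases eq_or_ne n 0 with rfl | hn
  · simp
  · rw [LSeries.term_of_ne_zero hn, LSeries.term_of_ne_zero hn, map_div₀]
    congr 1
    · exact (MulChar.star_apply' χ _).symm
    · rw [Complex.cpow_conj _ _ (by rw [Complex.natCast_arg]; exact Real.pi_pos.ne),
        Complex.conj_natCast]

lemma Gammaℝ_conj (z : ℂ) :
    Complex.Gammaℝ (starRingEnd ℂ z) = starRingEnd ℂ (Complex.Gammaℝ z) := by
  rw [Complex.Gammaℝ_def, Complex.Gammaℝ_def, map_mul, ← Complex.Gamma_conj]
  have h1 : (starRingEnd ℂ) z / 2 = starRingEnd ℂ (z / 2) := by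
    rw [map_div₀, map_ofNat]
  have h2 : -(starRingEnd ℂ) z / 2 = starRingEnd ℂ (-z / 2) := by
    rw [map_div₀, map_ofNat, map_neg]
  rw [h1, h2, Complex.cpow_conj _ _ (by
    rw [Complex.arg_ofReal_of_nonneg Real.pi_pos.le]; exact Real.pi_pos.ne), Complex.conj_ofReal]

lemma xiFun_conj {χ : DirichletCharacter ℂ q} (hχ : χ ≠ 1) (z : ℂ) :
    xiFun χ⁻¹ (starRingEnd ℂ z) = starRingEnd ℂ (xiFun χ z) := by
  have h1 : Differentiable ℂ fun z ↦ starRingEnd ℂ (xiFun χ (starRingEnd ℂ z)) := fun z ↦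
    differentiableAt_conj_conj_iff.mpr (differentiable_xiFun hχ _)
  have h2 : Differentiable ℂ (xiFun χ⁻¹) := differentiable_xiFun (inv_ne_one.mpr hχ)
  have h3 : ∀ z : ℂ, 1 < z.re → xiFun χ⁻¹ z = starRingEnd ℂ (xiFun χ (starRingEnd ℂ z)) := by
    intro z hz
    have hz' : 1 < (starRingEnd ℂ z).re := by simpa using hz
    have h4 := LFunction_conj χ hz'
    rw [Complex.conj_conj] at h4
    rw [xiFun, xiFun, completedLFunction_eq_mul _ (by linarith),
      completedLFunction_eq_mul _ (by linarith), map_mul, map_mul, h4, gammaFactor_eq,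
      gammaFactor_eq, parity_inv, ← Gammaℝ_conj, map_add, Complex.conj_conj, Complex.conj_ofReal]
    congr 1
    rw [← Complex.conj_natCast, ← Complex.cpow_conj _ _ (by
      rw [Complex.natCast_arg]; exact Real.pi_pos.ne), map_div₀, map_ofNat, Complex.conj_conj,
      Complex.conj_natCast]
  have h5 : xiFun χ⁻¹ = fun z ↦ starRingEnd ℂ (xiFun χ (starRingEnd ℂ z)) := by
    refine AnalyticOnNhd.eq_of_eventuallyEq (𝕜 := ℂ) (z₀ := 2)
      (fun z _ ↦ h2.analyticAt z) (fun z _ ↦ h1.analyticAt z) ?_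
    filter_upwards [(isOpen_lt continuous_const Complex.continuous_re).mem_nhds
      (show (1 : ℝ) < (2 : ℂ).re by norm_num)] with z hz using h3 z hz
  rw [h5]
  simp

lemma xiFun_ne_zero_of_LFunction {χ : DirichletCharacter ℂ q} {z : ℂ} (hz : 0 < z.re)
    (h : DirichletCharacter.LFunction χ z ≠ 0) : xiFun χ z ≠ 0 := by
  rw [xiFun, completedLFunction_eq_mul χ hz]
  refine mul_ne_zero ?_ (mul_ne_zero h (gammaFactor_ne_zero χ hz))
  rw [Complex.cpow_def_of_ne_zero (NeZero.ne _)]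
  exact Complex.exp_ne_zero _

lemma norm_xiFun_one_sub_conj {χ : DirichletCharacter ℂ q} (hχ : χ ≠ 1) (hp : χ.IsPrimitive)
    (z : ℂ) : ‖xiFun χ (1 - starRingEnd ℂ z)‖ = ‖xiFun χ z‖ := by
  have hq : (q : ℂ) ≠ 0 := NeZero.ne _
  set ε := ‖DirichletCharacter.rootNumber χ‖ with hε
  have h1 : ∀ z : ℂ, ‖xiFun χ (1 - starRingEnd ℂ z)‖ = ε * ‖xiFun χ z‖ := by
    intro z
    have h2 : xiFun χ (1 - starRingEnd ℂ z) =
        DirichletCharacter.rootNumber χ * xiFun χ⁻¹ (starRingEnd ℂ z) := by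
      rw [xiFun, xiFun, hp.completedLFunction_one_sub]
      have : (q : ℂ) ^ (starRingEnd ℂ z / 2) = (q : ℂ) ^ ((1 - starRingEnd ℂ z) / 2) *
          (q : ℂ) ^ (starRingEnd ℂ z - 1 / 2) := by
        rw [← Complex.cpow_add _ _ hq]
        congr 1
        ring
      rw [this]
      ring
    rw [h2, xiFun_conj hχ, norm_mul, RCLike.norm_conj]
  have h3 : ε * ε = 1 := by
    have h4 : ‖xiFun χ 2‖ ≠ 0 := norm_ne_zero_iff.mpr (xiFun_ne_zero_of_LFunction (by norm_num)
      (DirichletCharacter.LFunction_ne_zero_of_one_le_re χ (Or.inl hχ) (by norm_num)))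
    have h5 := h1 (1 - starRingEnd ℂ 2)
    rw [h1 2] at h5
    simp only [map_sub, map_one, Complex.conj_conj, sub_sub_cancel] at h5
    refine mul_right_cancel₀ h4 ?_
    linarith
  have h6 : ε = 1 := by
    nlinarith [norm_nonneg (DirichletCharacter.rootNumber χ)]
  rw [h1, h6, one_mul]

end

section
open Filter Set Topology Metric

lemma one_add_norm_rpow_half_le (z : ℂ) : (1 + ‖z‖) ^ (1 / 2 : ℝ) ≤ 1 + ‖z‖ := by
  have h : (1 : ℝ) ≤ 1 + ‖z‖ := by linarith [norm_nonneg z]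
  simpa using Real.rpow_le_rpow_of_exponent_le h (show (1 / 2 : ℝ) ≤ 1 by norm_num)

/-- The discs tangent to the line of real part `1 / 2` exhaust the half-plane. -/
lemma mem_ball_of_re_of_im {δ X Y c : ℝ} (hδ : 0 < δ) (hc : X + Y ^ 2 / δ + 1 ≤ c) {z : ℂ}
    (h1 : 1 / 2 + δ ≤ z.re) (h2 : z.re ≤ X) (h3 : |z.im| ≤ Y) :
    z ∈ ball (c : ℂ) (c - 1 / 2) := by
  have h4 : z.im ^ 2 ≤ Y ^ 2 := by
    rw [← sq_abs]
    exact pow_le_pow_left₀ (abs_nonneg _) h3 2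
  have h5 : Y ^ 2 / δ * δ = Y ^ 2 := div_mul_cancel₀ _ hδ.ne'
  have h6 : 0 ≤ Y ^ 2 / δ := by positivity
  rw [mem_ball, dist_eq_norm]
  refine lt_of_pow_lt_pow_left₀ 2 (by linarith) ?_
  rw [← Complex.normSq_eq_norm_sq, Complex.normSq_apply]
  simp only [Complex.sub_re, Complex.ofReal_re, Complex.sub_im, Complex.ofReal_im, sub_zero]
  nlinarith [mul_nonneg (sub_nonneg.mpr h1) (show 0 ≤ 2 * c - z.re - 1 / 2 by linarith),
    mul_nonneg hδ.le (show 0 ≤ 2 * c - z.re - 1 / 2 - (Y ^ 2 / δ) - 1 by linarith)]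

/-- A nonvanishing holomorphic function on a disc has a logarithm. -/
lemma exists_log_on_ball {Ξ : ℂ → ℂ} (hd : Differentiable ℂ Ξ) {c p : ℂ} {r : ℝ}
    (hne : ∀ z ∈ ball c r, Ξ z ≠ 0) (hp : p ∈ ball c r) :
    ∃ g : ℂ → ℂ, g p = Complex.log (Ξ p) ∧ (∀ z ∈ ball c r, HasDerivAt g (logDeriv Ξ z) z) ∧
      ∀ z ∈ ball c r, Ξ z = Complex.exp (g z) := by
  have hf : DifferentiableOn ℂ (logDeriv Ξ) (ball c r) :=
    (hd.deriv.differentiableOn).div hd.differentiableOn hne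
  obtain ⟨g, hgp, hg⟩ := hf.isExactOn_ball.with_val_at p (Complex.log (Ξ p))
  refine ⟨g, hgp, hg, ?_⟩
  have hder : ∀ z ∈ ball c r, HasDerivAt (fun z ↦ Ξ z * Complex.exp (-g z)) 0 z := by
    intro z hz
    have h0 := hne z hz
    refine ((hd z).hasDerivAt.mul (hg z hz).neg.cexp).congr_deriv ?_
    rw [logDeriv_apply]
    field_simp
    simp
  intro z hz
  have h2 := (convex_ball c r).norm_image_sub_le_of_norm_hasDerivWithin_le (C := 0)
    (fun z hz ↦ (hder z hz).hasDerivWithinAt) (fun z _ ↦ by simp) hp hz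
  rw [zero_mul, norm_le_zero_iff, sub_eq_zero] at h2
  have h3 : Ξ p * Complex.exp (-g p) = 1 := by
    rw [hgp, Complex.exp_neg, Complex.exp_log (hne p hp), mul_inv_cancel₀ (hne p hp)]
  rw [h3, Complex.exp_neg, mul_inv_eq_one₀ (Complex.exp_ne_zero _)] at h2
  exact h2

lemma deriv_comp_const_add_ofReal {Ξ : ℂ → ℂ} (hd : Differentiable ℂ Ξ) (z : ℂ) (u : ℝ) :
    HasDerivAt (fun u : ℝ ↦ ‖Ξ (z + u)‖ ^ 2)
      (2 * (‖Ξ (z + u)‖ ^ 2 * (logDeriv Ξ (z + u)).re)) u := by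
  have h1 : HasDerivAt (fun v : ℂ ↦ Ξ (z + v)) (deriv Ξ (z + u)) (u : ℂ) :=
    (hd (z + u)).hasDerivAt.comp_const_add z (u : ℂ)
  have h2 := h1.comp_ofReal.norm_sq
  convert h2 using 1
  congr 1
  rw [Complex.inner, logDeriv_apply]
  rcases eq_or_ne (Ξ (z + u)) 0 with h | h
  · simp [h]
  · have h3 : (starRingEnd ℂ) (Ξ (z + u)) * deriv Ξ (z + u) =
        ((‖Ξ (z + u)‖ ^ 2 : ℝ) : ℂ) * (deriv Ξ (z + u) / Ξ (z + u)) := by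
      have := Complex.mul_conj (Ξ (z + u))
      rw [Complex.normSq_eq_norm_sq] at this
      rw [← this]
      field_simp
    rw [mul_comm (deriv Ξ (z + u)), h3, Complex.re_ofReal_mul]

variable {Ξ : ℂ → ℂ} (hd : Differentiable ℂ Ξ) (hne : ∀ z : ℂ, 1 / 2 < z.re → Ξ z ≠ 0)
  (hB : ∀ a b : ℝ, ∃ C, ∀ s : ℂ, a ≤ s.re → s.re ≤ b → ‖Ξ s‖ ≤ C)
  {C : ℝ} (hC : 0 ≤ C)
  (hg : ∀ z : ℂ, 2 ≤ z.re → ‖logDeriv Ξ z‖ ≤ C * (1 + ‖z‖) ^ (1 / 2 : ℝ))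
include hd hne

include hB hC hg in
lemma exists_exp_le_norm {h A : ℝ} (hh : 0 < h) (hA : 2 ≤ A) :
    ∃ K, 0 ≤ K ∧ ∀ z : ℂ, 1 / 2 + h ≤ z.re → z.re ≤ A →
      Real.exp (-(K * (1 + |z.im|) ^ 2)) ≤ ‖Ξ z‖ := by
  rcases lt_or_ge A (1 / 2 + h) with hAh | hAh
  · exact ⟨0, le_rfl, fun z h1 h2 ↦ by linarith⟩
  obtain ⟨B', hB'⟩ := hB (1 / 2) (2 * A)
  set B := max B' (Real.exp 1) with hBdef
  have hBpos : 0 < B := (Real.exp_pos 1).trans_le (le_max_right _ _)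
  set M := Real.log B with hM
  have hM1 : 1 ≤ M := by
    rw [hM, Real.le_log_iff_exp_le hBpos]
    exact le_max_right _ _
  set R := A - 1 / 2 - h / 2 with hR
  have hR0 : 0 < R := by linarith
  refine ⟨4 * R / h * (M + ‖Complex.log (Ξ 2)‖ + C * (1 + A) ^ 2), by positivity,
    fun z hz1 hz2 ↦ ?_⟩
  set T := z.im with hT
  set z0 : ℂ := (A : ℂ) + T * Complex.I with hz0
  have hz0re : z0.re = A := by simp [hz0]
  have hz0im : z0.im = T := by simp [hz0]
  set δ := min (h / 2) 1 with hδ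
  have hδ0 : 0 < δ := lt_min (by linarith) one_pos
  have hδ1 : δ ≤ h / 2 := min_le_left _ _
  have hδ2 : δ ≤ 1 := min_le_right _ _
  set Y := |T| + A with hY
  set c : ℝ := 2 * A + Y ^ 2 / δ + 1 with hc
  have hbig : ∀ w : ℂ, 1 / 2 + δ ≤ w.re → w.re ≤ 2 * A → |w.im| ≤ Y →
      w ∈ ball (c : ℂ) (c - 1 / 2) := fun w h1 h2 h3 ↦ mem_ball_of_re_of_im hδ0 le_rfl h1 h2 h3
  have h2mem : (2 : ℂ) ∈ ball (c : ℂ) (c - 1 / 2) := by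
    refine hbig 2 ?_ ?_ ?_
    · norm_num
      linarith
    · norm_num
      linarith
    · simp only [Complex.im_ofNat, abs_zero]
      positivity
  have hhalf : ∀ w ∈ ball (c : ℂ) (c - 1 / 2), 1 / 2 < w.re := by
    intro w hw
    rw [mem_ball, dist_eq_norm] at hw
    have := (Complex.abs_re_le_norm (w - c)).trans_lt hw
    rw [Complex.sub_re, Complex.ofReal_re] at this
    have := (abs_lt.mp this).1
    linarith
  obtain ⟨g, hg2, hgd, hge⟩ := exists_log_on_ball hd (fun w hw ↦ hne w (hhalf w hw)) h2mem
  have hz0mem : z0 ∈ ball (c : ℂ) (c - 1 / 2) := by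
    refine hbig z0 ?_ ?_ ?_
    · rw [hz0re]
      linarith
    · rw [hz0re]
      linarith
    · rw [hz0im, hY]
      linarith
  have hz0n : ‖z0‖ ≤ A + |T| := by
    have := Complex.norm_le_abs_re_add_abs_im z0
    rwa [hz0re, hz0im, abs_of_nonneg (by linarith)] at this
  have hgz0 : ‖g z0‖ ≤ ‖Complex.log (Ξ 2)‖ + C * (1 + A) ^ 2 * (1 + |T|) ^ 2 := by
    set s : Set ℂ := ball (c : ℂ) (c - 1 / 2) ∩ ({w | 2 ≤ w.re} ∩ closedBall 0 (A + |T|))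
    have hs : Convex ℝ s := (convex_ball _ _).inter
      ((convex_halfSpace_re_ge 2).inter (convex_closedBall _ _))
    have hT0 := abs_nonneg T
    have hp : (2 : ℂ) ∈ s := ⟨h2mem, by simp, by simp; linarith⟩
    have hq : z0 ∈ s := ⟨hz0mem, by simp [hz0re, hA], by simpa using hz0n⟩
    have h1 := hs.norm_image_sub_le_of_norm_hasDerivWithin_le (C := C * (1 + (A + |T|)))
      (fun w hw ↦ (hgd w hw.1).hasDerivWithinAt) (fun w hw ↦ by
        refine (hg w hw.2.1).trans (mul_le_mul_of_nonneg_left ?_ hC)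
        have : ‖w‖ ≤ A + |T| := by simpa using hw.2.2
        exact (one_add_norm_rpow_half_le w).trans (by linarith)) hp hq
    have h2 : ‖z0 - 2‖ ≤ A + |T| := by
      have h3 := Complex.norm_le_abs_re_add_abs_im (z0 - 2)
      rw [Complex.sub_re, Complex.sub_im, hz0re, hz0im] at h3
      simp only [Complex.re_ofNat, Complex.im_ofNat, sub_zero] at h3
      rw [abs_of_nonneg (by linarith : 0 ≤ A - 2)] at h3
      linarith
    have h4 : ‖g z0‖ ≤ ‖g 2‖ + ‖g z0 - g 2‖ := by
      have := norm_add_le (g 2) (g z0 - g 2)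
      simpa using this
    rw [hg2] at h4 h1
    have h5 : C * (1 + (A + |T|)) * ‖z0 - 2‖ ≤ C * (1 + A) ^ 2 * (1 + |T|) ^ 2 := by
      rw [mul_assoc, mul_assoc]
      refine mul_le_mul_of_nonneg_left ?_ hC
      have h6 : 1 + (A + |T|) ≤ (1 + A) * (1 + |T|) := by nlinarith
      calc (1 + (A + |T|)) * ‖z0 - 2‖ ≤ ((1 + A) * (1 + |T|)) * ((1 + A) * (1 + |T|)) :=
            mul_le_mul h6 (h2.trans (by linarith)) (norm_nonneg _) (by positivity)
        _ = _ := by ring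
    linarith
  have hball : ∀ v ∈ ball (0 : ℂ) R, z0 + v ∈ ball (c : ℂ) (c - 1 / 2) ∧
      (z0 + v).re ≤ 2 * A := by
    intro v hv
    rw [mem_ball_zero_iff] at hv
    have h1 := (Complex.abs_re_le_norm v).trans_lt hv
    have h2 := (Complex.abs_im_le_norm v).trans_lt hv
    have h3 := abs_lt.mp h1
    have h4 : (z0 + v).re = A + v.re := by rw [Complex.add_re, hz0re]
    refine ⟨hbig _ ?_ ?_ ?_, ?_⟩
    · rw [h4]
      linarith [h3.1]
    · rw [h4]
      linarith [h3.2]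
    · rw [Complex.add_im, hz0im]
      exact (abs_add_le _ _).trans (by linarith)
    · rw [h4]
      linarith [h3.2]
  have hzv : z - z0 = ((z.re - A : ℝ) : ℂ) := by
    apply Complex.ext <;> simp [hz0, hT]
  have hzn : ‖z - z0‖ = A - z.re := by
    rw [hzv, Complex.norm_real, Real.norm_eq_abs, abs_of_nonpos (by linarith)]
    ring
  have hmem : z - z0 ∈ ball (0 : ℂ) R := by
    rw [mem_ball_zero_iff, hzn]
    linarith
  have hBC := Complex.borelCaratheodory (f := fun v ↦ g (z0 + v)) (M := M) (R := R) (z := z - z0)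
    (by linarith)
    (fun v hv ↦ ((hgd _ (hball v hv).1).differentiableAt.comp v
      (by fun_prop : DifferentiableAt ℂ (fun v ↦ z0 + v) v)).differentiableWithinAt)
    (fun v hv ↦ by
      have h1 := hball v hv
      show (g (z0 + v)).re ≤ M
      rw [hM, Real.le_log_iff_exp_le hBpos, ← Complex.norm_exp, ← hge _ h1.1]
      exact (hB' _ (hhalf _ h1.1).le h1.2).trans (le_max_left _ _)) hR0 hmem
  simp only [add_sub_cancel, add_zero] at hBC
  rw [hzn] at hBC
  have hRr : h / 2 ≤ R - (A - z.re) := by linarith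
  have hfin : ‖g z‖ ≤ 4 * R / h * (M + ‖g z0‖) := by
    refine hBC.trans ?_
    rw [← add_div]
    calc (2 * M * (A - z.re) + ‖g z0‖ * (R + (A - z.re))) / (R - (A - z.re))
        ≤ (2 * M * R + ‖g z0‖ * (R + R)) / (h / 2) := by
          gcongr
          · linarith
          · linarith
      _ = _ := by
          field_simp
          ring
  have hzmem := (hball _ hmem).1
  rw [add_sub_cancel] at hzmem
  rw [hge z hzmem, Complex.norm_exp, Real.exp_le_exp]
  have h1 := (abs_le.mp (Complex.abs_re_le_norm (g z))).1
  have h2 : 4 * R / h * (M + ‖g z0‖) ≤ 4 * R / h *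
      (M + ‖Complex.log (Ξ 2)‖ + C * (1 + A) ^ 2) * (1 + |T|) ^ 2 := by
    rw [mul_assoc]
    refine mul_le_mul_of_nonneg_left ?_ (by positivity)
    have h3 : (1 : ℝ) ≤ (1 + |T|) ^ 2 := one_le_pow₀ (by linarith [abs_nonneg T])
    have h4 : 0 ≤ M + ‖Complex.log (Ξ 2)‖ := by positivity
    nlinarith
  linarith

end

section
open Filter Set Topology Metric

lemma exists_exp_sq_le (K c : ℝ) (hK : 0 ≤ K) (hc : 0 < c) :
    ∃ B, ∀ y : ℝ, K * (1 + |y|) ^ 2 ≤ B * Real.exp (c * |y|) := by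
  refine ⟨K * (2 + 4 / c ^ 2), fun y ↦ ?_⟩
  rw [mul_assoc]
  refine mul_le_mul_of_nonneg_left ?_ hK
  have h1 := Real.quadratic_le_exp_of_nonneg (x := c * |y|) (by positivity)
  have h2 : 0 ≤ c * |y| := by positivity
  have h3 : 1 + (c * |y|) ^ 2 / 2 ≤ Real.exp (c * |y|) := by linarith
  calc (1 + |y|) ^ 2 ≤ 2 + 2 * |y| ^ 2 := by nlinarith [sq_nonneg (1 - |y|)]
    _ ≤ (2 + 4 / c ^ 2) * (1 + (c * |y|) ^ 2 / 2) := by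
        have : (2 + 4 / c ^ 2) * (1 + (c * |y|) ^ 2 / 2) =
            2 + 2 * |y| ^ 2 + (4 / c ^ 2 + (c * |y|) ^ 2) := by
          field_simp
          ring
        rw [this]
        have : 0 ≤ 4 / c ^ 2 + (c * |y|) ^ 2 := by positivity
        linarith
    _ ≤ _ := by gcongr

lemma norm_sub_le_norm_add_of_re_logDeriv_nonneg {Ξ : ℂ → ℂ} (hd : Differentiable ℂ Ξ) {z : ℂ}
    {h : ℝ} (hh : 0 ≤ h) (hpos : ∀ w : ℂ, z.re - h ≤ w.re → 0 ≤ (logDeriv Ξ w).re) :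
    ‖Ξ (z - h)‖ ≤ ‖Ξ (z + h)‖ := by
  have hder := deriv_comp_const_add_ofReal hd z
  have hmono : MonotoneOn (fun u : ℝ ↦ ‖Ξ (z + u)‖ ^ 2) (Icc (-h) h) := by
    refine monotoneOn_of_deriv_nonneg (convex_Icc _ _)
      (fun u _ ↦ (hder u).continuousAt.continuousWithinAt)
      (fun u _ ↦ (hder u).differentiableAt.differentiableWithinAt) fun u hu ↦ ?_
    rw [interior_Icc] at hu
    rw [(hder u).deriv]
    have := hpos (z + u) (by simp; linarith [hu.1])
    positivity
  have h1 := hmono (left_mem_Icc.mpr (by linarith)) (right_mem_Icc.mpr (by linarith))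
    (by linarith : -h ≤ h)
  simp only [Complex.ofReal_neg, ← sub_eq_add_neg] at h1
  exact le_of_sq_le_sq h1 (norm_nonneg _)

lemma re_logDeriv_nonneg_of_norm_le {Ξ : ℂ → ℂ} (hd : Differentiable ℂ Ξ) {z : ℂ}
    (hz : Ξ z ≠ 0) (hle : ∀ h : ℝ, 0 < h → h < 1 → ‖Ξ (z - h)‖ ≤ ‖Ξ (z + h)‖) :
    0 ≤ (logDeriv Ξ z).re := by
  have hder := deriv_comp_const_add_ofReal hd z 0
  have hneg : HasDerivAt (fun u : ℝ ↦ ‖Ξ (z + (-u : ℝ))‖ ^ 2)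
      (-(2 * (‖Ξ z‖ ^ 2 * (logDeriv Ξ z).re))) 0 := by
    have h1 : HasDerivAt (fun u : ℝ ↦ ‖Ξ (z + u)‖ ^ 2)
      (2 * (‖Ξ (z + (0 : ℝ))‖ ^ 2 * (logDeriv Ξ (z + (0 : ℝ))).re)) (-0) := by
      rw [neg_zero]
      exact hder
    have h2 := h1.scomp (0 : ℝ) (hasDerivAt_neg (0 : ℝ))
    simpa [Function.comp_def] using h2
  simp only [Complex.ofReal_zero, add_zero] at hder
  have h3 := (hder.sub hneg).tendsto_slope_zero_right
  have h4 : 0 ≤ 2 * (‖Ξ z‖ ^ 2 * (logDeriv Ξ z).re) - -(2 * (‖Ξ z‖ ^ 2 * (logDeriv Ξ z).re)) := by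
    refine ge_of_tendsto h3 ?_
    filter_upwards [Ioo_mem_nhdsGT (zero_lt_one' ℝ)] with u hu
    have h5 := hle u hu.1 hu.2
    have h6 : ‖Ξ (z - u)‖ ^ 2 ≤ ‖Ξ (z + u)‖ ^ 2 := by gcongr
    have h7 : 0 < u := hu.1
    simp only [Pi.sub_apply, zero_add, Complex.ofReal_neg, Complex.ofReal_zero, add_zero,
      sub_self, sub_zero, smul_eq_mul, ← sub_eq_add_neg]
    have h8 : 0 ≤ ‖Ξ (z + u)‖ ^ 2 - ‖Ξ (z - u)‖ ^ 2 := by linarith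
    positivity
  have h5 : 0 < ‖Ξ z‖ ^ 2 := by positivity
  by_contra! h6
  nlinarith

variable {Ξ : ℂ → ℂ} (hd : Differentiable ℂ Ξ) (hne : ∀ z : ℂ, 1 / 2 < z.re → Ξ z ≠ 0)
  (hB : ∀ a b : ℝ, ∃ C, ∀ s : ℂ, a ≤ s.re → s.re ≤ b → ‖Ξ s‖ ≤ C)
  (hsym : ∀ z : ℂ, ‖Ξ (1 - starRingEnd ℂ z)‖ = ‖Ξ z‖)
  {C : ℝ} (hC : 0 ≤ C)
  (hg : ∀ z : ℂ, 2 ≤ z.re → ‖logDeriv Ξ z‖ ≤ C * (1 + ‖z‖) ^ (1 / 2 : ℝ))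
  {A₀ : ℝ} (hpos : ∀ z : ℂ, A₀ ≤ z.re → 0 ≤ (logDeriv Ξ z).re)
include hd hne hB hsym hC hg hpos

/-- An entire function with the symmetry of a completed `L`-function whose zeros lie on the
critical line increases in modulus away from that line. -/
lemma norm_sub_le_norm_add_of_symm {h : ℝ} (hh : 0 < h) (hh1 : h < 1) {z : ℂ}
    (hz : 1 / 2 ≤ z.re) : ‖Ξ (z - h)‖ ≤ ‖Ξ (z + h)‖ := by
  set A := max (max (A₀ + 1) 2) (z.re) with hA
  have hA1 : A₀ + 1 ≤ A := (le_max_left _ _).trans (le_max_left _ _)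
  have hA2 : 2 ≤ A := (le_max_right _ _).trans (le_max_left _ _)
  have hA3 : z.re ≤ A := le_max_right _ _
  have hne' : ∀ w : ℂ, 1 / 2 ≤ w.re → Ξ (w + h) ≠ 0 := fun w hw ↦
    hne _ (by simp; linarith)
  obtain ⟨K, hK, hlow⟩ := exists_exp_le_norm hd hne hB hC hg hh (by linarith : 2 ≤ A + 1)
  obtain ⟨B, hBd⟩ := hB (-1) A
  have hπ : 0 < Real.pi / (A - 1 / 2) := div_pos Real.pi_pos (by linarith)
  set c := Real.pi / (A - 1 / 2) / 2 with hc
  have hc0 : 0 < c := by positivity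
  obtain ⟨D, hD⟩ := exists_exp_sq_le K c hK hc0
  have hcl : closure (Complex.re ⁻¹' Ioo (1 / 2) A) ⊆ {w : ℂ | 1 / 2 ≤ w.re} :=
    closure_minimal (fun w hw ↦ hw.1.le) (isClosed_le continuous_const Complex.continuous_re)
  have hdiff : DiffContOnCl ℂ (fun w ↦ Ξ (w - h) / Ξ (w + h)) (Complex.re ⁻¹' Ioo (1 / 2) A) := by
    refine DifferentiableOn.diffContOnCl fun w hw ↦ ?_
    have h1 : Differentiable ℂ fun w : ℂ ↦ Ξ (w - h) := hd.comp (by fun_prop)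
    have h2 : Differentiable ℂ fun w : ℂ ↦ Ξ (w + h) := hd.comp (by fun_prop)
    exact ((h1 w).div (h2 w) (hne' w (hcl hw))).differentiableWithinAt
  have hPL := PhragmenLindelof.vertical_strip (C := 1) (z := z) hdiff
    ⟨c, half_lt_self hπ, D, ?_⟩ ?_ ?_ hz hA3
  · rw [norm_div] at hPL
    exact (div_le_one (norm_pos_iff.mpr (hne' z hz))).mp hPL
  · refine Asymptotics.IsBigO.of_bound (max B 0) ?_
    refine mem_inf_of_right fun w hw ↦ ?_
    have hw1 : 1 / 2 < w.re := hw.1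
    have hw2 : w.re < A := hw.2
    have h1 : ‖Ξ (w - h)‖ ≤ max B 0 :=
      (hBd _ (by simp; linarith) (by simp; linarith)).trans (le_max_left _ _)
    have h2 := hlow (w + h) (by simp; linarith) (by simp; linarith)
    simp only [Complex.add_im, Complex.ofReal_im, add_zero] at h2
    show ‖Ξ (w - h) / Ξ (w + h)‖ ≤ _
    rw [norm_div, Real.norm_of_nonneg (Real.exp_pos _).le]
    calc ‖Ξ (w - h)‖ / ‖Ξ (w + h)‖ ≤ max B 0 / Real.exp (-(K * (1 + |w.im|) ^ 2)) := by
          gcongr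
      _ = max B 0 * Real.exp (K * (1 + |w.im|) ^ 2) := by
          rw [Real.exp_neg, div_inv_eq_mul]
      _ ≤ _ := by
          exact mul_le_mul_of_nonneg_left (Real.exp_le_exp.mpr (hD _)) (le_max_right _ _)
  · intro w hw
    rw [norm_div]
    refine (div_le_one (norm_pos_iff.mpr (hne' w hw.ge))).mpr (le_of_eq ?_)
    rw [← hsym (w + h)]
    congr 2
    apply Complex.ext
    · simp [hw]
      ring
    · simp
  · intro w hw
    rw [norm_div]
    refine (div_le_one (norm_pos_iff.mpr (hne' w (by rw [hw]; linarith)))).mpr ?_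
    exact norm_sub_le_norm_add_of_re_logDeriv_nonneg hd hh.le fun v hv ↦ hpos v (by
      rw [hw] at hv
      linarith)

lemma re_logDeriv_nonneg_of_symm {z : ℂ} (hz : 1 / 2 < z.re) : 0 ≤ (logDeriv Ξ z).re :=
  re_logDeriv_nonneg_of_norm_le hd (hne z hz) fun _ h0 h1 ↦
    norm_sub_le_norm_add_of_symm hd hne hB hsym hC hg hpos h0 h1 hz.le

lemma exists_norm_logDeriv_le_of_symm {ε : ℝ} (hε : 0 < ε) :
    ∃ C', 0 ≤ C' ∧ ∀ z : ℂ, 1 / 2 + ε ≤ z.re →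
      ‖logDeriv Ξ z‖ ≤ C' * (1 + ‖z‖) ^ (1 / 2 : ℝ) := by
  refine ⟨max C ((3 + 9 * C) / ε), le_max_of_le_left hC, fun z hz ↦ ?_⟩
  rcases le_or_gt 2 z.re with h2 | h2
  · exact (hg z h2).trans (by gcongr; exact le_max_left _ _)
  have hpos' : ∀ w : ℂ, 1 / 2 < w.re → 0 ≤ (logDeriv Ξ w).re := fun w hw ↦
    re_logDeriv_nonneg_of_symm hd hne hB hsym hC hg hpos hw
  set z0 : ℂ := (2 : ℝ) + z.im * Complex.I with hz0
  have hz0re : z0.re = 2 := by simp [hz0]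
  have hz0im : z0.im = z.im := by simp [hz0]
  have hball : ∀ v ∈ ball (0 : ℂ) (3 / 2), 1 / 2 < (z0 + v).re := by
    intro v hv
    rw [mem_ball_zero_iff] at hv
    have h1 := abs_lt.mp ((Complex.abs_re_le_norm v).trans_lt hv)
    rw [Complex.add_re, hz0re]
    linarith [h1.1]
  have hzv : z - z0 = ((z.re - 2 : ℝ) : ℂ) := by
    apply Complex.ext <;> simp [hz0]
  have hzn : ‖z - z0‖ = 2 - z.re := by
    rw [hzv, Complex.norm_real, Real.norm_eq_abs, abs_of_nonpos (by linarith)]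
    ring
  have hBC := Complex.borelCaratheodory (f := fun v ↦ -logDeriv Ξ (z0 + v)) (M := 1) (R := 3 / 2)
    (z := z - z0) one_pos
    (fun v hv ↦ by
      have h1 : DifferentiableAt ℂ (logDeriv Ξ) (z0 + v) :=
        (hd.deriv _).div (hd _) (hne _ (hball v hv))
      exact (h1.comp v (by fun_prop : DifferentiableAt ℂ (fun v ↦ z0 + v) v)).neg
        |>.differentiableWithinAt)
    (fun v hv ↦ by
      have := hpos' _ (hball v hv)
      show (-logDeriv Ξ (z0 + v)).re ≤ 1
      rw [Complex.neg_re]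
      linarith) (by norm_num) (by rw [mem_ball_zero_iff, hzn]; linarith)
  simp only [add_sub_cancel, add_zero, norm_neg] at hBC
  rw [hzn] at hBC
  have hz0n : ‖z0‖ ≤ 2 + ‖z‖ := by
    have h3 := Complex.norm_le_abs_re_add_abs_im z0
    rw [hz0re, hz0im, abs_of_nonneg (by norm_num : (0 : ℝ) ≤ 2)] at h3
    linarith [Complex.abs_im_le_norm z]
  have hroot : (1 + ‖z0‖) ^ (1 / 2 : ℝ) ≤ 3 * (1 + ‖z‖) ^ (1 / 2 : ℝ) := by
    calc (1 + ‖z0‖) ^ (1 / 2 : ℝ) ≤ (9 * (1 + ‖z‖)) ^ (1 / 2 : ℝ) := by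
          gcongr
          linarith [norm_nonneg z]
      _ = (3 ^ (2 : ℝ)) ^ (1 / 2 : ℝ) * (1 + ‖z‖) ^ (1 / 2 : ℝ) := by
          rw [Real.mul_rpow (by norm_num) (by positivity)]
          norm_num
      _ = _ := by
          rw [← Real.rpow_mul (by norm_num)]
          norm_num
  have h1r : 1 ≤ (1 + ‖z‖) ^ (1 / 2 : ℝ) :=
    Real.one_le_rpow (by linarith [norm_nonneg z]) (by norm_num)
  have h3 := hg z0 hz0re.ge
  have h4 : ‖logDeriv Ξ z0‖ ≤ C * (3 * (1 + ‖z‖) ^ (1 / 2 : ℝ)) :=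
    h3.trans (mul_le_mul_of_nonneg_left hroot hC)
  have hden : ε ≤ 3 / 2 - (2 - z.re) := by linarith
  have n1 : 2 * 1 * (2 - z.re) ≤ 3 * (1 + ‖z‖) ^ (1 / 2 : ℝ) := by linarith
  have n2 : ‖logDeriv Ξ z0‖ * (3 / 2 + (2 - z.re)) ≤ C * (3 * (1 + ‖z‖) ^ (1 / 2 : ℝ)) * 3 :=
    mul_le_mul h4 (by linarith) (by linarith) (by positivity)
  refine hBC.trans ?_
  rw [← add_div]
  calc (2 * 1 * (2 - z.re) + ‖logDeriv Ξ z0‖ * (3 / 2 + (2 - z.re))) / (3 / 2 - (2 - z.re))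
      ≤ (3 * (1 + ‖z‖) ^ (1 / 2 : ℝ) + C * (3 * (1 + ‖z‖) ^ (1 / 2 : ℝ)) * 3) / ε := by
        exact div_le_div₀ (by positivity) (add_le_add n1 n2) hε hden
    _ = (3 + 9 * C) / ε * (1 + ‖z‖) ^ (1 / 2 : ℝ) := by ring
    _ ≤ _ := by
        gcongr
        exact le_max_right _ _

end

section
open Filter MeasureTheory Set Topology

lemma logDeriv_const_cpow {r : ℝ} (hr : 0 < r) {g : ℂ → ℂ} {z : ℂ} (hg : DifferentiableAt ℂ g z) :
    logDeriv (fun w ↦ (r : ℂ) ^ g w) z = Real.log r * deriv g z := by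
  have hr0 : (r : ℂ) ≠ 0 := by exact_mod_cast hr.ne'
  have h := hg.hasDerivAt.const_cpow (c := (r : ℂ)) (Or.inl hr0)
  have h0 : (r : ℂ) ^ g z ≠ 0 := by simp [Complex.cpow_eq_zero_iff, hr0]
  rw [logDeriv_apply, h.deriv, Complex.ofReal_log hr.le, mul_assoc, mul_div_cancel_left₀ _ h0]

lemma logDeriv_Gammaℝ {z : ℂ} (hz : 0 < z.re) :
    logDeriv Gammaℝ z = -(Real.log Real.pi / 2 : ℝ) + 1 / 2 * Complex.digamma (z / 2) := by
  have hz2 : ∀ m : ℕ, z / 2 ≠ -m := fun m h ↦ by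
    have h1 : (z / 2).re = -m := by rw [h]; simp
    rw [Complex.div_ofNat_re] at h1
    have h2 : (0 : ℝ) ≤ m := m.cast_nonneg
    linarith
  have h0 : Complex.Gamma (z / 2) ≠ 0 := Complex.Gamma_ne_zero hz2
  have hπ : (Real.pi : ℂ) ≠ 0 := by exact_mod_cast Real.pi_ne_zero
  have h1 : DifferentiableAt ℂ (fun w : ℂ ↦ -w / 2) z := by fun_prop
  have h2 : DifferentiableAt ℂ (fun w : ℂ ↦ (Real.pi : ℂ) ^ (-w / 2)) z :=
    h1.const_cpow (Or.inl hπ)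
  have h3 : DifferentiableAt ℂ (fun w : ℂ ↦ w / 2) z := by fun_prop
  have h4 : DifferentiableAt ℂ Complex.Gamma (z / 2) := Complex.differentiableAt_Gamma _ hz2
  have h5 : DifferentiableAt ℂ (fun w : ℂ ↦ Complex.Gamma (w / 2)) z := h4.comp z h3
  have h6 : Gammaℝ = fun w : ℂ ↦ (Real.pi : ℂ) ^ (-w / 2) * Complex.Gamma (w / 2) := by
    funext w
    exact Gammaℝ_def w
  have h7 := logDeriv_comp (f := Complex.Gamma) (g := fun w : ℂ ↦ w / 2) (x := z) h4 h3
  rw [h6, logDeriv_mul z (by simp [Complex.cpow_eq_zero_iff, hπ]) h0 h2 h5,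
    logDeriv_const_cpow Real.pi_pos h1,
    show (fun w : ℂ ↦ Complex.Gamma (w / 2)) = Complex.Gamma ∘ fun w : ℂ ↦ w / 2 from rfl, h7,
    Complex.digamma_def]
  have h8 : deriv (fun w : ℂ ↦ -w / 2) z = -1 / 2 := by
    simp [deriv_div_const]
  have h9 : deriv (fun w : ℂ ↦ w / 2) z = 1 / 2 := by
    simp [deriv_div_const]
  rw [h8, h9]
  push_cast
  ring

variable {q : ℕ} [NeZero q]

/-- The logarithmic derivative of a Dirichlet `L`-function is bounded on `2 ≤ re z`. -/
lemma exists_norm_logDeriv_LFunction_le (χ : DirichletCharacter ℂ q) :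
    ∃ C, 0 ≤ C ∧ ∀ z : ℂ, 2 ≤ z.re → ‖logDeriv (DirichletCharacter.LFunction χ) z‖ ≤ C := by
  set f : ℕ → ℂ := (fun n : ℕ ↦ χ n) * fun n : ℕ ↦ (vonMangoldt n : ℂ) with hf
  have hs : LSeriesSummable f (2 : ℂ) :=
    DirichletCharacter.LSeriesSummable_twist_vonMangoldt χ (by norm_num)
  refine ⟨∑' n, ‖LSeries.term f 2 n‖, tsum_nonneg fun _ ↦ norm_nonneg _, fun z hz ↦ ?_⟩
  have hle : ∀ n, ‖LSeries.term f z n‖ ≤ ‖LSeries.term f 2 n‖ := fun n ↦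
    LSeries.norm_term_le_of_re_le_re f (by simpa using hz) n
  rw [logDeriv_LFunction_eq χ (by linarith), norm_neg, LSeries]
  exact (norm_tsum_le_tsum_norm (hs.norm.of_nonneg_of_le (fun _ ↦ norm_nonneg _) hle)).trans
    ((hs.norm.of_nonneg_of_le (fun _ ↦ norm_nonneg _) hle).tsum_le_tsum hle hs.norm)

lemma LFunction_ne_zero_of_GRH {χ : DirichletCharacter ℂ q} (hχ : χ ≠ 1) (h : GRH χ) {z : ℂ}
    (hz : 1 / 2 < z.re) : DirichletCharacter.LFunction χ z ≠ 0 := by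
  rcases lt_or_ge z.re 1 with h1 | h1
  · exact fun h0 ↦ hz.ne' (h z h0 (by linarith) h1)
  · exact DirichletCharacter.LFunction_ne_zero_of_one_le_re χ (Or.inl hχ) h1

lemma logDeriv_xiFun {χ : DirichletCharacter ℂ q} (hχ : χ ≠ 1) {z : ℂ} (hz : 0 < z.re)
    (h0 : DirichletCharacter.LFunction χ z ≠ 0) :
    logDeriv (xiFun χ) z = ((Real.log q - Real.log Real.pi) / 2 : ℝ) +
      1 / 2 * Complex.digamma ((z + parity χ) / 2) + logDeriv (DirichletCharacter.LFunction χ) z := by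
  have hq0 : (0 : ℝ) < q := Nat.cast_pos.mpr (NeZero.pos q)
  have hqc : ((q : ℝ) : ℂ) ≠ 0 := by exact_mod_cast hq0.ne'
  have hev : xiFun χ =ᶠ[𝓝 z] fun w ↦ ((q : ℝ) : ℂ) ^ (w / 2) *
      (DirichletCharacter.LFunction χ w * Gammaℝ (w + parity χ)) := by
    filter_upwards [(isOpen_lt continuous_const Complex.continuous_re).mem_nhds hz] with w hw
    rw [xiFun, completedLFunction_eq_mul χ hw, gammaFactor_eq]
    simp
  have ha : 0 < (z + parity χ : ℂ).re := by
    simp only [Complex.add_re, Complex.ofReal_re]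
    linarith [parity_nonneg χ]
  have hG0 : Gammaℝ (z + parity χ) ≠ 0 := Gammaℝ_ne_zero_of_re_pos ha
  have h1 : DifferentiableAt ℂ (fun w : ℂ ↦ w / 2) z := by fun_prop
  have h2 : DifferentiableAt ℂ (fun w : ℂ ↦ ((q : ℝ) : ℂ) ^ (w / 2)) z :=
    h1.const_cpow (Or.inl hqc)
  have h3 : DifferentiableAt ℂ (DirichletCharacter.LFunction χ) z :=
    DirichletCharacter.differentiable_LFunction hχ z
  have h4 : DifferentiableAt ℂ Gammaℝ (z + parity χ) := by
    have h := (differentiable_Gammaℝ_inv (z + parity χ)).fun_inv (inv_ne_zero hG0)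
    simpa only [inv_inv] using h
  have h5 : DifferentiableAt ℂ (fun w : ℂ ↦ w + parity χ) z := by fun_prop
  have h6 : DifferentiableAt ℂ (fun w : ℂ ↦ Gammaℝ (w + parity χ)) z := DifferentiableAt.fun_comp' z h4 h5
  have h7 := logDeriv_comp (f := Gammaℝ) (g := fun w : ℂ ↦ w + parity χ) (x := z) h4 h5
  have h8 : deriv (fun w : ℂ ↦ w + parity χ) z = 1 := by simp
  have h9 : deriv (fun w : ℂ ↦ w / 2) z = 1 / 2 := by
    simp [deriv_div_const]
  have h10 := logDeriv_mul z (g := fun w : ℂ ↦ Gammaℝ (w + parity χ)) h0 hG0 h3 h6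
  have h11 := logDeriv_mul z (f := fun w : ℂ ↦ ((q : ℝ) : ℂ) ^ (w / 2))
    (g := fun w ↦ DirichletCharacter.LFunction χ w * Gammaℝ (w + parity χ))
    (fun h ↦ hqc (Complex.cpow_eq_zero_iff _ _ |>.mp h).1) (mul_ne_zero h0 hG0) h2 (h3.mul h6)
  rw [(logDeriv_congr_nhds hev).self_of_nhds, h11, h10, logDeriv_const_cpow hq0 h1,
    show (fun w : ℂ ↦ Gammaℝ (w + parity χ)) = Gammaℝ ∘ fun w : ℂ ↦ w + parity χ from rfl, h7,
    logDeriv_Gammaℝ ha, h8, h9]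
  push_cast
  ring

lemma norm_digamma_half_add_le {δ : ℝ} (hδ : 0 < δ) (hδ1 : δ ≤ 1) :
    ∃ C, 0 ≤ C ∧ ∀ (a : ℝ), 0 ≤ a → a ≤ 1 → ∀ z : ℂ, δ ≤ z.re →
      ‖1 / 2 * Complex.digamma ((z + a) / 2)‖ ≤ C * (1 + ‖z‖) ^ (1 / 2 : ℝ) := by
  obtain ⟨C, hC, h⟩ := norm_digamma_le (half_pos hδ) (by linarith)
  refine ⟨C, hC, fun a ha0 ha1 z hz ↦ ?_⟩
  have h1 : δ / 2 ≤ ((z + a) / 2).re := by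
    rw [Complex.div_ofNat_re]
    simp only [Complex.add_re, Complex.ofReal_re]
    linarith
  have h2 : ‖(z + a) / 2‖ ≤ (‖z‖ + 1) / 2 := by
    rw [norm_div, Complex.norm_ofNat]
    have := norm_add_le z a
    rw [Complex.norm_real, Real.norm_of_nonneg ha0] at this
    linarith
  have h3 : (1 + ‖(z + a) / 2‖) ^ (1 / 2 : ℝ) ≤ (2 ^ 2 * (1 + ‖z‖)) ^ (1 / 2 : ℝ) := by
    gcongr
    linarith [norm_nonneg z]
  rw [Real.mul_rpow (by norm_num) (by positivity), ← Real.sqrt_eq_rpow (2 ^ 2),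
    Real.sqrt_sq (by norm_num)] at h3
  rw [norm_mul]
  have h4 := (h _ h1).trans (mul_le_mul_of_nonneg_left h3 hC)
  norm_num
  norm_num at h4
  linarith

/-- Under the Riemann hypothesis for `L(s, χ)`, the logarithmic derivative of the completed
function has nonnegative real part to the right of the critical line. -/
lemma re_logDeriv_xiFun_nonneg {χ : DirichletCharacter ℂ q} (hq : 1 < q) (hp : χ.IsPrimitive)
    (hχ : χ ≠ 1) (h : GRH χ) :
    (∀ z : ℂ, 1 / 2 < z.re → 0 ≤ (logDeriv (xiFun χ) z).re) ∧
    ∀ ε : ℝ, 0 < ε → ∃ C, 0 ≤ C ∧ ∀ z : ℂ, 1 / 2 + ε ≤ z.re →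
      ‖logDeriv (xiFun χ) z‖ ≤ C * (1 + ‖z‖) ^ (1 / 2 : ℝ) := by
  have hL0 : ∀ z : ℂ, 1 / 2 < z.re → DirichletCharacter.LFunction χ z ≠ 0 := fun z hz ↦
    LFunction_ne_zero_of_GRH hχ h hz
  have hne : ∀ z : ℂ, 1 / 2 < z.re → xiFun χ z ≠ 0 := fun z hz ↦
    xiFun_ne_zero_of_LFunction (by linarith) (hL0 z hz)
  obtain ⟨C₁, hC₁, h1⟩ := exists_norm_logDeriv_LFunction_le χ
  obtain ⟨C₂, hC₂, h2⟩ := norm_digamma_half_add_le one_pos le_rfl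
  set c : ℝ := (Real.log q - Real.log Real.pi) / 2 with hc
  have hg : ∀ z : ℂ, 2 ≤ z.re →
      ‖logDeriv (xiFun χ) z‖ ≤ (|c| + C₂ + C₁) * (1 + ‖z‖) ^ (1 / 2 : ℝ) := by
    intro z hz
    rw [logDeriv_xiFun hχ (by linarith) (hL0 z (by linarith))]
    refine (norm_add₃_le).trans ?_
    have h3 := h2 (parity χ) (parity_nonneg χ) (parity_le_one χ) z (by linarith)
    have h4 := h1 z hz
    have h5 := one_le_rpow_half z
    rw [Complex.norm_real, Real.norm_eq_abs, add_mul, add_mul]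
    have h6 := le_mul_of_one_le_right (abs_nonneg c) h5
    have h7 := le_mul_of_one_le_right hC₁ h5
    linarith
  obtain ⟨A, hA1, hA⟩ := exists_le_re_digamma (2 * (C₁ - c))
  have hpos : ∀ z : ℂ, 2 * A ≤ z.re → 0 ≤ (logDeriv (xiFun χ) z).re := by
    intro z hz
    rw [logDeriv_xiFun hχ (by linarith) (hL0 z (by linarith))]
    have h3 := hA ((z + parity χ) / 2) (by
      rw [Complex.div_ofNat_re]
      simp only [Complex.add_re, Complex.ofReal_re]
      linarith [parity_nonneg χ])
    have h4 := (abs_le.mp ((Complex.abs_re_le_norm _).trans (h1 z (by linarith)))).1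
    have h5 : (1 / 2 * Complex.digamma ((z + parity χ) / 2)).re =
        1 / 2 * (Complex.digamma ((z + parity χ) / 2)).re := by
      rw [show (1 / 2 : ℂ) = ((1 / 2 : ℝ) : ℂ) by norm_num, Complex.re_ofReal_mul]
    rw [Complex.add_re, Complex.add_re, h5, Complex.ofReal_re]
    linarith
  have hd := differentiable_xiFun hχ
  have hB := exists_norm_xiFun_le hq hχ
  have hsym := norm_xiFun_one_sub_conj hχ hp
  exact ⟨fun z hz ↦ re_logDeriv_nonneg_of_symm hd hne hB hsym (by positivity) hg hpos hz,
    fun ε hε ↦ exists_norm_logDeriv_le_of_symm hd hne hB hsym (by positivity) hg hpos hε⟩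

lemma ne_one_of_isPrimitive {χ : DirichletCharacter ℂ q} (hq : 1 < q) (hp : χ.IsPrimitive) :
    χ ≠ 1 := by
  rintro rfl
  rw [DirichletCharacter.isPrimitive_def, DirichletCharacter.conductor_one] at hp
  omega

end

section
open Filter MeasureTheory Set Topology

lemma differentiableAt_digamma {w : ℂ} (hw : 0 < w.re) : DifferentiableAt ℂ Complex.digamma w := by
  have hne : ∀ v : ℂ, 0 < v.re → ∀ m : ℕ, v ≠ -m := fun v hv m h ↦ by
    rw [h] at hv
    have h2 : (0 : ℝ) ≤ m := m.cast_nonneg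
    simp at hv
    linarith
  have hopen : IsOpen {v : ℂ | 0 < v.re} := isOpen_lt continuous_const Complex.continuous_re
  have h1 : DifferentiableOn ℂ Complex.Gamma {v : ℂ | 0 < v.re} := fun v hv ↦
    (Complex.differentiableAt_Gamma v (hne v hv)).differentiableWithinAt
  rw [Complex.digamma_def]
  exact ((h1.deriv hopen).differentiableAt (hopen.mem_nhds hw)).div
    (Complex.differentiableAt_Gamma w (hne w hw)) (Complex.Gamma_ne_zero (hne w hw))

variable {q : ℕ} [NeZero q]

lemma differentiableAt_logDeriv_xiFun {χ : DirichletCharacter ℂ q} (hχ : χ ≠ 1) (h : GRH χ) {z : ℂ}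
    (hz : 1 / 2 < z.re) : DifferentiableAt ℂ (logDeriv (xiFun χ)) z :=
  ((differentiable_xiFun hχ).deriv z).div (differentiable_xiFun hχ z)
    (xiFun_ne_zero_of_LFunction (by linarith) (LFunction_ne_zero_of_GRH hχ h hz))

lemma differentiableAt_logDeriv_LFunction {χ : DirichletCharacter ℂ q} (hχ : χ ≠ 1) (h : GRH χ)
    {z : ℂ} (hz : 1 / 2 < z.re) :
    DifferentiableAt ℂ (logDeriv (DirichletCharacter.LFunction χ)) z :=
  ((DirichletCharacter.differentiable_LFunction hχ).deriv z).div
    (DirichletCharacter.differentiable_LFunction hχ z) (LFunction_ne_zero_of_GRH hχ h hz)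

/-- Selberg's approximation of `L'/L` by a Dirichlet polynomial, with the contribution of the zeros
bounded on a vertical line to the right of the critical line. -/
lemma norm_Dpoly_add_logDeriv_le_of_lt {χ : DirichletCharacter ℂ q} (hq : 1 < q)
    (hp : χ.IsPrimitive) (h : GRH χ) {x c : ℝ} {s : ℂ} (hx : 1 < x) (hc : 1 / 2 < c) (hc1 : c ≤ 1)
    (hcs : c < s.re) :
    Real.log x * ‖Dpoly χ x s + logDeriv (DirichletCharacter.LFunction χ) s‖ ≤
      (Real.exp (-(Real.log x * (s.re - c))) + Real.exp (-(2 * Real.log x * (s.re - c))))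
        / (s.re - c) * (logDeriv (xiFun χ) s).re +
      (Real.exp (-(Real.log x * s.re)) + Real.exp (-(2 * Real.log x * s.re))) / 4 *
        ∑' k : ℕ, 1 / ‖(s + parity χ) / 2 + k‖ ^ 2 := by
  have hχ := ne_one_of_isPrimitive hq hp
  set L := Real.log x with hL
  have hL0 : 0 < L := Real.log_pos hx
  set ℓ := logDeriv (DirichletCharacter.LFunction χ) with hℓ
  set f := logDeriv (xiFun χ) with hf
  set κ : ℂ := (((Real.log q - Real.log Real.pi) / 2 : ℝ) : ℂ) with hκ
  obtain ⟨hre, hgrow⟩ := re_logDeriv_xiFun_nonneg hq hp hχ h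
  obtain ⟨A, hA0, hA⟩ := hgrow (c - 1 / 2) (by linarith)
  replace hA : ∀ z : ℂ, c ≤ z.re → ‖f z‖ ≤ A * (1 + ‖z‖) ^ (1 / 2 : ℝ) := fun z hz ↦
    hA z (by linarith)
  obtain ⟨B, hB0, hB⟩ := norm_digamma_half_add_le (δ := c) (by linarith) hc1
  specialize hB (parity χ) (parity_nonneg χ) (parity_le_one χ)
  have hform : ∀ z : ℂ, c ≤ z.re →
      f z = κ + 1 / 2 * Complex.digamma ((z + parity χ) / 2) + ℓ z := fun z hz ↦
    logDeriv_xiFun hχ (by linarith) (LFunction_ne_zero_of_GRH hχ h (by linarith))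
  have hκb : ∀ z : ℂ, ‖κ‖ ≤ ‖κ‖ * (1 + ‖z‖) ^ (1 / 2 : ℝ) := fun z ↦
    le_mul_of_one_le_right (norm_nonneg _) (one_le_rpow_half z)
  have hℓb : ∀ z : ℂ, c ≤ z.re → ‖ℓ z‖ ≤ (A + ‖κ‖ + B) * (1 + ‖z‖) ^ (1 / 2 : ℝ) := by
    intro z hz
    have e : ℓ z = f z - κ - 1 / 2 * Complex.digamma ((z + parity χ) / 2) := by
      rw [hform z hz]
      ring
    rw [e, add_mul, add_mul]
    exact (norm_sub_le _ _).trans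
      (add_le_add ((norm_sub_le _ _).trans (add_le_add (hA z hz) (hκb z))) (hB z hz))
  have hfd : ∀ z : ℂ, c ≤ z.re → DifferentiableAt ℂ f z := fun z hz ↦
    differentiableAt_logDeriv_xiFun hχ h (by linarith)
  have hℓd : ∀ z : ℂ, c ≤ z.re → DifferentiableAt ℂ ℓ z := fun z hz ↦
    differentiableAt_logDeriv_LFunction hχ h (by linarith)
  have hψc : ContinuousOn (fun z : ℂ ↦ 1 / 2 * Complex.digamma ((z + parity χ) / 2))
      {z | z.re = c} := by
    intro z hz
    have hw : 0 < ((z + parity χ) / 2).re := by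
      rw [Complex.div_ofNat_re, Complex.add_re, Complex.ofReal_re, show z.re = c from hz]
      linarith [parity_nonneg χ]
    have h1 : ContinuousAt (fun z : ℂ ↦ Complex.digamma ((z + parity χ) / 2)) z :=
      ContinuousAt.comp (f := fun z : ℂ ↦ (z + parity χ) / 2)
        (differentiableAt_digamma hw).continuousAt (by fun_prop)
    exact (continuousAt_const.mul h1).continuousWithinAt
  set b := s.re + 2 with hb
  have hbs : s.re < b := by linarith
  have hE := differentiable_selE L s
  have hM : ∀ z : ℂ, z.re ≤ b → ‖selE L s z‖ ≤
      Real.exp (L * (b - s.re)) + Real.exp (2 * L * (b - s.re)) := fun z hz ↦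
    norm_selE_le_of_re_le hL0.le hz
  have hcb : c ≤ b := by linarith
  have i1 := integrable_vertical_kernel (h := fun _ ↦ κ) hcs.ne continuousOn_const hE.continuous
    (fun z _ ↦ hκb z) (fun z hz ↦ hM z (hz.le.trans hcb))
  have i2 := integrable_vertical_kernel hcs.ne hψc hE.continuous
    (fun z hz ↦ hB z hz.ge) (fun z hz ↦ hM z (hz.le.trans hcb))
  have i3 := integrable_vertical_kernel (h := ℓ) hcs.ne
    (fun z hz ↦ (hℓd z (ge_of_eq hz)).continuousAt.continuousWithinAt) hE.continuous
    (fun z hz ↦ hℓb z hz.ge) (fun z hz ↦ hM z (hz.le.trans hcb))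
  have hsplit : vInt (fun z ↦ f z * (selE L s z / (z - s) ^ 2)) c =
      vInt (fun z ↦ κ * (selE L s z / (z - s) ^ 2)) c +
      vInt (fun z ↦ (1 / 2 * Complex.digamma ((z + parity χ) / 2)) *
        (selE L s z / (z - s) ^ 2)) c +
      vInt (fun z ↦ ℓ z * (selE L s z / (z - s) ^ 2)) c := by
    unfold vInt
    rw [← integral_add i1 i2]
    refine Eq.trans ?_ (integral_add (i1.add i2) i3)
    congr 1
    funext y
    beta_reduce
    rw [hform _ (by simp)]
    ring
  have hconst : vInt (fun z ↦ κ * (selE L s z / (z - s) ^ 2)) c = 0 :=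
    vInt_eq_zero_of_left_of_bound (h := fun _ ↦ κ) (A := ‖κ‖) hcs (by fun_prop) hE
      (fun z _ ↦ hκb z) (fun z hz ↦ hM z (hz.trans hcb))
  have hshift := vInt_sub_vInt_of_zero (h := ℓ) hcs hbs
    (fun z hz ↦ (hℓd z hz.1).differentiableWithinAt) hE (selE_self L s)
    (fun z hz _ ↦ hℓb z hz) (fun z _ hz ↦ hM z hz)
  rw [vInt_logDeriv_LFunction χ hx (by linarith) hbs, deriv_selE_self] at hshift
  have hf1 := norm_vInt_selE_le hL0.le hcs hfd hA (fun z hz ↦ hre z (by linarith))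
  have hf2 := norm_vInt_digamma_le (L := L) (s := s) hL0.le (by linarith : 0 < c) hc1 hcs
    (parity_nonneg χ)
  have hmain : 2 * (Real.pi : ℂ) * (L * (Dpoly χ x s + ℓ s)) =
      vInt (fun z ↦ f z * (selE L s z / (z - s) ^ 2)) c -
      vInt (fun z ↦ (1 / 2 * Complex.digamma ((z + parity χ) / 2)) *
        (selE L s z / (z - s) ^ 2)) c := by
    rw [hsplit, hconst]
    linear_combination hshift
  have hnorm := (congrArg norm hmain).le.trans ((norm_sub_le _ _).trans (add_le_add hf1 hf2))
  rw [norm_mul, norm_mul, norm_mul, Complex.norm_real, Complex.norm_real, Complex.norm_ofNat,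
    Real.norm_of_nonneg Real.pi_pos.le, Real.norm_of_nonneg hL0.le, ← mul_add] at hnorm
  exact le_of_mul_le_mul_left hnorm (by positivity)

lemma norm_Dpoly_add_logDeriv_le {χ : DirichletCharacter ℂ q} (hq : 1 < q)
    (hp : χ.IsPrimitive) (h : GRH χ) {x : ℝ} {s : ℂ} (hx : 1 < x) (hs : 1 / 2 < s.re) :
    Real.log x * ‖Dpoly χ x s + logDeriv (DirichletCharacter.LFunction χ) s‖ ≤
      (Real.exp (-(Real.log x * (s.re - 1 / 2))) + Real.exp (-(2 * Real.log x * (s.re - 1 / 2))))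
        / (s.re - 1 / 2) * (logDeriv (xiFun χ) s).re +
      (Real.exp (-(Real.log x * s.re)) + Real.exp (-(2 * Real.log x * s.re))) / 4 *
        ∑' k : ℕ, 1 / ‖(s + parity χ) / 2 + k‖ ^ 2 := by
  set T := (Real.exp (-(Real.log x * s.re)) + Real.exp (-(2 * Real.log x * s.re))) / 4 *
        ∑' k : ℕ, 1 / ‖(s + parity χ) / 2 + k‖ ^ 2 with hT
  have hcont : ContinuousAt (fun c : ℝ ↦ (Real.exp (-(Real.log x * (s.re - c))) +
      Real.exp (-(2 * Real.log x * (s.re - c)))) / (s.re - c) * (logDeriv (xiFun χ) s).re + T)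
      (1 / 2) := by
    have h1 : s.re - 1 / 2 ≠ 0 := by linarith
    refine ((ContinuousAt.div ?_ (by fun_prop) h1).mul continuousAt_const).add continuousAt_const
    fun_prop
  refine ge_of_tendsto (hcont.tendsto.mono_left nhdsWithin_le_nhds : Tendsto _ (𝓝[>] (1 / 2 : ℝ)) _) ?_
  filter_upwards [Ioo_mem_nhdsGT (lt_min hs (by norm_num : (1 / 2 : ℝ) < 1))] with c hc
  exact norm_Dpoly_add_logDeriv_le_of_lt hq hp h hx hc.1 (hc.2.le.trans (min_le_right _ _))
    (hc.2.trans_le (min_le_left _ _))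

end

section
open Filter MeasureTheory Set Topology

lemma tsum_one_div_norm_add_sq_le_two {w : ℂ} (hre : 1 / 4 ≤ w.re) (him : 1 ≤ w.im) :
    ∑' k : ℕ, 1 / ‖w + k‖ ^ 2 ≤ 2 := by
  have hk : ∀ k : ℕ, 1 / ‖w + k‖ ^ 2 ≤ 1 / (((k : ℝ) + 1 / 4) ^ 2 + 1) := by
    intro k
    refine one_div_le_one_div_of_le (by positivity) ?_
    have hk0 : (0 : ℝ) ≤ k := k.cast_nonneg
    rw [Complex.sq_norm, Complex.normSq_apply]
    simp only [Complex.add_re, Complex.natCast_re, Complex.add_im, Complex.natCast_im, add_zero]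
    nlinarith
  have hsum : ∀ n : ℕ, ∑ k ∈ Finset.range (n + 2), 1 / ‖w + k‖ ^ 2 ≤ 2 - 1 / ((n : ℝ) + 7 / 4) := by
    intro n
    induction n with
    | zero =>
      have h0 := hk 0
      have h1 := hk 1
      rw [Finset.sum_range_succ, Finset.sum_range_succ, Finset.sum_range_zero]
      norm_num at h0 h1 ⊢
      linarith
    | succ n ih =>
      rw [Finset.sum_range_succ]
      have h1 := hk (n + 2)
      have h2 : 1 / (((n + 2 : ℕ) : ℝ) + 1 / 4) ^ 2 ≤
          1 / ((n : ℝ) + 7 / 4) - 1 / (((n + 1 : ℕ) : ℝ) + 7 / 4) := by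
        push_cast
        rw [div_sub_div _ _ (by positivity) (by positivity), div_le_div_iff₀ (by positivity)
          (by positivity)]
        nlinarith [(n.cast_nonneg : (0 : ℝ) ≤ n)]
      have h3 : 1 / ((((n + 2 : ℕ) : ℝ) + 1 / 4) ^ 2 + 1) ≤ 1 / (((n + 2 : ℕ) : ℝ) + 1 / 4) ^ 2 :=
        one_div_le_one_div_of_le (by positivity) (by linarith)
      linarith
  refine Real.tsum_le_of_sum_range_le (fun k ↦ by positivity) fun n ↦ ?_
  have h1 : ∑ k ∈ Finset.range n, 1 / ‖w + k‖ ^ 2 ≤ ∑ k ∈ Finset.range (n + 2), 1 / ‖w + k‖ ^ 2 :=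
    Finset.sum_le_sum_of_subset_of_nonneg (Finset.range_mono (by omega)) fun _ _ _ ↦ by positivity
  have h2 : 0 ≤ 1 / ((n : ℝ) + 7 / 4) := by positivity
  linarith [hsum n]

lemma inv_exp_one_bounds : 0.3678 < 1 / Real.exp 1 ∧ 1 / Real.exp 1 < 0.3679 := by
  have h1 := Real.exp_one_gt_d9
  have h2 := Real.exp_one_lt_d9
  constructor
  · rw [lt_div_iff₀ (by positivity)]
    linarith
  · rw [div_lt_iff₀ (by positivity)]
    linarith

/-- The archimedean contribution to the explicit formula is at most `log (t + 1)`. -/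
lemma re_digamma_add_le {L t a : ℝ} (hL : Real.log 4 ≤ L) (ht : 2 ≤ t) (ha : 0 ≤ a) (ha1 : a ≤ 1)
    {s : ℂ} (hs : s = (1 / 2 + 1 / L : ℝ) + t * Complex.I) :
    (1 / Real.exp 1 + 1 / Real.exp 1 ^ 2) / 2 *
        ((Complex.digamma ((s + a) / 2)).re - Real.log Real.pi) +
      (Real.exp (-(L * s.re)) + Real.exp (-(2 * L * s.re))) / 4 *
        (∑' k : ℕ, 1 / ‖(s + a) / 2 + k‖ ^ 2) / L ≤
    (1 / Real.exp 1 + 1 / Real.exp 1 ^ 2) / 2 * Real.log (t + 1) := by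
  have hlog2 := Real.log_two_gt_d9
  have hlog4 : Real.log 4 = 2 * Real.log 2 := by
    rw [show (4 : ℝ) = 2 ^ 2 by norm_num, Real.log_pow]
    norm_num
  have hL1 : 1.386 ≤ L := by linarith
  have hL0 : 0 < L := by linarith
  have hLinv : 1 / L ≤ 0.73 := by
    rw [div_le_iff₀ hL0]
    linarith
  have hLinv0 : 0 < 1 / L := by positivity
  have hsre : s.re = 1 / 2 + 1 / L := by simp [hs]
  have hsim : s.im = t := by simp [hs]
  obtain ⟨he1, he2⟩ := inv_exp_one_bounds
  set e := 1 / Real.exp 1 with he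
  have he' : 1 / Real.exp 1 ^ 2 = e ^ 2 := by rw [he, div_pow, one_pow]
  rw [he']
  have hκ : 0.503 ≤ e + e ^ 2 := by nlinarith
  set w := (s + a) / 2 with hw
  have hwre : w.re = (s.re + a) / 2 := by
    rw [hw, Complex.div_ofNat_re, Complex.add_re, Complex.ofReal_re]
  have hwim : w.im = t / 2 := by
    rw [hw, Complex.div_ofNat_im, Complex.add_im, Complex.ofReal_im, hsim, add_zero]
  have hw0 : 0 < w.re := by
    rw [hwre]
    linarith
  have hS := tsum_one_div_norm_add_sq_le_two (w := w) (by rw [hwre]; linarith)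
    (by rw [hwim]; linarith)
  have hψ := re_digamma_le hw0
  set S := ∑' k : ℕ, 1 / ‖w + k‖ ^ 2 with hSdef
  have hS0 : 0 ≤ S := tsum_nonneg fun k ↦ by positivity
  have hu : Real.exp (-(L * s.re)) ≤ 1 / 2 * e := by
    have h1 : -(L * s.re) = -(L / 2) + -1 := by
      rw [hsre]
      field_simp
      ring
    rw [h1, Real.exp_add]
    have h2 : Real.exp (-(L / 2)) ≤ 1 / 2 := by
      calc Real.exp (-(L / 2)) ≤ Real.exp (-Real.log 2) := Real.exp_le_exp.mpr (by linarith)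
        _ = 1 / 2 := by rw [Real.exp_neg, Real.exp_log two_pos, one_div]
    have h3 : Real.exp (-1) = e := by rw [Real.exp_neg, he, one_div]
    rw [h3]
    exact mul_le_mul_of_nonneg_right h2 (by linarith)
  have hu2 : Real.exp (-(2 * L * s.re)) = Real.exp (-(L * s.re)) ^ 2 := by
    rw [← Real.exp_nat_mul]
    congr 1
    push_cast
    ring
  rw [hu2]
  set u := Real.exp (-(L * s.re)) with hudef
  have hu0 : 0 < u := Real.exp_pos _
  have hu1 : u + u ^ 2 ≤ 0.2179 := by nlinarith
  have hT : (u + u ^ 2) / 4 * S / L ≤ 0.079 := by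
    rw [div_le_iff₀ hL0]
    have : (u + u ^ 2) / 4 * S ≤ 0.2179 / 4 * 2 := by gcongr
    linarith
  have hwn : ‖w‖ ≤ (2.23 + t) / 2 := by
    have h1 := Complex.norm_le_abs_re_add_abs_im w
    rw [abs_of_pos hw0, abs_of_nonneg (by rw [hwim]; linarith), hwre, hwim] at h1
    linarith
  have hwn0 : 0 < ‖w‖ := hw0.trans_le ((le_abs_self _).trans (Complex.abs_re_le_norm w))
  have hπ := Real.pi_gt_d2
  have hfin : Real.log 4 + Real.log ‖w‖ ≤ Real.log Real.pi + Real.log (t + 1) := by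
    rw [← Real.log_mul (by norm_num) hwn0.ne', ← Real.log_mul Real.pi_ne_zero (by linarith)]
    exact Real.log_le_log (by positivity) (by nlinarith)
  have hψ2 : (Complex.digamma w).re - Real.log Real.pi ≤ Real.log (t + 1) - 0.32 := by linarith
  nlinarith [mul_le_mul_of_nonneg_left hψ2 (by linarith : 0 ≤ (e + e ^ 2) / 2)]

end

theorem M2_estimate :
    ∃ C : ℝ, 0 < C ∧
      ∀ (q : ℕ) [NeZero q] (χ : DirichletCharacter ℂ q), 1 < q → χ.IsPrimitive → GRH χ →
        ∀ t : ℝ, 2 ≤ t → ∀ x : ℝ, 4 ≤ x → x ≤ t ^ 2 →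
          ‖(((1 / 2 + 1 / Real.log x : ℝ) - 1 / 2 : ℝ) : ℂ)
              * logDeriv (DirichletCharacter.LFunction χ)
                  ((1 / 2 + 1 / Real.log x : ℝ) + t * Complex.I)‖
            ≤ ((1 / Real.exp 1 + 1 / (Real.exp 1) ^ 2)
                  / (1 - (1 / Real.exp 1) * (1 + 1 / Real.exp 1)))
                * (1 / 2) * (Real.log (q * (t + 1)) / Real.log x)
              + C * (1 / Real.log x)
                  * ‖Dpoly χ x ((1 / 2 + 1 / Real.log x : ℝ) + t * Complex.I)‖ := by
  obtain ⟨he1, he2⟩ := inv_exp_one_bounds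
  have he' : 1 / Real.exp 1 ^ 2 = (1 / Real.exp 1) ^ 2 := by rw [div_pow, one_pow]
  have hκ : 0 < 1 - 1 / Real.exp 1 * (1 + 1 / Real.exp 1) := by nlinarith
  refine ⟨1 / (1 - 1 / Real.exp 1 * (1 + 1 / Real.exp 1)), by positivity,
    fun q _ χ hq hp hG t ht x hx _ ↦ ?_⟩
  have hL : Real.log 4 ≤ Real.log x := Real.log_le_log (by norm_num) hx
  have hL0 : 0 < Real.log x := Real.log_pos (by linarith)
  have hq0 : (0 : ℝ) < q := by exact_mod_cast (by omega : 0 < q)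
  set s : ℂ := (1 / 2 + 1 / Real.log x : ℝ) + t * Complex.I with hs
  have hsre : s.re = 1 / 2 + 1 / Real.log x := by simp [hs]
  have hs2 : 1 / 2 < s.re := by
    rw [hsre]
    have : 0 < 1 / Real.log x := by positivity
    linarith
  have harch := re_digamma_add_le hL ht (parity_nonneg χ) (parity_le_one χ) hs
  have hmain := norm_Dpoly_add_logDeriv_le hq hp hG (by linarith : 1 < x) hs2
  rw [logDeriv_xiFun (ne_one_of_isPrimitive hq hp) (by linarith)
    (LFunction_ne_zero_of_GRH (ne_one_of_isPrimitive hq hp) hG hs2)] at hmain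
  set ℓ := logDeriv (DirichletCharacter.LFunction χ) s with hℓ
  set D := Dpoly χ x s with hD
  set T := (Real.exp (-(Real.log x * s.re)) + Real.exp (-(2 * Real.log x * s.re))) / 4 *
    ∑' k : ℕ, 1 / ‖(s + parity χ) / 2 + k‖ ^ 2 with hT
  set ψ := Complex.digamma ((s + parity χ) / 2) with hψ
  have h1 : s.re - 1 / 2 = 1 / Real.log x := by
    rw [hsre]
    ring
  have h2 : Real.log x * (1 / Real.log x) = 1 := by field_simp
  have h3 : (1 / 2 * ψ).re = 1 / 2 * ψ.re := by
    rw [show (1 / 2 : ℂ) = ((1 / 2 : ℝ) : ℂ) by norm_num, Complex.re_ofReal_mul]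
  have h4 : Real.exp (-1) + Real.exp (-(2 * 1)) = 1 / Real.exp 1 + 1 / Real.exp 1 ^ 2 := by
    rw [← Real.exp_nat_mul, one_div, one_div, ← Real.exp_neg, ← Real.exp_neg]
    norm_num
  rw [h1, mul_assoc 2, h2, h4, Complex.add_re, Complex.add_re, h3, Complex.ofReal_re] at hmain
  set κ := 1 / Real.exp 1 + 1 / Real.exp 1 ^ 2 with hκdef
  have hden : 1 - 1 / Real.exp 1 * (1 + 1 / Real.exp 1) = 1 - κ := by
    rw [hκdef, he']
    ring
  rw [hden] at hκ ⊢
  have hκ0 : 0 < κ := by positivity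
  have h5 : ‖D + ℓ‖ ≤ κ * ((Real.log q - Real.log Real.pi) / 2 + 1 / 2 * ψ.re + ℓ.re) +
      T / Real.log x := by
    refine le_of_mul_le_mul_left (hmain.trans (le_of_eq ?_)) hL0
    field_simp
  have h6 : ‖ℓ‖ ≤ ‖D + ℓ‖ + ‖D‖ := by
    have := norm_sub_le (D + ℓ) D
    rwa [add_sub_cancel_left] at this
  have h7 : κ * ℓ.re ≤ κ * ‖ℓ‖ := mul_le_mul_of_nonneg_left (Complex.re_le_norm ℓ) hκ0.le
  have hlog : Real.log (q * (t + 1)) = Real.log q + Real.log (t + 1) :=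
    Real.log_mul hq0.ne' (by linarith)
  have h8 : (1 - κ) * ‖ℓ‖ ≤ κ * (1 / 2) * Real.log (q * (t + 1)) + ‖D‖ := by
    rw [hlog]
    linarith
  have h9 : (1 / 2 + 1 / Real.log x) - 1 / 2 = 1 / Real.log x := by ring
  rw [h9, norm_mul, Complex.norm_real, Real.norm_of_nonneg (by positivity)]
  calc 1 / Real.log x * ‖ℓ‖
      ≤ 1 / Real.log x * ((κ * (1 / 2) * Real.log (q * (t + 1)) + ‖D‖) / (1 - κ)) := by
        refine mul_le_mul_of_nonneg_left ?_ (by positivity)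
        rw [le_div_iff₀ hκ]
        linarith
    _ = _ := by ring
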